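/- arXiv:2408.01666 — 11 statements merged into one kernel-verified Lean document; each statement's English description precedes it below -/
import Mathlib

section
/- Suppose a ≡ 0 (mod 2). If b ≡ 0 (mod 4), then for k = 1,2,3 the permutations σ_k and τ_k are even (have sign +1). If instead b ≡ 2 (mod 4), then for k = 1,2,3 the permutations σ_k and τ_k are odd (have sign −1). -/
/-- A permutation cycling through the `m + 1` values of an embedding and fixing everything else
has sign `(-1) ^ m`. -/
theorem sign_eq_of_embedding {α : Type*} [Fintype α] [DecidableEq α] {m : ℕ}
    (f : Fin (m + 1) ↪ α) (p : Equiv.Perm α) (hf : ∀ k, p (f k) = f (finRotate (m + 1) k))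
    (hfix : ∀ x, x ∉ Set.range f → p x = x) : Equiv.Perm.sign p = (-1) ^ m := by
  have hp : p = (finRotate (m + 1)).viaFintypeEmbedding f := by
    ext1 x
    by_cases hx : x ∈ Set.range f
    · obtain ⟨k, rfl⟩ := hx
      rw [hf, Equiv.Perm.viaFintypeEmbedding_apply_image]
    · rw [hfix x hx, Equiv.Perm.viaFintypeEmbedding_apply_notMem_range _ _ hx]
  rw [hp, Equiv.Perm.viaFintypeEmbedding_sign, sign_finRotate, Nat.add_sub_cancel]

/-- The sign of a permutation of `Fin N` cycling through `c 0, …, c m` and fixing the rest. -/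
theorem sign_eq_of_cycle_values {N m : ℕ} (p : Equiv.Perm (Fin N)) (c : ℕ → ℕ)
    (hlt : ∀ k ≤ m, c k < N) (hinj : ∀ k ≤ m, ∀ l ≤ m, c k = c l → k = l)
    (hstep : ∀ i : Fin N, ∀ k < m, (i : ℕ) = c k → (p i : ℕ) = c (k + 1))
    (hlast : ∀ i : Fin N, (i : ℕ) = c m → (p i : ℕ) = c 0)
    (hfix : ∀ i : Fin N, (∀ k ≤ m, (i : ℕ) ≠ c k) → p i = i) :
    Equiv.Perm.sign p = (-1) ^ m := by
  refine sign_eq_of_embedding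
    ⟨fun k : Fin (m + 1) => ⟨c k, hlt k (Nat.le_of_lt_succ k.2)⟩, fun k l h => ?_⟩ p
    (fun k => ?_) (fun i hi => hfix i fun k hk h => hi ⟨⟨k, Nat.lt_succ_of_le hk⟩, ?_⟩)
  · exact Fin.ext (hinj k (Nat.le_of_lt_succ k.2) l (Nat.le_of_lt_succ l.2)
      (congrArg Fin.val h))
  · apply Fin.ext
    change _ = c (finRotate (m + 1) k : Fin (m + 1))
    rw [coe_finRotate]
    split_ifs with hk
    · exact hlast _ (by subst hk; rfl)
    · exact hstep _ k (Fin.val_lt_last hk) rfl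
  · exact Fin.ext h.symm

/-- The sign of a fixed-point-free involution. -/
theorem sign_eq_of_involutive_of_forall_ne {N : ℕ} (p : Equiv.Perm (Fin N))
    (hp : ∀ i, p (p i) = i) (hne : ∀ i, p i ≠ i) : Equiv.Perm.sign p = (-1) ^ (N / 2) := by
  have hsq : p ^ 2 = 1 := by
    ext1 i
    simp [pow_two, hp]
  have hfixed : IsEmpty (Function.fixedPoints p) := ⟨fun i => hne i i.2⟩
  rw [Equiv.Perm.sign_of_pow_two_eq_one hsq, Fintype.card_fin,
    Fintype.card_eq_zero (α := Function.fixedPoints p), Nat.sub_zero]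

/-- The cycle `(0, 1, …, a + 1)` is odd for `a` even. -/
theorem sign_p1 (a b : ℕ) (haeven : a % 2 = 0)
    (p1 : Equiv.Perm (Fin (2*a+b+2)))
    (hp1 : ∀ i : Fin (2*a+b+2), (p1 i : ℕ) =
      if (i : ℕ) ≤ a then (i : ℕ) + 1
      else if (i : ℕ) = a+1 then 0
      else (i : ℕ)) :
    Equiv.Perm.sign p1 = -1 := by
  rw [sign_eq_of_cycle_values (m := a + 1) p1 (fun k => k), Odd.neg_one_pow (by grind)]
  · omega
  · omega
  · intro i k hk h
    grind
  · intro i h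
    grind
  · intro i h
    have := h i
    apply Fin.ext
    grind

/-- The cycle `(0, 2a + 2, …, 2a + b + 1, a + 1)` is odd for `b` even. -/
theorem sign_p2 (a b : ℕ) (hb : b % 2 = 0)
    (p2 : Equiv.Perm (Fin (2*a+b+2)))
    (hp2 : ∀ i : Fin (2*a+b+2), (p2 i : ℕ) =
      if (i : ℕ) = 0 then (if b = 0 then a+1 else 2*a+2)
      else if (i : ℕ) = a+1 then 0
      else if 2*a+2 ≤ (i : ℕ) ∧ (i : ℕ) ≤ 2*a+b then (i : ℕ) + 1
      else if (i : ℕ) = 2*a+b+1 ∧ b ≠ 0 then a+1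
      else (i : ℕ)) :
    Equiv.Perm.sign p2 = -1 := by
  rw [sign_eq_of_cycle_values (m := b + 1) p2
    (fun k => if k = 0 then 0 else if k = b + 1 then a + 1 else 2 * a + 1 + k),
    Odd.neg_one_pow (by grind)]
  · grind
  · grind
  · intro i k hk h
    rw [hp2 i]
    clear hp2
    grind
  · intro i h
    rw [hp2 i]
    clear hp2
    grind
  · intro i h
    have := h 0
    have := h (b + 1)
    have := h (i - (2 * a + 1))
    apply Fin.ext
    rw [hp2 i]
    clear hp2
    grind

/-- The cycle `(0, 2a + 1, 2a, …, a + 1)` is odd for `a` even. -/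
theorem sign_p3 (a b : ℕ) (haeven : a % 2 = 0)
    (p3 : Equiv.Perm (Fin (2*a+b+2)))
    (hp3 : ∀ i : Fin (2*a+b+2), (p3 i : ℕ) =
      if (i : ℕ) = 0 then 2*a+1
      else if a+2 ≤ (i : ℕ) ∧ (i : ℕ) ≤ 2*a+1 then (i : ℕ) - 1
      else if (i : ℕ) = a+1 then 0
      else (i : ℕ)) :
    Equiv.Perm.sign p3 = -1 := by
  rw [sign_eq_of_cycle_values (m := a + 1) p3 (fun k => if k = 0 then 0 else 2 * a + 2 - k),
    Odd.neg_one_pow (by grind)]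
  · grind
  · grind
  · intro i k hk h
    grind
  · intro i h
    grind
  · intro i h
    have := h 0
    have := h (2 * a + 2 - i)
    apply Fin.ext
    grind

/-- For `b` even, `ρ` is a fixed-point-free involution, which determines its sign. -/
theorem sign_ρ (a b : ℕ) (hb : b % 2 = 0)
    (ρ : Equiv.Perm (Fin (2*a+b+2)))
    (hρ : ∀ i : Fin (2*a+b+2), (ρ i : ℕ) =
      if (i : ℕ) ≤ 2*a+1 then ((i : ℕ) + a + 1) % (2*a+2) else 4*a+b+3 - (i : ℕ)) :
    Equiv.Perm.sign ρ = (-1) ^ ((2*a+b+2) / 2) := by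
  have hρ' : ∀ i : Fin (2*a+b+2), (ρ i : ℕ) =
      if (i : ℕ) ≤ a then (i : ℕ) + a + 1
      else if (i : ℕ) ≤ 2*a+1 then (i : ℕ) - (a + 1) else 4*a+b+3 - (i : ℕ) := by
    intro i
    rw [hρ]
    split_ifs with h1 h2 h2
    · exact Nat.mod_eq_of_lt (by omega)
    · rw [Nat.mod_eq_sub_mod (by omega), Nat.mod_eq_of_lt (by omega)]
      omega
    · omega
    · rfl
  apply sign_eq_of_involutive_of_forall_ne
  · intro i
    apply Fin.ext
    grind
  · intro i h
    have := congrArg Fin.val h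
    grind

/-- For `a` and `b` even, `ψ` is a fixed-point-free involution, which determines its sign. -/
theorem sign_ψ (a b : ℕ) (haeven : a % 2 = 0) (hb : b % 2 = 0)
    (ψ : Equiv.Perm (Fin (2*a+b+2)))
    (hψ : ∀ i : Fin (2*a+b+2), (ψ i : ℕ) =
      if (i : ℕ) ≤ a+1 then a+1 - (i : ℕ)
      else if (i : ℕ) ≤ 2*a+1 then 3*a+3 - (i : ℕ)
      else 4*a+b+3 - (i : ℕ)) :
    Equiv.Perm.sign ψ = (-1) ^ ((2*a+b+2) / 2) := by
  apply sign_eq_of_involutive_of_forall_ne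
  · intro i
    apply Fin.ext
    grind
  · intro i h
    have := congrArg Fin.val h
    grind

theorem signs_a_even (a b : ℕ) (ha : 1 ≤ a) (haeven : a % 2 = 0)
    (ρ ψ p1 p2 p3 : Equiv.Perm (Fin (2*a+b+2)))
    (hρ : ∀ i : Fin (2*a+b+2), (ρ i : ℕ) =
      if (i : ℕ) ≤ 2*a+1 then ((i : ℕ) + a + 1) % (2*a+2) else 4*a+b+3 - (i : ℕ))
    (hψ : ∀ i : Fin (2*a+b+2), (ψ i : ℕ) =
      if (i : ℕ) ≤ a+1 then a+1 - (i : ℕ)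
      else if (i : ℕ) ≤ 2*a+1 then 3*a+3 - (i : ℕ)
      else 4*a+b+3 - (i : ℕ))
    (hp1 : ∀ i : Fin (2*a+b+2), (p1 i : ℕ) =
      if (i : ℕ) ≤ a then (i : ℕ) + 1
      else if (i : ℕ) = a+1 then 0
      else (i : ℕ))
    (hp2 : ∀ i : Fin (2*a+b+2), (p2 i : ℕ) =
      if (i : ℕ) = 0 then (if b = 0 then a+1 else 2*a+2)
      else if (i : ℕ) = a+1 then 0
      else if 2*a+2 ≤ (i : ℕ) ∧ (i : ℕ) ≤ 2*a+b then (i : ℕ) + 1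
      else if (i : ℕ) = 2*a+b+1 ∧ b ≠ 0 then a+1
      else (i : ℕ))
    (hp3 : ∀ i : Fin (2*a+b+2), (p3 i : ℕ) =
      if (i : ℕ) = 0 then 2*a+1
      else if a+2 ≤ (i : ℕ) ∧ (i : ℕ) ≤ 2*a+1 then (i : ℕ) - 1
      else if (i : ℕ) = a+1 then 0
      else (i : ℕ))
    :
    (b % 4 = 0 → ∀ p ∈ [p1, p2, p3],
      Equiv.Perm.sign (p * ρ) = 1 ∧ Equiv.Perm.sign (p * ψ) = 1) ∧
    (b % 4 = 2 → ∀ p ∈ [p1, p2, p3],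
      Equiv.Perm.sign (p * ρ) = -1 ∧ Equiv.Perm.sign (p * ψ) = -1) := by
  have hcyc : b % 2 = 0 → ∀ p ∈ [p1, p2, p3], Equiv.Perm.sign p = -1 := by
    intro hb
    simp only [List.forall_mem_cons]
    exact ⟨sign_p1 a b haeven p1 hp1, sign_p2 a b hb p2 hp2, sign_p3 a b haeven p3 hp3, by simp⟩
  refine ⟨fun hb p hp => ?_, fun hb p hp => ?_⟩
  · have hs : Equiv.Perm.sign p = -1 := hcyc (by omega) p hp
    rw [map_mul, map_mul, hs, sign_ρ a b (by omega) ρ hρ, sign_ψ a b haeven (by omega) ψ hψ,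
      Odd.neg_one_pow (by grind)]
    simp
  · have hs : Equiv.Perm.sign p = -1 := hcyc (by omega) p hp
    rw [map_mul, map_mul, hs, sign_ρ a b (by omega) ρ hρ, sign_ψ a b haeven (by omega) ψ hψ,
      Even.neg_one_pow (by grind)]
    simp
end

section
/- Suppose a ≡ 1 (mod 2). If b ≡ 1 (mod 4), then for k = 1,2,3 the permutations σ_k are even (sign +1) and the permutations τ_k are odd (sign −1). If instead b ≡ 3 (mod 4), then for k = 1,2,3 the permutations σ_k are odd and the permutations τ_k are even. -/
/-- The reversal `s + j ↦ s + (m - 1 - j)` of the block `[s, s + m)` of `Fin N`. -/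
def blockReversal {N : ℕ} (s m : ℕ) (h : s + m ≤ N) : Equiv.Perm (Fin N) :=
  Function.Involutive.toPerm
    (fun i => ⟨if s ≤ (i : ℕ) ∧ (i : ℕ) < s + m then 2 * s + m - 1 - i else i, by
      have := i.isLt; split_ifs <;> omega⟩)
    (fun i => by ext; dsimp only; split_ifs <;> omega)

lemma coe_blockReversal {N : ℕ} (s m : ℕ) (h : s + m ≤ N) (i : Fin N) :
    (blockReversal s m h i : ℕ) =
      if s ≤ (i : ℕ) ∧ (i : ℕ) < s + m then 2 * s + m - 1 - i else i := rfl

lemma coe_swap {N : ℕ} (x y i : Fin N) :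
    (Equiv.swap x y i : ℕ) = if (i : ℕ) = x then (y : ℕ) else if (i : ℕ) = y then (x : ℕ) else i := by
  simp only [Equiv.swap_apply_def, Fin.ext_iff]
  split_ifs <;> rfl

lemma blockReversal_eq_one {N : ℕ} (s m : ℕ) (h : s + m ≤ N) (hm : m ≤ 1) :
    blockReversal s m h = 1 := by
  ext i
  rw [coe_blockReversal, Equiv.Perm.one_apply]
  split_ifs <;> omega

lemma sign_blockReversal {N : ℕ} (s m : ℕ) (h : s + m ≤ N) :
    Equiv.Perm.sign (blockReversal s m h) = (-1) ^ (m / 2) := by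
  induction m using Nat.twoStepInduction generalizing s with
  | zero => simp [blockReversal_eq_one]
  | one => simp [blockReversal_eq_one]
  | more m ih _ =>
    have hpeel : blockReversal s (m + 2) h =
        Equiv.swap ⟨s, by omega⟩ ⟨s + m + 1, by omega⟩ * blockReversal (s + 1) m (by omega) := by
      ext i
      simp only [Equiv.Perm.mul_apply, coe_swap, coe_blockReversal]
      split_ifs <;> omega
    rw [hpeel, Equiv.Perm.sign_mul, ih, Equiv.Perm.sign_swap (by simp [Fin.ext_iff]; omega),
      show (m + 2) / 2 = m / 2 + 1 by omega, pow_succ']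


/-- Rotation by half the length on `[0, 2a + 2)`, times the reversal of the remaining block. -/
lemma sign_rotation_mul_reversal (a b : ℕ) (haodd : a % 2 = 1)
    (ρ : Equiv.Perm (Fin (2*a+b+2)))
    (hρ : ∀ i : Fin (2*a+b+2), (ρ i : ℕ) =
      if (i : ℕ) ≤ 2*a+1 then ((i : ℕ) + a + 1) % (2*a+2) else 4*a+b+3 - (i : ℕ)) :
    Equiv.Perm.sign ρ = (-1) ^ (b / 2) := by
  have hfac : ρ = blockReversal (2 * a + 2) b (by omega) *
      (blockReversal 0 (2 * a + 2) (by omega) *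
      (blockReversal 0 (a + 1) (by omega) * blockReversal (a + 1) (a + 1) (by omega))) := by
    ext i
    have hmod : (i : ℕ) ≤ 2 * a + 1 → ((i : ℕ) + a + 1) % (2 * a + 2) =
        if (i : ℕ) ≤ a then (i : ℕ) + a + 1 else (i : ℕ) - (a + 1) := by
      intro hi
      split_ifs with hia
      · exact Nat.mod_eq_of_lt (by omega)
      · rw [Nat.mod_eq_sub_mod (by omega), Nat.mod_eq_of_lt (by omega)]
        omega
    have hi := hρ i
    simp only [Equiv.Perm.mul_apply]
    have h₁ := coe_blockReversal (a + 1) (a + 1) (by omega) i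
    generalize blockReversal (a + 1) (a + 1) _ i = j at h₁ ⊢
    have h₂ := coe_blockReversal 0 (a + 1) (by omega) j
    generalize blockReversal 0 (a + 1) _ j = k at h₂ ⊢
    have h₃ := coe_blockReversal 0 (2 * a + 2) (by omega) k
    generalize blockReversal 0 (2 * a + 2) _ k = l at h₃ ⊢
    rw [coe_blockReversal]
    generalize ((i : ℕ) + a + 1) % (2 * a + 2) = r at hmod hi
    split_ifs at hi h₁ h₂ h₃ ⊢ <;> grind
  simp only [hfac, Equiv.Perm.sign_mul, sign_blockReversal]
  have heven : Even ((2 * a + 2) / 2 + ((a + 1) / 2 + (a + 1) / 2)) := by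
    rw [Nat.even_iff]; omega
  rw [← pow_add, ← pow_add, heven.neg_one_pow, mul_one]

/-- The cycle `(0, 2a + 2, …, 2a + b + 1, a + 1)` has odd length `b + 2`. -/
lemma sign_middle_cycle (a b : ℕ) (hb : b % 2 = 1)
    (p2 : Equiv.Perm (Fin (2*a+b+2)))
    (hp2 : ∀ i : Fin (2*a+b+2), (p2 i : ℕ) =
      if (i : ℕ) = 0 then (if b = 0 then a+1 else 2*a+2)
      else if (i : ℕ) = a+1 then 0
      else if 2*a+2 ≤ (i : ℕ) ∧ (i : ℕ) ≤ 2*a+b then (i : ℕ) + 1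
      else if (i : ℕ) = 2*a+b+1 ∧ b ≠ 0 then a+1
      else (i : ℕ)) :
    Equiv.Perm.sign p2 = 1 := by
  have hfac : p2 = Equiv.swap ⟨0, by omega⟩ ⟨a + 1, by omega⟩ *
      Equiv.swap ⟨0, by omega⟩ ⟨2 * a + 2, by omega⟩ *
      blockReversal (2 * a + 2) b (by omega) *
      blockReversal (2 * a + 2) (b - 1) (by omega) := by
    ext i
    have hi := hp2 i
    simp only [Equiv.Perm.mul_apply]
    have h₁ := coe_blockReversal (2 * a + 2) (b - 1) (by omega) i
    generalize blockReversal (2 * a + 2) (b - 1) _ i = j at h₁ ⊢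
    have h₂ := coe_blockReversal (2 * a + 2) b (by omega) j
    generalize blockReversal (2 * a + 2) b _ j = k at h₂ ⊢
    have h₃ := coe_swap ⟨0, by omega⟩ ⟨2 * a + 2, by omega⟩ k
    generalize Equiv.swap _ _ k = l at h₃ ⊢
    rw [coe_swap]
    dsimp only at h₃ ⊢
    split_ifs at hi h₁ h₂ h₃ ⊢ <;> omega
  simp only [hfac, Equiv.Perm.sign_mul, sign_blockReversal]
  rw [Equiv.Perm.sign_swap (by simp [Fin.ext_iff]), Equiv.Perm.sign_swap (by simp [Fin.ext_iff]),
    ← pow_two, ← pow_add, ← pow_add]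
  exact Even.neg_one_pow (by rw [Nat.even_iff]; omega)

theorem signs_a_odd (a b : ℕ) (ha : 1 ≤ a) (haodd : a % 2 = 1)
    (ρ ψ p1 p2 p3 : Equiv.Perm (Fin (2*a+b+2)))
    (hρ : ∀ i : Fin (2*a+b+2), (ρ i : ℕ) =
      if (i : ℕ) ≤ 2*a+1 then ((i : ℕ) + a + 1) % (2*a+2) else 4*a+b+3 - (i : ℕ))
    (hψ : ∀ i : Fin (2*a+b+2), (ψ i : ℕ) =
      if (i : ℕ) ≤ a+1 then a+1 - (i : ℕ)
      else if (i : ℕ) ≤ 2*a+1 then 3*a+3 - (i : ℕ)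
      else 4*a+b+3 - (i : ℕ))
    (hp1 : ∀ i : Fin (2*a+b+2), (p1 i : ℕ) =
      if (i : ℕ) ≤ a then (i : ℕ) + 1
      else if (i : ℕ) = a+1 then 0
      else (i : ℕ))
    (hp2 : ∀ i : Fin (2*a+b+2), (p2 i : ℕ) =
      if (i : ℕ) = 0 then (if b = 0 then a+1 else 2*a+2)
      else if (i : ℕ) = a+1 then 0
      else if 2*a+2 ≤ (i : ℕ) ∧ (i : ℕ) ≤ 2*a+b then (i : ℕ) + 1
      else if (i : ℕ) = 2*a+b+1 ∧ b ≠ 0 then a+1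
      else (i : ℕ))
    (hp3 : ∀ i : Fin (2*a+b+2), (p3 i : ℕ) =
      if (i : ℕ) = 0 then 2*a+1
      else if a+2 ≤ (i : ℕ) ∧ (i : ℕ) ≤ 2*a+1 then (i : ℕ) - 1
      else if (i : ℕ) = a+1 then 0
      else (i : ℕ))
    :
    (b % 4 = 1 → ∀ p ∈ [p1, p2, p3],
      Equiv.Perm.sign (p * ρ) = 1 ∧ Equiv.Perm.sign (p * ψ) = -1) ∧
    (b % 4 = 3 → ∀ p ∈ [p1, p2, p3],
      Equiv.Perm.sign (p * ρ) = -1 ∧ Equiv.Perm.sign (p * ψ) = 1) := by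
  have hs1 : Equiv.Perm.sign p1 = 1 := by
    have hfac : p1 = blockReversal 0 (a + 2) (by omega) * blockReversal 0 (a + 1) (by omega) := by
      ext i
      simp only [Equiv.Perm.mul_apply, coe_blockReversal, hp1]
      split_ifs <;> omega
    rw [hfac, Equiv.Perm.sign_mul, sign_blockReversal, sign_blockReversal, ← pow_add]
    exact Even.neg_one_pow (by rw [Nat.even_iff]; omega)
  have hs3 : Equiv.Perm.sign p3 = 1 := by
    have hfac : p3 = blockReversal (a + 1) a (by omega) * blockReversal (a + 1) (a + 1) (by omega) *
        Equiv.swap ⟨0, by omega⟩ ⟨a + 1, by omega⟩ := by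
      ext i
      simp only [Equiv.Perm.mul_apply, coe_blockReversal, coe_swap, hp3]
      split_ifs <;> omega
    rw [hfac, Equiv.Perm.sign_mul, Equiv.Perm.sign_mul, sign_blockReversal, sign_blockReversal,
      Equiv.Perm.sign_swap (by simp [Fin.ext_iff]), ← pow_add, ← pow_succ]
    exact Even.neg_one_pow (by rw [Nat.even_iff]; omega)
  have hs2 (hb : b % 2 = 1) := sign_middle_cycle a b hb p2 hp2
  have hsρ := sign_rotation_mul_reversal a b haodd ρ hρ
  have hsψ : Equiv.Perm.sign ψ = -(-1) ^ (b / 2) := by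
    have hfac : ψ = blockReversal (2 * a + 2) b (by omega) *
        (blockReversal 0 (a + 2) (by omega) * blockReversal (a + 2) a (by omega)) := by
      ext i
      simp only [Equiv.Perm.mul_apply, coe_blockReversal, hψ]
      split_ifs <;> omega
    simp only [hfac, Equiv.Perm.sign_mul, sign_blockReversal]
    have hodd : Odd ((a + 2) / 2 + a / 2) := by rw [Nat.odd_iff]; omega
    rw [← pow_add, hodd.neg_one_pow, mul_neg_one]
  have hsp (hb : b % 2 = 1) : ∀ p ∈ [p1, p2, p3], Equiv.Perm.sign p = 1 := by
    simp [hs1, hs2 hb, hs3]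
  refine ⟨fun hb p hp => ?_, fun hb p hp => ?_⟩
  · have heven : Even (b / 2) := by rw [Nat.even_iff]; omega
    simp [hsp (by omega) p hp, hsρ, hsψ, heven.neg_one_pow]
  · have hodd : Odd (b / 2) := by rw [Nat.odd_iff]; omega
    simp [hsp (by omega) p hp, hsρ, hsψ, hodd.neg_one_pow]
end

section
/- Suppose a+b is odd and (a,b) ≠ (2,1). Then the subgroup of Perm(Fin (n+1)) generated by S1 = {σ_1, σ_2, σ_3} equals the stabilizer {π ∈ Perm(Fin (n+1)) | π(0) = 0} of the point 0, and likewise the subgroup generated by S2 = {τ_1, τ_2, τ_3} equals the stabilizer of 0. (In particular each of S1 and S2 generates a copy of the symmetric group of degree n.) -/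
open Equiv Equiv.Perm

section SwapProducts

variable {α : Type*} [DecidableEq α] {H : Subgroup (Perm α)}

theorem conj_swap_mul_swap_mem {g : Perm α} (hg : g ∈ H) {i j k l : α}
    (h : swap i j * swap k l ∈ H) : swap (g i) (g j) * swap (g k) (g l) ∈ H := by
  have : swap (g i) (g j) * swap (g k) (g l) = g * (swap i j * swap k l) * g⁻¹ := by
    rw [swap_apply_apply, swap_apply_apply]; group
  rw [this]
  exact H.mul_mem (H.mul_mem hg h) (H.inv_mem hg)

theorem swap_mul_swap_mem_symm {i j k l : α} (h : swap i j * swap k l ∈ H) :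
    swap k l * swap i j ∈ H := by
  simpa using H.inv_mem h

/-- Two double transpositions whose supports share exactly one point `s` yield a 3-cycle. -/
theorem threeCycle_mem_of_double_swaps {s u v p p' q q' : α}
    (hnd : [s, u, v, p, p', q, q'].Nodup)
    (h₁ : swap u s * swap p p' ∈ H) (h₂ : swap v s * swap q q' ∈ H) :
    swap u s * swap u v ∈ H := by
  have h := H.mul_mem (H.mul_mem h₁ h₂) (H.mul_mem h₁ h₂)
  convert h using 1
  simp only [List.nodup_cons, List.mem_cons, not_or, List.not_mem_nil] at hnd
  ext z
  simp only [Perm.mul_apply]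
  grind (splits := 40)

/-- The points `i` and `j` are equal or `swap i j * d` lies in `H`. -/
def SwapRel (H : Subgroup (Perm α)) (d : Perm α) (i j : α) : Prop :=
  i = j ∨ swap i j * d ∈ H

theorem SwapRel.symm {d : Perm α} {i j : α} (h : SwapRel H d i j) : SwapRel H d j i := by
  rcases h with h | h
  · exact .inl h.symm
  · exact .inr (by rwa [swap_comm])

theorem SwapRel.trans {u v i j k : α} (h₁ : SwapRel H (swap u v) i j)
    (h₂ : SwapRel H (swap u v) j k) : SwapRel H (swap u v) i k := by
  rcases h₁ with rfl | h₁
  · exact h₂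
  rcases h₂ with rfl | h₂
  · exact .inr h₁
  by_cases hik : i = k
  · exact .inl hik
  by_cases hjk : j = k
  · subst hjk; exact .inr h₁
  right
  have h := H.mul_mem (H.mul_mem h₁ (H.inv_mem h₂)) h₁
  have e : swap i k = swap i j * swap j k * swap i j := by
    rw [swap_comm i j, swap_comm j k, swap_mul_swap_mul_swap (Ne.symm hjk) (Ne.symm hik)]
  rw [e]
  simpa [mul_assoc] using h

theorem SwapRel.map {u v i j : α} {g : Perm α} (hg : g ∈ H)
    (hd : swap (g u) (g v) * swap u v ∈ H) (h : SwapRel H (swap u v) i j) :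
    SwapRel H (swap u v) (g i) (g j) := by
  rcases h with rfl | h
  · exact .inl rfl
  · right
    have := H.mul_mem (conj_swap_mul_swap_mem hg h) hd
    simpa [mul_assoc] using this

theorem mem_of_swapRel [Fintype α] {o u v c : α} {y : Perm α} (hy : y ∈ H) (hyo : y o = o)
    (hsign : sign y = -1) (hrel : ∀ z, z ≠ o → SwapRel H (swap u v) c z)
    {π : Perm α} (hπ : π o = o) : π ∈ H := by
  classical
  have key : ∀ f : Perm {i // i ≠ o}, (sign f = 1 → ofSubtype f ∈ H) ∧
      (sign f = -1 → ofSubtype f * swap u v ∈ H) := by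
    intro f
    induction f using swap_induction_on' with
    | one => simp
    | mul_swap f i j hij ih =>
      have hs : swap (i : α) j * swap u v ∈ H := by
        rcases (hrel i i.2).symm.trans (hrel j j.2) with h | h
        · exact absurd (Subtype.ext h) hij
        · exact h
      rw [Perm.sign_mul, sign_swap hij, map_mul, ofSubtype_swap_eq]
      refine ⟨fun h => ?_, fun h => ?_⟩
      · have := H.mul_mem (ih.2 (by simpa [neg_eq_iff_eq_neg] using h)) (H.inv_mem hs)
        simpa [mul_assoc] using this
      · have := H.mul_mem (ih.1 (by simpa using h)) hs
        simpa [mul_assoc] using this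
  have restrict : ∀ f : Perm α, f o = o →
      ∃ f' : Perm {i // i ≠ o}, ofSubtype f' = f := by
    intro f hf
    have hmem : ∀ x, f x ≠ o ↔ x ≠ o := fun x => by
      rw [not_iff_not]; exact ⟨fun h => f.injective (h.trans hf.symm), fun h => h ▸ hf⟩
    exact ⟨f.subtypePerm hmem, ofSubtype_subtypePerm hmem fun x hx hxo => hx (hxo ▸ hf)⟩
  have hd : swap u v ∈ H := by
    obtain ⟨y', rfl⟩ := restrict y hyo
    rw [sign_ofSubtype] at hsign
    exact (H.mul_mem_cancel_left hy).1 ((key y').2 hsign)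
  obtain ⟨π', rfl⟩ := restrict π hπ
  rcases Int.units_eq_one_or (sign π') with h | h
  · exact (key π').1 h
  · exact (H.mul_mem_cancel_right hd).1 ((key π').2 h)

end SwapProducts

/-- `x` is the cycle `(1, 2, …, 2a+1)`. -/
def IsOuterCycle (a b : ℕ) (x : Perm (Fin (2*a+b+2))) : Prop :=
  ∀ i, (x i : ℕ) =
    if (i : ℕ) = 0 then 0
    else if (i : ℕ) ≤ 2*a then (i : ℕ) + 1
    else if (i : ℕ) = 2*a+1 then 1
    else (i : ℕ)

/-- `y` is the cycle `(1, 2, …, a+1, 2a+b+1, 2a+b, …, 2a+2)`. -/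
def IsInnerCycle (a b : ℕ) (y : Perm (Fin (2*a+b+2))) : Prop :=
  ∀ i, (y i : ℕ) =
    if (i : ℕ) = 0 then 0
    else if (i : ℕ) ≤ a then (i : ℕ) + 1
    else if (i : ℕ) = a+1 then (if b = 0 then 1 else 2*a+b+1)
    else if (i : ℕ) ≤ 2*a+1 then (i : ℕ)
    else if (i : ℕ) = 2*a+2 then 1
    else (i : ℕ) - 1

theorem Fin.val_swap_apply {N : ℕ} (u v i : Fin N) :
    (swap u v i : ℕ) = if (i : ℕ) = u then (v : ℕ) else if (i : ℕ) = v then u else i := by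
  simp only [swap_apply_def, Fin.ext_iff]
  split_ifs <;> rfl

section ThetaCycles

variable {a b : ℕ} {x y : Perm (Fin (2*a+b+2))} {H : Subgroup (Perm (Fin (2*a+b+2)))}

theorem IsInnerCycle.forall_of_one (hy : IsInnerCycle a b y) {P : Fin (2*a+b+2) → Prop}
    (hP : ∀ z, P z → P (y z)) (h1 : P ⟨1, by omega⟩) (z : Fin (2*a+b+2)) (hz : (z : ℕ) ≠ 0)
    (hz' : (z : ℕ) ≤ a+1 ∨ 2*a+2 ≤ (z : ℕ)) : P z := by
  have left : ∀ k (hk : k ≤ a), P ⟨k+1, by omega⟩ := by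
    intro k
    induction k with
    | zero => exact fun _ => h1
    | succ k ih =>
      intro hk
      convert hP _ (ih (by omega)) using 1
      rw [Fin.ext_iff, hy]
      grind
  have right : ∀ k (hk : k < b), P ⟨2*a+b+1-k, by omega⟩ := by
    intro k
    induction k with
    | zero =>
      intro hk
      convert hP _ (left a le_rfl) using 1
      rw [Fin.ext_iff, hy]
      grind
    | succ k ih =>
      intro hk
      convert hP _ (ih (by omega)) using 1
      rw [Fin.ext_iff, hy]
      grind
  rcases hz' with h | h
  · convert left (z-1) (by omega) using 1
    grind
  · convert right (2*a+b+1-z) (by omega) using 1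
    grind

theorem IsInnerCycle.one_of_last (hb : 1 ≤ b) (hy : IsInnerCycle a b y)
    {P : Fin (2*a+b+2) → Prop} (hP : ∀ z, P z → P (y z)) (h : P ⟨2*a+b+1, by omega⟩) :
    P ⟨1, by omega⟩ := by
  have right : ∀ k (hk : k < b), P ⟨2*a+b+1-k, by omega⟩ := by
    intro k
    induction k with
    | zero => exact fun _ => h
    | succ k ih =>
      intro hk
      convert hP _ (ih (by omega)) using 1
      rw [Fin.ext_iff, hy]
      grind
  convert hP _ (right (b-1) (by omega)) using 1
  rw [Fin.ext_iff, hy]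
  grind

/-- The criterion: a single 3-cycle on `1, 2, a+2` makes all nonzero points related. -/
theorem swapRel_of_threeCycle (ha : 1 ≤ a) (hx : IsOuterCycle a b x) (hy : IsInnerCycle a b y)
    (hxH : x ∈ H) (hyH : y ∈ H)
    (h : swap (⟨2, by omega⟩ : Fin (2*a+b+2)) ⟨a+2, by omega⟩ *
      swap ⟨1, by omega⟩ ⟨a+2, by omega⟩ ∈ H) (z : Fin (2*a+b+2)) (hz : (z : ℕ) ≠ 0) :
    SwapRel H (swap ⟨1, by omega⟩ ⟨a+2, by omega⟩) ⟨a+2, by omega⟩ z := by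
  set p : Fin (2*a+b+2) := ⟨1, by omega⟩ with hp
  set p' : Fin (2*a+b+2) := ⟨2, by omega⟩ with hp'
  set q : Fin (2*a+b+2) := ⟨a+2, by omega⟩ with hq
  have hyp : y p = p' := by rw [Fin.ext_iff, hy]; grind
  have hyq : y q = q := by rw [Fin.ext_iff, hy]; grind
  have hyd : swap (y p) (y q) * swap p q ∈ H := by rwa [hyp, hyq]
  have hqp : SwapRel H (swap p q) q p := by
    right; rw [swap_comm q p, swap_mul_self]; exact H.one_mem
  have inner : ∀ z : Fin (2*a+b+2), (z : ℕ) ≠ 0 → ((z : ℕ) ≤ a+1 ∨ 2*a+2 ≤ (z : ℕ)) →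
      SwapRel H (swap p q) q z :=
    hy.forall_of_one (P := fun z => SwapRel H (swap p q) q z)
      (fun z hz => by simpa only [hyq] using hz.map hyH hyd) hqp
  by_cases hz' : (z : ℕ) ≤ a+1 ∨ 2*a+2 ≤ (z : ℕ)
  · exact inner z hz hz'
  by_cases ha1 : a = 1
  · left; rw [Fin.ext_iff]; grind
  set p'' : Fin (2*a+b+2) := ⟨3, by omega⟩ with hp''
  have rel_pp' : SwapRel H (swap p q) p p' :=
    hqp.symm.trans (inner p' (by simp [hp']) (by left; simp only [hp']; omega))
  have rel_p'p'' : SwapRel H (swap p q) p' p'' :=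
    (inner p' (by simp [hp']) (by left; simp only [hp']; omega)).symm.trans
      (inner p'' (by simp [hp'']) (by left; simp only [hp'']; omega))
  have mem_pp' : swap p p' * swap p q ∈ H :=
    rel_pp'.resolve_left (by simp [hp, hp'])
  have mem_p'p'' : swap p' p'' * swap p q ∈ H :=
    rel_p'p''.resolve_left (by simp [hp', hp''])
  have hxp : x p = p' := by rw [Fin.ext_iff, hx]; grind
  have hxp' : x p' = p'' := by rw [Fin.ext_iff, hx]; grind
  have hxd : swap (x p) (x q) * swap p q ∈ H := by
    have h₁ := conj_swap_mul_swap_mem hxH mem_pp'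
    rw [hxp, hxp'] at h₁
    have := H.mul_mem (H.inv_mem h₁) mem_p'p''
    simpa [mul_assoc, hxp] using this
  have step : ∀ k (hk : k < 2*a), SwapRel H (swap p q) ⟨k+1, by omega⟩ ⟨k+2, by omega⟩ := by
    intro k
    induction k with
    | zero => exact fun _ => rel_pp'
    | succ k ih =>
      intro hk
      convert (ih (by omega)).map hxH hxd using 1 <;> rw [Fin.ext_iff, hx] <;> grind
  have all : ∀ k (hk : k ≤ 2*a), SwapRel H (swap p q) p ⟨k+1, by omega⟩ := by
    intro k
    induction k with
    | zero => exact fun _ => .inl rfl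
    | succ k ih => exact fun hk => (ih (by omega)).trans (step k (by omega))
  refine hqp.trans ?_
  convert all (z-1) (by omega) using 1
  grind

theorem commutator_eq_double_swap (ha : 1 ≤ a) (hb : 1 ≤ b)
    (hx : IsOuterCycle a b x) (hy : IsInnerCycle a b y) :
    swap (⟨a+2, by omega⟩ : Fin (2*a+b+2)) ⟨2*a+b+1, by omega⟩ *
      swap ⟨1, by omega⟩ ⟨2, by omega⟩ = x * y * x⁻¹ * y⁻¹ := by
  rw [eq_mul_inv_iff_mul_eq, eq_mul_inv_iff_mul_eq]
  ext i
  simp only [Perm.mul_apply, Fin.val_swap_apply]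
  have h1 := hx i
  have h2 := hy (x i)
  have h3 := hy i
  have h4 := hx (y i)
  grind (splits := 40)

theorem threeCycle_mem_of_no_middle (ha : 1 ≤ a) (hb : b = 0)
    (hx : IsOuterCycle a b x) (hy : IsInnerCycle a b y) (hxH : x ∈ H) (hyH : y ∈ H) :
    swap (⟨2, by omega⟩ : Fin (2*a+b+2)) ⟨a+2, by omega⟩ *
      swap ⟨1, by omega⟩ ⟨a+2, by omega⟩ ∈ H := by
  have : swap (⟨2, by omega⟩ : Fin (2*a+b+2)) ⟨a+2, by omega⟩ *
      swap ⟨1, by omega⟩ ⟨a+2, by omega⟩ = y * x * y⁻¹ * x⁻¹ := by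
    rw [eq_mul_inv_iff_mul_eq, eq_mul_inv_iff_mul_eq]
    ext i
    simp only [Perm.mul_apply, Fin.val_swap_apply]
    have h1 := hx i
    have h2 := hy (x i)
    have h3 := hy i
    have h4 := hx (y i)
    grind (splits := 40)
  rw [this]
  exact H.mul_mem (H.mul_mem (H.mul_mem hyH hxH) (H.inv_mem hyH)) (H.inv_mem hxH)

theorem threeCycle_mem_of_one (ha : a = 1) (hx : IsOuterCycle a b x) (hxH : x ∈ H) :
    swap (⟨2, by omega⟩ : Fin (2*a+b+2)) ⟨a+2, by omega⟩ *
      swap ⟨1, by omega⟩ ⟨a+2, by omega⟩ ∈ H := by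
  convert hxH using 1
  ext i
  simp only [Perm.mul_apply, Fin.val_swap_apply]
  have h1 := hx i
  grind

theorem double_swap_mem (ha : 1 ≤ a) (hb : 1 ≤ b)
    (hx : IsOuterCycle a b x) (hy : IsInnerCycle a b y) (hxH : x ∈ H) (hyH : y ∈ H) :
    swap (⟨a+2, by omega⟩ : Fin (2*a+b+2)) ⟨2*a+b+1, by omega⟩ *
      swap ⟨1, by omega⟩ ⟨2, by omega⟩ ∈ H := by
  rw [commutator_eq_double_swap ha hb hx hy]
  exact H.mul_mem (H.mul_mem (H.mul_mem hxH hyH) (H.inv_mem hxH)) (H.inv_mem hyH)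

theorem threeCycle_mem_of_three_le (ha : 3 ≤ a) (hb : 1 ≤ b)
    (hx : IsOuterCycle a b x) (hy : IsInnerCycle a b y) (hxH : x ∈ H) (hyH : y ∈ H) :
    swap (⟨2, by omega⟩ : Fin (2*a+b+2)) ⟨a+2, by omega⟩ *
      swap ⟨1, by omega⟩ ⟨a+2, by omega⟩ ∈ H := by
  have h₁ := double_swap_mem (by omega) hb hx hy hxH hyH
  have h₂ := conj_swap_mul_swap_mem hxH (conj_swap_mul_swap_mem hxH h₁)
  have e₁ : x (x ⟨a+2, by omega⟩) = ⟨a+4, by omega⟩ := by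
    rw [Fin.ext_iff, hx, hx]; grind
  have e₂ : x (x ⟨2*a+b+1, by omega⟩) = ⟨2*a+b+1, by omega⟩ := by
    rw [Fin.ext_iff, hx, hx]; grind
  have e₃ : x (x ⟨1, by omega⟩) = ⟨3, by omega⟩ := by
    rw [Fin.ext_iff, hx, hx]; grind
  have e₄ : x (x ⟨2, by omega⟩) = ⟨4, by omega⟩ := by
    rw [Fin.ext_iff, hx, hx]; grind
  rw [e₁, e₂, e₃, e₄] at h₂
  have h₃ := threeCycle_mem_of_double_swaps (by simp; omega) h₁ h₂
  rw [swap_comm] at h₃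
  set q : Fin (2*a+b+2) := ⟨a+2, by omega⟩ with hq
  set q' : Fin (2*a+b+2) := ⟨a+4, by omega⟩ with hq'
  have hyq : y q = q := by rw [Fin.ext_iff, hy]; grind
  have hyq' : y q' = q' := by rw [Fin.ext_iff, hy]; grind
  have hstep : ∀ z, swap z q * swap q q' ∈ H → swap (y z) q * swap q q' ∈ H := by
    intro z hz
    simpa only [hyq, hyq'] using conj_swap_mul_swap_mem hyH hz
  have m₁ := hy.one_of_last hb (P := fun z => swap z q * swap q q' ∈ H) hstep h₃
  have m₂ := hstep _ m₁
  have e₅ : y ⟨1, by omega⟩ = ⟨2, by omega⟩ := by rw [Fin.ext_iff, hy]; grind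
  rw [e₅] at m₂
  simpa [mul_assoc] using H.mul_mem m₂ (H.inv_mem m₁)

theorem threeCycle_mem_of_two (ha : a = 2) (hb : 5 ≤ b)
    (hx : IsOuterCycle a b x) (hy : IsInnerCycle a b y) (hxH : x ∈ H) (hyH : y ∈ H) :
    swap (⟨2, by omega⟩ : Fin (2*a+b+2)) ⟨a+2, by omega⟩ *
      swap ⟨1, by omega⟩ ⟨a+2, by omega⟩ ∈ H := by
  subst ha
  have h₁ := double_swap_mem (by omega) (by omega) hx hy hxH hyH
  have h₂ := conj_swap_mul_swap_mem hyH (conj_swap_mul_swap_mem hyH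
    (conj_swap_mul_swap_mem hyH (conj_swap_mul_swap_mem hyH h₁)))
  have e₁ : y ⟨2+2, by omega⟩ = ⟨2+2, by omega⟩ := by
    rw [Fin.ext_iff, hy]; grind
  have s₁ : y ⟨1, by omega⟩ = ⟨2, by omega⟩ := by rw [Fin.ext_iff, hy]; grind
  have s₂ : y ⟨2, by omega⟩ = ⟨3, by omega⟩ := by rw [Fin.ext_iff, hy]; grind
  have s₃ : y ⟨3, by omega⟩ = ⟨2*2+b+1, by omega⟩ := by rw [Fin.ext_iff, hy]; grind
  have s₄ : y ⟨2*2+b+1, by omega⟩ = ⟨b+4, by omega⟩ := by rw [Fin.ext_iff, hy]; grind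
  have s₅ : y ⟨b+4, by omega⟩ = ⟨b+3, by omega⟩ := by rw [Fin.ext_iff, hy]; grind
  have s₆ : y ⟨b+3, by omega⟩ = ⟨b+2, by omega⟩ := by rw [Fin.ext_iff, hy]; grind
  have s₇ : y ⟨b+2, by omega⟩ = ⟨b+1, by omega⟩ := by rw [Fin.ext_iff, hy]; grind
  simp only [e₁, s₁, s₂, s₃, s₄, s₅, s₆, s₇] at h₂
  rw [swap_comm] at h₂
  rw [swap_comm] at h₁
  have h₃ := threeCycle_mem_of_double_swaps (by simp; omega) h₁ h₂
  set r : Fin (2*2+b+2) := ⟨2*2+b+1, by omega⟩ with hr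
  set r' : Fin (2*2+b+2) := ⟨b+1, by omega⟩ with hr'
  have hxr : x r = r := by rw [Fin.ext_iff, hx]; grind
  have hxr' : x r' = r' := by rw [Fin.ext_iff, hx]; grind
  have hstep : ∀ z, swap r z * swap r r' ∈ H → swap r (x z) * swap r r' ∈ H := by
    intro z hz
    simpa only [hxr, hxr'] using conj_swap_mul_swap_mem hxH hz
  have m₁ := hstep _ (hstep _ h₃)
  have f₁ : x (x ⟨2+2, by omega⟩) = ⟨1, by omega⟩ := by rw [Fin.ext_iff, hx, hx]; grind
  rw [f₁] at m₁
  have m₂ := hstep _ m₁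
  have f₂ : x ⟨1, by omega⟩ = ⟨2, by omega⟩ := by rw [Fin.ext_iff, hx]; grind
  rw [f₂] at m₂
  have rq : SwapRel H (swap r r') r ⟨2+2, by omega⟩ := .inr h₃
  have r1 : SwapRel H (swap r r') r ⟨1, by omega⟩ := .inr m₁
  have r2 : SwapRel H (swap r r') r ⟨2, by omega⟩ := .inr m₂
  have k₁ := (r1.symm.trans rq).resolve_left (by simp)
  have k₂ := (r2.symm.trans rq).resolve_left (by simp)
  simpa [mul_assoc] using H.mul_mem k₂ (H.inv_mem k₁)

set_option maxRecDepth 100000 in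
theorem threeCycle_mem_of_two_three (ha : a = 2) (hb : b = 3)
    (hx : IsOuterCycle a b x) (hy : IsInnerCycle a b y) (hxH : x ∈ H) (hyH : y ∈ H) :
    swap (⟨2, by omega⟩ : Fin (2*a+b+2)) ⟨a+2, by omega⟩ *
      swap ⟨1, by omega⟩ ⟨a+2, by omega⟩ ∈ H := by
  subst ha hb
  have ex : x = List.formPerm [(1 : Fin 9), 2, 3, 4, 5] := by
    ext i
    rw [hx]
    revert i
    decide
  have ey : y = List.formPerm [(1 : Fin 9), 2, 3, 8, 7, 6] := by
    ext i
    rw [hy]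
    revert i
    decide
  have xi := H.inv_mem hxH
  have yi := H.inv_mem hyH
  have h : y⁻¹ * x⁻¹ * y⁻¹ * x * y⁻¹ * y⁻¹ * x * x * y⁻¹ * x * x * y⁻¹ ∈ H := by
    repeat' first | assumption | apply H.mul_mem
  convert h using 1
  rw [ex, ey]
  decide

theorem threeCycle_mem (ha : 1 ≤ a) (hodd : (a + b) % 2 = 1) (hab : ¬(a = 2 ∧ b = 1))
    (hx : IsOuterCycle a b x) (hy : IsInnerCycle a b y) (hxH : x ∈ H) (hyH : y ∈ H) :
    swap (⟨2, by omega⟩ : Fin (2*a+b+2)) ⟨a+2, by omega⟩ *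
      swap ⟨1, by omega⟩ ⟨a+2, by omega⟩ ∈ H := by
  rcases Nat.eq_zero_or_pos b with hb | hb
  · exact threeCycle_mem_of_no_middle ha hb hx hy hxH hyH
  by_cases h1 : a = 1
  · exact threeCycle_mem_of_one h1 hx hxH
  by_cases h2 : a = 2
  · by_cases h3 : b = 3
    · exact threeCycle_mem_of_two_three h2 h3 hx hy hxH hyH
    · exact threeCycle_mem_of_two h2 (by omega) hx hy hxH hyH
  · exact threeCycle_mem_of_three_le (by omega) hb hx hy hxH hyH

theorem stabilizer_zero_le (ha : 1 ≤ a) (hodd : (a + b) % 2 = 1) (hab : ¬(a = 2 ∧ b = 1))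
    (hx : IsOuterCycle a b x) (hy : IsInnerCycle a b y) (hsign : sign y = -1)
    (hxH : x ∈ H) (hyH : y ∈ H) :
    MulAction.stabilizer (Perm (Fin (2*a+b+2))) (0 : Fin (2*a+b+2)) ≤ H := by
  intro π hπ
  have hy0 : y 0 = 0 := by rw [Fin.ext_iff, hy]; simp
  exact mem_of_swapRel hyH hy0 hsign (fun z hz => swapRel_of_threeCycle ha hx hy hxH hyH
    (threeCycle_mem ha hodd hab hx hy hxH hyH) z fun h => hz (Fin.ext h)) hπ

end ThetaCycles

section Generators

variable {a b : ℕ} {p₁ p₂ p₃ : Perm (Fin (2*a+b+2))}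

theorem isOuterCycle_mul_inv (ha : 1 ≤ a)
    (hp₁ : ∀ i : Fin (2*a+b+2), (p₁ i : ℕ) =
      if (i : ℕ) ≤ a then (i : ℕ) + 1
      else if (i : ℕ) = a+1 then 0
      else (i : ℕ))
    (hp₃ : ∀ i : Fin (2*a+b+2), (p₃ i : ℕ) =
      if (i : ℕ) = 0 then 2*a+1
      else if a+2 ≤ (i : ℕ) ∧ (i : ℕ) ≤ 2*a+1 then (i : ℕ) - 1
      else if (i : ℕ) = a+1 then 0
      else (i : ℕ)) :
    IsOuterCycle a b (p₁ * p₃⁻¹) := by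
  intro i
  obtain ⟨j, rfl⟩ := p₃.surjective i
  have h₁ := hp₁ j
  have h₃ := hp₃ j
  rw [Perm.mul_apply, show p₃⁻¹ (p₃ j) = j from p₃.symm_apply_apply j]
  have hj := j.isLt
  split_ifs at h₁ h₃ <;> split_ifs <;> omega

theorem isInnerCycle_mul_inv
    (hp₁ : ∀ i : Fin (2*a+b+2), (p₁ i : ℕ) =
      if (i : ℕ) ≤ a then (i : ℕ) + 1
      else if (i : ℕ) = a+1 then 0
      else (i : ℕ))
    (hp₂ : ∀ i : Fin (2*a+b+2), (p₂ i : ℕ) =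
      if (i : ℕ) = 0 then (if b = 0 then a+1 else 2*a+2)
      else if (i : ℕ) = a+1 then 0
      else if 2*a+2 ≤ (i : ℕ) ∧ (i : ℕ) ≤ 2*a+b then (i : ℕ) + 1
      else if (i : ℕ) = 2*a+b+1 ∧ b ≠ 0 then a+1
      else (i : ℕ)) :
    IsInnerCycle a b (p₁ * p₂⁻¹) := by
  intro i
  obtain ⟨j, rfl⟩ := p₂.surjective i
  have h₁ := hp₁ j
  have h₂ := hp₂ j
  rw [Perm.mul_apply, show p₂⁻¹ (p₂ j) = j from p₂.symm_apply_apply j]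
  have hj := j.isLt
  split_ifs at h₁ h₂ <;> split_ifs <;> omega

theorem sign_left_cycle
    (hp₁ : ∀ i : Fin (2*a+b+2), (p₁ i : ℕ) =
      if (i : ℕ) ≤ a then (i : ℕ) + 1
      else if (i : ℕ) = a+1 then 0
      else (i : ℕ)) :
    sign p₁ = (-1) ^ (a+1) := by
  have : p₁ = Fin.cycleRange ⟨a+1, by omega⟩ := by
    ext i
    rw [hp₁]
    rcases le_or_gt i ⟨a+1, by omega⟩ with h | h
    · rw [Fin.coe_cycleRange_of_le h]
      simp only [Fin.le_def, Fin.ext_iff] at h ⊢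
      grind
    · rw [Fin.cycleRange_of_gt h]
      simp only [Fin.lt_def] at h
      grind
  rw [this, Fin.sign_cycleRange]

theorem sign_middle_cycle_s4
    (hp₂ : ∀ i : Fin (2*a+b+2), (p₂ i : ℕ) =
      if (i : ℕ) = 0 then (if b = 0 then a+1 else 2*a+2)
      else if (i : ℕ) = a+1 then 0
      else if 2*a+2 ≤ (i : ℕ) ∧ (i : ℕ) ≤ 2*a+b then (i : ℕ) + 1
      else if (i : ℕ) = 2*a+b+1 ∧ b ≠ 0 then a+1
      else (i : ℕ)) :
    sign p₂ = (-1) ^ (b+1) := by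
  rcases Nat.eq_zero_or_pos b with hb | hb
  · have : p₂ = swap ⟨0, by omega⟩ ⟨a+1, by omega⟩ := by
      ext i
      have := hp₂ i
      rw [Fin.val_swap_apply]
      grind
    rw [this, sign_swap (by simp), hb]
    simp
  · set m : Fin (2*a+b+2) := ⟨2*a+2, by omega⟩ with hm
    set l : Fin (2*a+b+2) := ⟨2*a+b+1, by omega⟩ with hl
    have hml : m ≤ l := by simp only [hm, hl, Fin.le_def]; omega
    have : p₂ = swap ⟨0, by omega⟩ ⟨a+1, by omega⟩ * swap ⟨0, by omega⟩ m *
        Fin.cycleIcc m l := by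
      ext i
      have h := hp₂ i
      simp only [Perm.mul_apply]
      rcases lt_or_ge i m with hi | hi
      · rw [Fin.cycleIcc_of_lt hi, Fin.val_swap_apply, Fin.val_swap_apply]
        simp only [hm, Fin.lt_def] at hi ⊢
        grind
      · have hil : i ≤ l := by simp only [hl, Fin.le_def]; omega
        rw [Fin.cycleIcc_of_le_of_le hi hil]
        split_ifs with hi'
        · rw [Fin.val_swap_apply, Fin.val_swap_apply]
          simp only [hm, hl, Fin.ext_iff] at hi' ⊢
          grind
        · have hlt : (i : ℕ) < 2*a+b+1 := by
            simp only [hl, Fin.ext_iff] at hi'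
            omega
          have hval : ((i + 1 : Fin (2*a+b+2)) : ℕ) = i + 1 :=
            Fin.val_add_one_of_lt' (by omega)
          rw [Fin.val_swap_apply, Fin.val_swap_apply, hval]
          simp only [hm, Fin.le_def] at hi ⊢
          grind
    rw [this, Perm.sign_mul, Perm.sign_mul, sign_swap (by simp),
      sign_swap (by simp [hm, Fin.ext_iff]), Fin.sign_cycleIcc_of_le hml]
    obtain ⟨c, rfl⟩ : ∃ c, b = c + 1 := ⟨b - 1, by omega⟩
    have : (l : ℕ) - m = c := by simp only [hl, hm]; omega
    rw [this]
    simp [pow_succ]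

end Generators


theorem closure_odd_case (a b : ℕ) (ha : 1 ≤ a)
    (hodd : (a + b) % 2 = 1) (hab : ¬(a = 2 ∧ b = 1))
    (ρ ψ p1 p2 p3 : Equiv.Perm (Fin (2*a+b+2)))
    (hρ : ∀ i : Fin (2*a+b+2), (ρ i : ℕ) =
      if (i : ℕ) ≤ 2*a+1 then ((i : ℕ) + a + 1) % (2*a+2) else 4*a+b+3 - (i : ℕ))
    (hψ : ∀ i : Fin (2*a+b+2), (ψ i : ℕ) =
      if (i : ℕ) ≤ a+1 then a+1 - (i : ℕ)
      else if (i : ℕ) ≤ 2*a+1 then 3*a+3 - (i : ℕ)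
      else 4*a+b+3 - (i : ℕ))
    (hp1 : ∀ i : Fin (2*a+b+2), (p1 i : ℕ) =
      if (i : ℕ) ≤ a then (i : ℕ) + 1
      else if (i : ℕ) = a+1 then 0
      else (i : ℕ))
    (hp2 : ∀ i : Fin (2*a+b+2), (p2 i : ℕ) =
      if (i : ℕ) = 0 then (if b = 0 then a+1 else 2*a+2)
      else if (i : ℕ) = a+1 then 0
      else if 2*a+2 ≤ (i : ℕ) ∧ (i : ℕ) ≤ 2*a+b then (i : ℕ) + 1
      else if (i : ℕ) = 2*a+b+1 ∧ b ≠ 0 then a+1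
      else (i : ℕ))
    (hp3 : ∀ i : Fin (2*a+b+2), (p3 i : ℕ) =
      if (i : ℕ) = 0 then 2*a+1
      else if a+2 ≤ (i : ℕ) ∧ (i : ℕ) ≤ 2*a+1 then (i : ℕ) - 1
      else if (i : ℕ) = a+1 then 0
      else (i : ℕ))
    :
    Subgroup.closure ({p1 * ρ, p2 * ρ, p3 * ρ} : Set (Equiv.Perm (Fin (2*a+b+2))))
      = MulAction.stabilizer (Equiv.Perm (Fin (2*a+b+2))) (0 : Fin (2*a+b+2)) ∧
    Subgroup.closure ({p1 * ψ, p2 * ψ, p3 * ψ} : Set (Equiv.Perm (Fin (2*a+b+2))))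
      = MulAction.stabilizer (Equiv.Perm (Fin (2*a+b+2))) (0 : Fin (2*a+b+2)) := by
  have hx := isOuterCycle_mul_inv ha hp1 hp3
  have hy := isInnerCycle_mul_inv hp1 hp2
  have hsign : sign (p1 * p2⁻¹) = -1 := by
    rw [Perm.sign_mul, sign_inv, sign_left_cycle hp1, sign_middle_cycle_s4 hp2, ← pow_add]
    exact Odd.neg_one_pow (Nat.odd_iff.2 (by omega))
  have key : ∀ g : Perm (Fin (2*a+b+2)), (g 0 : ℕ) = a+1 →
      Subgroup.closure ({p1 * g, p2 * g, p3 * g} : Set (Perm (Fin (2*a+b+2))))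
        = MulAction.stabilizer (Perm (Fin (2*a+b+2))) (0 : Fin (2*a+b+2)) := by
    intro g hg
    have m₁ : p1 * g ∈ Subgroup.closure ({p1 * g, p2 * g, p3 * g} : Set _) :=
      Subgroup.subset_closure (by simp)
    have m₂ : p2 * g ∈ Subgroup.closure ({p1 * g, p2 * g, p3 * g} : Set _) :=
      Subgroup.subset_closure (by simp)
    have m₃ : p3 * g ∈ Subgroup.closure ({p1 * g, p2 * g, p3 * g} : Set _) :=
      Subgroup.subset_closure (by simp)
    refine le_antisymm ?_ (stabilizer_zero_le ha hodd hab hx hy hsign ?_ ?_)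
    · rw [Subgroup.closure_le]
      have h₁ := hp1 (g 0)
      have h₂ := hp2 (g 0)
      have h₃ := hp3 (g 0)
      rw [hg] at h₁ h₂ h₃
      rintro _ (rfl | rfl | rfl) <;>
        rw [SetLike.mem_coe, MulAction.mem_stabilizer_iff, Perm.smul_def, Perm.mul_apply,
          Fin.ext_iff, Fin.val_zero]
      · simpa using h₁
      · simpa using h₂
      · simpa using h₃
    · simpa [mul_assoc] using mul_mem m₁ (inv_mem m₃)
    · simpa [mul_assoc] using mul_mem m₁ (inv_mem m₂)
  refine ⟨key ρ ?_, key ψ ?_⟩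
  · rw [hρ]
    simp [Nat.mod_eq_of_lt (show a + 1 < 2*a+2 by omega)]
  · rw [hψ]
    simp
end

section
/- Suppose a ≡ 0 (mod 2) and b ≡ 0 (mod 4). Then the subgroup of Perm(Fin (n+1)) generated by S1 = {σ_1, σ_2, σ_3} equals the group of all even permutations fixing 0, i.e. the intersection of the stabilizer {π | π(0) = 0} with the alternating group of Fin (n+1); the same holds for the subgroup generated by S2 = {τ_1, τ_2, τ_3}. (In particular each of S1 and S2 generates a copy of the alternating group of degree n.) -/
open Equiv Equiv.Perm

/-- If a subgroup contains every 3-cycle avoiding `z`, it contains every even permutation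
fixing `z`. -/
theorem stabilizer_inf_alternatingGroup_le {α : Type*} [Fintype α] [DecidableEq α] (z : α)
    (G : Subgroup (Perm α))
    (h : ∀ u v w, u ≠ z → v ≠ z → w ≠ z → u ≠ v → v ≠ w → u ≠ w → swap u v * swap v w ∈ G) :
    MulAction.stabilizer (Perm α) z ⊓ alternatingGroup α ≤ G := by
  rintro f ⟨hfz, hf⟩
  have hfz : f z = z := hfz
  have hp : ∀ x, f x ≠ z ↔ x ≠ z := fun x ↦ by
    rw [not_iff_not]
    exact ⟨fun hx ↦ f.injective (hx.trans hfz.symm), fun hx ↦ hx ▸ hfz⟩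
  have hq : ∀ x, f x ≠ x → x ≠ z := fun x hx hxz ↦ hx (hxz ▸ hfz)
  have hmem : f.subtypePerm (p := fun x ↦ x ≠ z) hp ∈ alternatingGroup {x // x ≠ z} := by
    rw [mem_alternatingGroup, sign_subtypePerm f hp hq]
    exact hf
  have hle : alternatingGroup {x // x ≠ z} ≤
      G.comap (ofSubtype : Perm {x // x ≠ z} →* Perm α) := by
    rw [← closure_three_cycles_eq_alternating, Subgroup.closure_le]
    intro g hg
    obtain ⟨x, hx⟩ := hg.isCycle.nonempty_support
    have hnd := hg.nodup_iff_mem_support.mpr hx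
    have hgx := hg.eq_swap_mul_swap_iff_mem_support.mpr hx
    simp only [List.nodup_cons, List.mem_cons, List.not_mem_nil, or_false, not_or] at hnd
    rw [SetLike.mem_coe, Subgroup.mem_comap, hgx, map_mul, ofSubtype_swap_eq, ofSubtype_swap_eq]
    exact h _ _ _ x.2 (g x).2 (g (g x)).2 (Subtype.coe_ne_coe.mpr hnd.1.1)
      (Subtype.coe_ne_coe.mpr hnd.2.1) (Subtype.coe_ne_coe.mpr hnd.1.2)
  have := hle hmem
  rwa [Subgroup.mem_comap, ofSubtype_subtypePerm hp hq] at this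

theorem swap_mul_swap_conj_mem {α : Type*} [DecidableEq α] {G : Subgroup (Perm α)}
    {g : Perm α} (hg : g ∈ G) {p q r s : α} (h : swap p q * swap r s ∈ G) :
    swap (g p) (g q) * swap (g r) (g s) ∈ G := by
  have : swap (g p) (g q) * swap (g r) (g s) = g * (swap p q * swap r s) * g⁻¹ := by
    rw [swap_apply_apply, swap_apply_apply]; group
  rw [this]
  exact mul_mem (mul_mem hg h) (inv_mem hg)

theorem swap_mul_swap_rotate {α : Type*} [DecidableEq α] {x y z : α}
    (hxy : x ≠ y) (hyz : y ≠ z) (hxz : x ≠ z) :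
    swap x y * swap y z = swap y z * swap z x := by
  ext i
  simp only [mul_apply, swap_apply_def]
  grind

theorem swap_mul_swap_mem_of_reverse {α : Type*} [DecidableEq α] {G : Subgroup (Perm α)}
    {x y z : α} (h : swap x y * swap y z ∈ G) : swap z y * swap y x ∈ G := by
  simpa [swap_comm] using inv_mem h

/-- A subgroup fixing `z`, 2-transitive on the other points and containing a 3-cycle
contains every 3-cycle avoiding `z`. -/
theorem three_cycle_mem_of_two_transitive {α : Type*} [DecidableEq α] {z : α}
    {G : Subgroup (Perm α)} (hz : ∀ g ∈ G, g z = z)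
    (h2 : ∀ u v u' v', u ≠ z → v ≠ z → u ≠ v → u' ≠ z → v' ≠ z → u' ≠ v' →
      ∃ g ∈ G, g u = u' ∧ g v = v')
    {p q r : α} (hp : p ≠ z) (hq : q ≠ z) (hr : r ≠ z) (hpq : p ≠ q) (hqr : q ≠ r) (hpr : p ≠ r)
    (h : swap p q * swap q r ∈ G)
    (u v w : α) (hu : u ≠ z) (hv : v ≠ z) (hw : w ≠ z) (huv : u ≠ v) (hvw : v ≠ w) (huw : u ≠ w) :
    swap u v * swap v w ∈ G := by
  have key : ∀ u v, u ≠ z → v ≠ z → u ≠ v →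
      ∃ x, x ≠ z ∧ u ≠ x ∧ v ≠ x ∧ swap u v * swap v x ∈ G := by
    intro u v hu hv huv
    obtain ⟨g, hg, rfl, rfl⟩ := h2 p q u v hp hq hpq hu hv huv
    refine ⟨g r, fun hgr ↦ hr (g.injective (hgr.trans (hz g hg).symm)), g.injective.ne hpr,
      g.injective.ne hqr, swap_mul_swap_conj_mem hg h⟩
  have hrev : swap u w * swap w v ∈ G → swap u v * swap v w ∈ G := by
    intro h
    rw [swap_mul_swap_rotate huv hvw huw]
    exact swap_mul_swap_mem_of_reverse h
  obtain ⟨x, hxz, hux, hvx, hx⟩ := key u v hu hv huv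
  by_cases hxw : x = w
  · exact hxw ▸ hx
  obtain ⟨y, -, hxy, hwy, hy⟩ := key x w hxz hw hxw
  have e1 : (swap x w * swap w y) x = w := by
    rw [mul_apply, swap_apply_of_ne_of_ne hxw hxy, swap_apply_left]
  by_cases hyu : y = u
  · subst hyu
    have := swap_mul_swap_conj_mem hx hy
    have e2 : (swap y v * swap v x) x = y := by simp
    have e3 : (swap y v * swap v x) y = v := by
      rw [mul_apply, swap_apply_of_ne_of_ne huv hxy.symm, swap_apply_left]
    have e4 : (swap y v * swap v x) w = w := by
      rw [mul_apply, swap_apply_of_ne_of_ne hvw.symm (Ne.symm hxw),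
        swap_apply_of_ne_of_ne huw.symm hvw.symm]
    rw [e2, e3, e4] at this
    exact hrev this
  have e2 : (swap x w * swap w y) u = u := by
    rw [mul_apply, swap_apply_of_ne_of_ne huw (Ne.symm hyu), swap_apply_of_ne_of_ne hux huw]
  by_cases hyv : y = v
  · subst hyv
    have := swap_mul_swap_conj_mem hy (swap_mul_swap_conj_mem hy hx)
    have e3 : (swap x w * swap w y) y = x := by simp
    have e4 : (swap x w * swap w y) w = y := by
      rw [mul_apply, swap_apply_left, swap_apply_of_ne_of_ne hxy.symm hwy.symm]
    rw [e2, e1, e3, e2, e1, e4] at this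
    exact hrev this
  have e3 : (swap x w * swap w y) v = v := by
    rw [mul_apply, swap_apply_of_ne_of_ne hvw (Ne.symm hyv), swap_apply_of_ne_of_ne hvx hvw]
  have := swap_mul_swap_conj_mem hy hx
  rwa [e1, e2, e3] at this

/-- Two double transpositions sharing exactly one point generate a 3-cycle. -/
theorem three_cycle_mem_of_double_swaps {α : Type*} [DecidableEq α] {G : Subgroup (Perm α)}
    {p q r s t u v : α} (h : [p, q, r, s, t, u, v].Nodup)
    (h1 : swap p q * swap r s ∈ G) (h2 : swap p t * swap u v ∈ G) :
    swap t p * swap p q ∈ G := by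
  have := mul_mem (mul_mem h1 h2) (mul_mem h1 h2)
  convert this using 1
  simp only [List.nodup_cons, List.mem_cons, List.not_mem_nil, or_false, not_or] at h
  ext i
  simp only [mul_apply]
  by_cases hi : i = p ∨ i = q ∨ i = r ∨ i = s ∨ i = t ∨ i = u ∨ i = v
  · rcases hi with hi | hi | hi | hi | hi | hi | hi <;> subst hi <;> simp [swap_apply_def] <;> grind
  simp only [not_or] at hi
  simp [swap_apply_of_ne_of_ne, *]

/-- A subgroup fixing `z` is 2-transitive on the other points as soon as it moves a base pair
`x, y` to every pair `x, w`, and `x` to every point. -/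
theorem two_transitive_of_base {α : Type*} {z x y : α} {G : Subgroup (Perm α)}
    (hz : ∀ g ∈ G, g z = z)
    (h1 : ∀ u, u ≠ z → ∃ g ∈ G, g x = u)
    (h2 : ∀ v, v ≠ z → v ≠ x → ∃ g ∈ G, g x = x ∧ g y = v)
    (u v u' v' : α) (hu : u ≠ z) (hv : v ≠ z) (huv : u ≠ v) (hu' : u' ≠ z) (hv' : v' ≠ z)
    (huv' : u' ≠ v') : ∃ g ∈ G, g u = u' ∧ g v = v' := by
  have key : ∀ u v, u ≠ z → v ≠ z → u ≠ v → ∃ g ∈ G, g x = u ∧ g y = v := by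
    intro u v hu hv huv
    obtain ⟨g, hg, rfl⟩ := h1 u hu
    have hgz : g⁻¹ z = z := hz _ (inv_mem hg)
    obtain ⟨s, hs, hsx, hsy⟩ := h2 (g⁻¹ v)
      (fun h ↦ hv ((g⁻¹).injective (h.trans hgz.symm)))
      (fun h ↦ huv (by rw [← h]; simp))
    exact ⟨g * s, mul_mem hg hs, by rw [mul_apply, hsx], by rw [mul_apply, hsy]; simp⟩
  obtain ⟨g, hg, rfl, rfl⟩ := key u v hu hv huv
  obtain ⟨k, hk, rfl, rfl⟩ := key u' v' hu' hv' huv'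
  exact ⟨k * g⁻¹, mul_mem hk (inv_mem hg), by simp, by simp⟩

theorem pow_apply_of_shift {N m M : ℕ} [NeZero N] {f : Perm (Fin N)}
    (hf : ∀ k, m ≤ k → k < M → f (Fin.ofNat N k) = Fin.ofNat N (k + 1)) (i k : ℕ)
    (hk : m ≤ k) (hi : k + i ≤ M) : (f ^ i) (Fin.ofNat N k) = Fin.ofNat N (k + i) := by
  induction i with
  | zero => rfl
  | succ i ih => rw [pow_succ', mul_apply, ih (by omega), hf _ (by omega) (by omega), add_assoc]

theorem ofNat_ne_ofNat {N k l : ℕ} [NeZero N] (hk : k < N) (hl : l < N) (h : k ≠ l) :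
    Fin.ofNat N k ≠ Fin.ofNat N l := by
  intro hkl
  apply h
  simpa [Fin.ext_iff, Nat.mod_eq_of_lt, hk, hl] using hkl

theorem exists_eq_ofNat {N : ℕ} [NeZero N] (u : Fin N) : ∃ k < N, u = Fin.ofNat N k :=
  ⟨u, u.2, by simp⟩

theorem ofNat_ne_zero_iff {N k : ℕ} [NeZero N] (hk : k < N) : Fin.ofNat N k ≠ 0 ↔ k ≠ 0 := by
  simp [Fin.ext_iff, Nat.mod_eq_of_lt hk]

/-- Two cycles `(1 … M)` and `(m … N-1)` with `1 < m < M < N` generate a group 2-transitive on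
the nonzero points. -/
theorem two_transitive_of_cycles {N m M : ℕ} [NeZero N] {A C : Perm (Fin N)}
    {G : Subgroup (Perm (Fin N))} (hm : 1 < m) (hmM : m < M) (hMN : M < N)
    (hz : ∀ g ∈ G, g 0 = 0) (hA : A ∈ G) (hC : C ∈ G)
    (hAs : ∀ k, 1 ≤ k → k < M → A (Fin.ofNat N k) = Fin.ofNat N (k + 1))
    (hCs : ∀ k, m ≤ k → k < N - 1 → C (Fin.ofNat N k) = Fin.ofNat N (k + 1))
    (hCf : ∀ k, k < m → C (Fin.ofNat N k) = Fin.ofNat N k)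
    (u v u' v' : Fin N) (hu : u ≠ 0) (hv : v ≠ 0) (huv : u ≠ v) (hu' : u' ≠ 0)
    (hv' : v' ≠ 0) (huv' : u' ≠ v') : ∃ g ∈ G, g u = u' ∧ g v = v' := by
  refine two_transitive_of_base (x := Fin.ofNat N 1) (y := Fin.ofNat N 2) hz ?_ ?_
    u v u' v' hu hv huv hu' hv' huv'
  · intro u hu
    obtain ⟨k, hk, rfl⟩ := exists_eq_ofNat u
    have hk0 : 1 ≤ k := Nat.one_le_iff_ne_zero.mpr ((ofNat_ne_zero_iff hk).mp hu)
    clear hu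
    induction k, hk0 using Nat.le_induction with
    | base => exact ⟨1, one_mem _, rfl⟩
    | succ k hk0 ih =>
      obtain ⟨g, hg, hgk⟩ := ih (by omega)
      rcases Nat.lt_or_ge k M with h | h
      · exact ⟨A * g, mul_mem hA hg, by rw [mul_apply, hgk, hAs k hk0 h]⟩
      · exact ⟨C * g, mul_mem hC hg, by rw [mul_apply, hgk, hCs k (by omega) (by omega)]⟩
  · intro v hv hv1
    obtain ⟨k, hk, rfl⟩ := exists_eq_ofNat v
    have hk0 : 2 ≤ k := by
      have h0 := (ofNat_ne_zero_iff hk).mp hv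
      have h1 : k ≠ 1 := fun h ↦ hv1 (h ▸ rfl)
      omega
    clear hv hv1
    induction k, hk0 using Nat.le_induction with
    | base => exact ⟨1, one_mem _, rfl, rfl⟩
    | succ k hk0 ih =>
      obtain ⟨g, hg, hg1, hgk⟩ := ih (by omega)
      rcases Nat.lt_or_ge k m with h | h
      · have hpow := pow_apply_of_shift hAs (m - k)
        have e1 := hpow 1 le_rfl (by omega)
        have e2 := hpow k (by omega) (by omega)
        have e3 := hpow (k + 1) (by omega) (by omega)
        rw [show k + (m - k) = m by omega] at e2
        rw [show k + 1 + (m - k) = m + 1 by omega] at e3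
        refine ⟨(A ^ (m - k))⁻¹ * C * A ^ (m - k) * g,
          mul_mem (mul_mem (mul_mem (inv_mem (pow_mem hA _)) hC) (pow_mem hA _)) hg, ?_, ?_⟩
        · rw [mul_apply, mul_apply, mul_apply, hg1, e1, hCf _ (by omega), inv_eq_iff_eq, e1]
        · rw [mul_apply, mul_apply, mul_apply, hgk, e2, hCs _ le_rfl (by omega), inv_eq_iff_eq, e3]
      · refine ⟨C * g, mul_mem hC hg, ?_, ?_⟩
        · rw [mul_apply, hg1, hCf 1 (by omega)]
        · rw [mul_apply, hgk, hCs k h (by omega)]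

theorem coe_swap_apply {N : ℕ} (x y i : Fin N) :
    (swap x y i : ℕ) = if (i : ℕ) = x then (y : ℕ) else if (i : ℕ) = y then (x : ℕ) else i := by
  simp only [swap_apply_def, Fin.ext_iff, apply_ite Fin.val]

theorem coe_ofNat_of_lt {N k : ℕ} [NeZero N] (hk : k < N) : (Fin.ofNat N k : ℕ) = k :=
  Nat.mod_eq_of_lt hk

section TwoCycles

variable {a b : ℕ} {A C : Perm (Fin (2*a+b+2))}

/-- If `b = 0`, the commutator of the two cycles is a 3-cycle. -/
theorem commutator_eq_of_eq_zero (ha : 1 ≤ a) (hb : b = 0)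
    (hA : ∀ i, (A i : ℕ) =
      if 1 ≤ (i : ℕ) ∧ (i : ℕ) ≤ 2*a then (i : ℕ) + 1 else if (i : ℕ) = 2*a+1 then 1 else i)
    (hC : ∀ i, (C i : ℕ) =
      if a+1 ≤ (i : ℕ) ∧ (i : ℕ) ≤ 2*a+b then (i : ℕ) + 1
      else if (i : ℕ) = 2*a+b+1 then a+1 else i) :
    A * C = swap (Fin.ofNat _ (a+1)) (Fin.ofNat _ 1) * swap (Fin.ofNat _ 1) (Fin.ofNat _ (a+2)) *
      (C * A) := by
  have hk1 : a + 1 < 2*a+b+2 := by omega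
  have hk2 : a + 2 < 2*a+b+2 := by omega
  have hk3 : 1 < 2*a+b+2 := by omega
  ext i
  have hi := i.2
  have h1 := hA i
  have h2 := hC (A i)
  have h3 := hC i
  have h4 := hA (C i)
  have h5 := coe_swap_apply (Fin.ofNat (2*a+b+2) 1) (Fin.ofNat (2*a+b+2) (a+2)) (C (A i))
  have h6 := coe_swap_apply (Fin.ofNat (2*a+b+2) (a+1)) (Fin.ofNat (2*a+b+2) 1)
    (swap (Fin.ofNat (2*a+b+2) 1) (Fin.ofNat (2*a+b+2) (a+2)) (C (A i)))
  simp only [coe_ofNat_of_lt, hk1, hk2, hk3] at h5 h6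
  simp only [mul_apply]
  split_ifs at h1 <;> split_ifs at h3 <;> try (exfalso; omega)
  all_goals split_ifs at h2 <;> split_ifs at h4 <;> try (exfalso; omega)
  all_goals split_ifs at h5 <;> split_ifs at h6 <;> omega

/-- If `0 < b`, the commutator of the two cycles is a double transposition. -/
theorem commutator_eq_of_pos (ha : 1 ≤ a) (hb : 0 < b)
    (hA : ∀ i, (A i : ℕ) =
      if 1 ≤ (i : ℕ) ∧ (i : ℕ) ≤ 2*a then (i : ℕ) + 1 else if (i : ℕ) = 2*a+1 then 1 else i)
    (hC : ∀ i, (C i : ℕ) =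
      if a+1 ≤ (i : ℕ) ∧ (i : ℕ) ≤ 2*a+b then (i : ℕ) + 1
      else if (i : ℕ) = 2*a+b+1 then a+1 else i) :
    A * C = swap (Fin.ofNat _ (a+1)) (Fin.ofNat _ (a+2)) *
      swap (Fin.ofNat _ 1) (Fin.ofNat _ (2*a+2)) * (C * A) := by
  have hk1 : a + 1 < 2*a+b+2 := by omega
  have hk2 : a + 2 < 2*a+b+2 := by omega
  have hk3 : 1 < 2*a+b+2 := by omega
  have hk4 : 2*a+2 < 2*a+b+2 := by omega
  ext i
  have hi := i.2
  have h1 := hA i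
  have h2 := hC (A i)
  have h3 := hC i
  have h4 := hA (C i)
  have h5 := coe_swap_apply (Fin.ofNat (2*a+b+2) 1) (Fin.ofNat (2*a+b+2) (2*a+2)) (C (A i))
  have h6 := coe_swap_apply (Fin.ofNat (2*a+b+2) (a+1)) (Fin.ofNat (2*a+b+2) (a+2))
    (swap (Fin.ofNat (2*a+b+2) 1) (Fin.ofNat (2*a+b+2) (2*a+2)) (C (A i)))
  simp only [coe_ofNat_of_lt, hk1, hk2, hk3, hk4] at h5 h6
  simp only [mul_apply]
  split_ifs at h1 <;> split_ifs at h3 <;> try (exfalso; omega)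
  all_goals split_ifs at h2 <;> split_ifs at h4 <;> try (exfalso; omega)
  all_goals split_ifs at h5 <;> split_ifs at h6 <;> omega

end TwoCycles

theorem swap_mul_swap_mem_comm {α : Type*} [DecidableEq α] {G : Subgroup (Perm α)}
    {p q r s : α} (hnd : [p, q, r, s].Nodup) (h : swap p q * swap r s ∈ G) :
    swap r s * swap q p ∈ G := by
  rwa [swap_comm q p, ← (disjoint_swap_swap hnd).commute.eq]

theorem nodup_map_ofNat {N : ℕ} [NeZero N] {l : List ℕ} (hl : l.Nodup) (hN : ∀ k ∈ l, k < N) :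
    (l.map (Fin.ofNat N)).Nodup :=
  hl.map_on fun k hk m hm h ↦ by_contra fun hne ↦ ofNat_ne_ofNat (hN k hk) (hN m hm) hne h

theorem swap_mul_swap_mem_of_apply_eq {α : Type*} [DecidableEq α] {G : Subgroup (Perm α)}
    {g : Perm α} (hg : g ∈ G) {p q r s p' q' r' s' : α} (hp : g p = p') (hq : g q = q')
    (hr : g r = r') (hs : g s = s') (h : swap p q * swap r s ∈ G) :
    swap p' q' * swap r' s' ∈ G := by
  rw [← hp, ← hq, ← hr, ← hs]
  exact swap_mul_swap_conj_mem hg h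

section TwoCyclesGenerate

variable {a b : ℕ} {A C : Perm (Fin (2*a+b+2))} {G : Subgroup (Perm (Fin (2*a+b+2)))}

/-- For even `a` and `b` divisible by 4, a group containing the cycles `(1 … 2a+1)` and
`(a+1 … 2a+b+1)` contains a 3-cycle avoiding `0`. -/
theorem exists_three_cycle_mem (ha : 2 ≤ a) (haeven : a % 2 = 0) (hb : b % 4 = 0)
    (hAG : A ∈ G) (hCG : C ∈ G)
    (hA : ∀ i, (A i : ℕ) =
      if 1 ≤ (i : ℕ) ∧ (i : ℕ) ≤ 2*a then (i : ℕ) + 1 else if (i : ℕ) = 2*a+1 then 1 else i)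
    (hC : ∀ i, (C i : ℕ) =
      if a+1 ≤ (i : ℕ) ∧ (i : ℕ) ≤ 2*a+b then (i : ℕ) + 1
      else if (i : ℕ) = 2*a+b+1 then a+1 else i) :
    ∃ p q r, [0, p, q, r].Nodup ∧ (∀ k ∈ [0, p, q, r], k < 2*a+b+2) ∧
      swap (Fin.ofNat (2*a+b+2) p) (Fin.ofNat (2*a+b+2) q) *
        swap (Fin.ofNat (2*a+b+2) q) (Fin.ofNat (2*a+b+2) r) ∈ G := by
  rcases Nat.eq_zero_or_pos b with hb0 | hb0
  · refine ⟨a + 1, 1, a + 2, by simp; omega, by simp; omega, ?_⟩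
    rw [eq_mul_inv_of_mul_eq (commutator_eq_of_eq_zero (by omega) hb0 hA hC).symm]
    exact mul_mem (mul_mem hAG hCG) (inv_mem (mul_mem hCG hAG))
  have hD : swap (Fin.ofNat (2*a+b+2) (a+1)) (Fin.ofNat (2*a+b+2) (a+2)) *
      swap (Fin.ofNat (2*a+b+2) 1) (Fin.ofNat (2*a+b+2) (2*a+2)) ∈ G := by
    rw [eq_mul_inv_of_mul_eq (commutator_eq_of_pos (by omega) hb0 hA hC).symm]
    exact mul_mem (mul_mem hAG hCG) (inv_mem (mul_mem hCG hAG))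
  have stepA : ∀ k l, (k < 2*a+b+2 ∧ ((1 ≤ k ∧ k ≤ 2*a ∧ l = k + 1) ∨ (k = 2*a+1 ∧ l = 1) ∨
      (2*a+1 < k ∧ l = k))) → A (Fin.ofNat _ k) = Fin.ofNat _ l := by
    intro k l h
    apply Fin.ext
    rw [hA, coe_ofNat_of_lt h.1, coe_ofNat_of_lt (by omega)]
    split_ifs <;> omega
  have stepC : ∀ k l, (k < 2*a+b+2 ∧ ((a+1 ≤ k ∧ k ≤ 2*a+b ∧ l = k + 1) ∨
      (k = 2*a+b+1 ∧ l = a+1) ∨ (k < a+1 ∧ l = k))) → C (Fin.ofNat _ k) = Fin.ofNat _ l := by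
    intro k l h
    apply Fin.ext
    rw [hC, coe_ofNat_of_lt h.1, coe_ofNat_of_lt (by omega)]
    split_ifs <;> omega
  rcases Nat.lt_or_ge a 4 with h4 | h4
  · obtain rfl : a = 2 := by omega
    have hA1 := swap_mul_swap_mem_of_apply_eq hAG (stepA 3 4 (by omega)) (stepA 4 5 (by omega))
      (stepA 1 2 (by omega)) (stepA 6 6 (by omega)) hD
    have hA2 := swap_mul_swap_mem_of_apply_eq hAG (stepA 4 5 (by omega)) (stepA 5 1 (by omega))
      (stepA 2 3 (by omega)) (stepA 6 6 (by omega)) hA1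
    have hA3 := swap_mul_swap_mem_of_apply_eq hAG (stepA 5 1 (by omega)) (stepA 1 2 (by omega))
      (stepA 3 4 (by omega)) (stepA 6 6 (by omega)) hA2
    have hC1 := swap_mul_swap_mem_of_apply_eq hCG (stepC 3 4 (by omega)) (stepC 4 5 (by omega))
      (stepC 1 1 (by omega)) (stepC 6 7 (by omega)) hD
    have hC2 := swap_mul_swap_mem_of_apply_eq hCG (stepC 4 5 (by omega)) (stepC 5 6 (by omega))
      (stepC 1 1 (by omega)) (stepC 7 8 (by omega)) hC1
    have hC3 := swap_mul_swap_mem_of_apply_eq hCG (stepC 5 6 (by omega)) (stepC 6 7 (by omega))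
      (stepC 1 1 (by omega)) (stepC 8 9 (by omega)) hC2
    obtain ⟨x, hx⟩ : ∃ x, (x = 10 ∧ 4 < b) ∨ (x = 3 ∧ b = 4) := by
      rcases eq_or_ne b 4 with h | h
      · exact ⟨3, by omega⟩
      · exact ⟨10, by omega⟩
    have hC4 := swap_mul_swap_mem_of_apply_eq hCG (stepC 6 7 (by omega)) (stepC 7 8 (by omega))
      (stepC 1 1 (by omega)) (stepC 9 x (by omega)) hC3
    have hC5 := swap_mul_swap_mem_comm
      (nodup_map_ofNat (l := [7, 8, 1, x]) (by simp; omega) (by simp; omega)) hC4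
    exact ⟨x, 1, 2, by simp; omega, by simp; omega, three_cycle_mem_of_double_swaps
      (nodup_map_ofNat (l := [1, 2, 4, 6, x, 8, 7]) (by simp; omega) (by simp; omega)) hA3 hC5⟩
  · have hA1 := swap_mul_swap_mem_of_apply_eq hAG (stepA (a+1) (a+2) (by omega))
      (stepA (a+2) (a+3) (by omega)) (stepA 1 2 (by omega))
      (stepA (2*a+2) (2*a+2) (by omega)) hD
    have hA2 := swap_mul_swap_mem_of_apply_eq hAG (stepA (a+2) (a+3) (by omega))
      (stepA (a+3) (a+4) (by omega)) (stepA 2 3 (by omega))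
      (stepA (2*a+2) (2*a+2) (by omega)) hA1
    have h1 := swap_mul_swap_mem_comm (nodup_map_ofNat (l := [a+1, a+2, 1, 2*a+2])
      (by simp; omega) (by simp; omega)) hD
    have h2 := swap_mul_swap_mem_comm (nodup_map_ofNat (l := [a+3, a+4, 3, 2*a+2])
      (by simp; omega) (by simp; omega)) hA2
    rw [swap_comm (Fin.ofNat _ 1)] at h1
    rw [swap_comm (Fin.ofNat _ 3)] at h2
    exact ⟨3, 2*a+2, 1, by simp, by simp; omega, three_cycle_mem_of_double_swaps
      (nodup_map_ofNat (l := [2*a+2, 1, a+2, a+1, 3, a+4, a+3]) (by simp; omega)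
        (by simp; omega)) h1 h2⟩

/-- For even `a` and `b` divisible by 4, the cycles `(1 … 2a+1)` and `(a+1 … 2a+b+1)` generate
every even permutation fixing `0`. -/
theorem stabilizer_inf_alternatingGroup_le_of_cycles (ha : 2 ≤ a) (haeven : a % 2 = 0)
    (hb : b % 4 = 0) (hz : ∀ g ∈ G, g 0 = 0) (hAG : A ∈ G) (hCG : C ∈ G)
    (hA : ∀ i, (A i : ℕ) =
      if 1 ≤ (i : ℕ) ∧ (i : ℕ) ≤ 2*a then (i : ℕ) + 1 else if (i : ℕ) = 2*a+1 then 1 else i)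
    (hC : ∀ i, (C i : ℕ) =
      if a+1 ≤ (i : ℕ) ∧ (i : ℕ) ≤ 2*a+b then (i : ℕ) + 1
      else if (i : ℕ) = 2*a+b+1 then a+1 else i) :
    MulAction.stabilizer (Perm (Fin (2*a+b+2))) (0 : Fin (2*a+b+2)) ⊓
      alternatingGroup (Fin (2*a+b+2)) ≤ G := by
  obtain ⟨p, q, r, hnd, hlt, h⟩ := exists_three_cycle_mem ha haeven hb hAG hCG hA hC
  have hnd' := nodup_map_ofNat hnd hlt
  have h0 : Fin.ofNat (2*a+b+2) 0 = 0 := rfl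
  simp only [List.map_cons, List.map_nil, List.nodup_cons, List.mem_cons, List.not_mem_nil,
    or_false, not_or, h0] at hnd'
  obtain ⟨⟨hp, hq, hr⟩, ⟨hpq, hpr⟩, hqr, -⟩ := hnd'
  refine stabilizer_inf_alternatingGroup_le 0 G (three_cycle_mem_of_two_transitive hz
    (two_transitive_of_cycles (m := a + 1) (M := 2*a+1) (by omega) (by omega) (by omega) hz hAG hCG
      ?_ ?_ ?_) (Ne.symm hp) (Ne.symm hq) (Ne.symm hr) hpq hqr hpr h)
  · intro k hk hk'
    apply Fin.ext
    rw [hA, coe_ofNat_of_lt (by omega), coe_ofNat_of_lt (by omega), if_pos (by omega)]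
  · intro k hk hk'
    apply Fin.ext
    rw [hC, coe_ofNat_of_lt (by omega), coe_ofNat_of_lt (by omega), if_pos (by omega)]
  · intro k hk
    apply Fin.ext
    rw [hC, coe_ofNat_of_lt (by omega), if_neg (by omega), if_neg (by omega)]

end TwoCyclesGenerate

/-- The sign of a permutation cycling `i, i + 1, …, j`. -/
theorem sign_of_interval_cycle {N i j : ℕ} (hij : i ≤ j) (hj : j < N) (f : Perm (Fin N))
    (hf : ∀ x, (f x : ℕ) = if i ≤ (x : ℕ) ∧ (x : ℕ) < j then (x : ℕ) + 1
      else if (x : ℕ) = j then i else x) : sign f = (-1) ^ (j - i) := by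
  have : NeZero N := ⟨by omega⟩
  have hle : (⟨i, by omega⟩ : Fin N) ≤ ⟨j, hj⟩ := hij
  suffices h : f = Fin.cycleIcc ⟨i, by omega⟩ ⟨j, hj⟩ by
    rw [h, Fin.sign_cycleIcc_of_le hle]
  ext x
  rw [hf]
  split_ifs with h1 h2
  · rw [Fin.cycleIcc_of_ge_of_lt (Fin.le_def.mpr h1.1) (Fin.lt_def.mpr h1.2),
      Fin.val_add_one_of_lt' (by omega)]
  · rw [show x = ⟨j, hj⟩ from Fin.ext h2, Fin.cycleIcc_of_last hle]
  · rcases Nat.lt_or_ge x i with h | h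
    · rw [Fin.cycleIcc_of_lt (Fin.lt_def.mpr h)]
    · rw [Fin.cycleIcc_of_gt (Fin.lt_def.mpr (by simp; omega))]

theorem sign_of_involutive_of_fixedPointFree {α : Type*} [Fintype α] [DecidableEq α] (f : Perm α)
    (hf : ∀ x, f (f x) = x) (hne : ∀ x, f x ≠ x) : sign f = (-1) ^ (Fintype.card α / 2) := by
  have : IsEmpty (Function.fixedPoints f) := ⟨fun x ↦ hne x x.2⟩
  rw [sign_of_pow_two_eq_one (by ext x; simp [pow_two, hf]),
    Fintype.card_eq_zero (α := Function.fixedPoints f), Nat.sub_zero]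

/-- If the `p k * τ` are even and fix `0`, and the quotients `p1 * p3⁻¹` and `p2 * p3⁻¹` are the
cycles `(1 … 2a+1)` and `(a+1 … 2a+b+1)`, then the `p k * τ` generate all even permutations
fixing `0`. -/
theorem closure_eq_of_cycle_quotients {a b : ℕ} (ha : 2 ≤ a) (haeven : a % 2 = 0)
    (hb : b % 4 = 0) {τ p1 p2 p3 : Perm (Fin (2*a+b+2))}
    (h1 : (p1 * τ) 0 = 0) (h2 : (p2 * τ) 0 = 0) (h3 : (p3 * τ) 0 = 0)
    (hsp : sign p1 = -1) (hsτ : sign τ = -1)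
    (hA : ∀ i, ((p1 * p3⁻¹) i : ℕ) =
      if 1 ≤ (i : ℕ) ∧ (i : ℕ) ≤ 2*a then (i : ℕ) + 1 else if (i : ℕ) = 2*a+1 then 1 else i)
    (hC : ∀ i, ((p2 * p3⁻¹) i : ℕ) =
      if a+1 ≤ (i : ℕ) ∧ (i : ℕ) ≤ 2*a+b then (i : ℕ) + 1
      else if (i : ℕ) = 2*a+b+1 then a+1 else i) :
    Subgroup.closure ({p1 * τ, p2 * τ, p3 * τ} : Set (Perm (Fin (2*a+b+2))))
      = MulAction.stabilizer (Perm (Fin (2*a+b+2))) (0 : Fin (2*a+b+2))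
        ⊓ alternatingGroup (Fin (2*a+b+2)) := by
  have hsA : sign (p1 * p3⁻¹) = 1 := by
    rw [sign_of_interval_cycle (i := 1) (j := 2*a+1) (by omega) (by omega) _
      (by intro x; rw [hA]; split_ifs <;> omega)]
    exact Even.neg_one_pow ⟨a, by omega⟩
  have hsC : sign (p2 * p3⁻¹) = 1 := by
    rw [sign_of_interval_cycle (i := a + 1) (j := 2*a+b+1) (by omega) (by omega) _
      (by intro x; rw [hC]; split_ifs <;> omega)]
    exact Even.neg_one_pow (Nat.even_iff.mpr (by omega))
  have hs3 : sign p3 = -1 := by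
    rw [map_mul, map_inv, mul_inv_eq_one] at hsA
    rw [← hsA, hsp]
  have hs2 : sign p2 = -1 := by
    rw [map_mul, map_inv, mul_inv_eq_one] at hsC
    rw [hsC, hs3]
  have hle : Subgroup.closure ({p1 * τ, p2 * τ, p3 * τ} : Set (Perm (Fin (2*a+b+2)))) ≤
      MulAction.stabilizer (Perm (Fin (2*a+b+2))) (0 : Fin (2*a+b+2))
        ⊓ alternatingGroup (Fin (2*a+b+2)) := by
    rw [Subgroup.closure_le]
    rintro g (rfl | rfl | rfl)
    · exact ⟨h1, by simp [hsp, hsτ]⟩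
    · exact ⟨h2, by simp [hs2, hsτ]⟩
    · exact ⟨h3, by simp [hs3, hsτ]⟩
  have m1 := Subgroup.subset_closure (G := Perm (Fin (2*a+b+2)))
    (show p1 * τ ∈ ({p1 * τ, p2 * τ, p3 * τ} : Set _) by simp)
  have m2 := Subgroup.subset_closure (G := Perm (Fin (2*a+b+2)))
    (show p2 * τ ∈ ({p1 * τ, p2 * τ, p3 * τ} : Set _) by simp)
  have m3 := Subgroup.subset_closure (G := Perm (Fin (2*a+b+2)))
    (show p3 * τ ∈ ({p1 * τ, p2 * τ, p3 * τ} : Set _) by simp)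
  refine le_antisymm hle (stabilizer_inf_alternatingGroup_le_of_cycles ha haeven hb
    (fun g hg ↦ (hle hg).1) ?_ ?_ hA hC)
  · simpa using mul_mem m1 (inv_mem m3)
  · simpa using mul_mem m2 (inv_mem m3)

theorem closure_even_case_b0mod4 (a b : ℕ) (ha : 1 ≤ a)
    (haeven : a % 2 = 0) (hb : b % 4 = 0)
    (ρ ψ p1 p2 p3 : Equiv.Perm (Fin (2*a+b+2)))
    (hρ : ∀ i : Fin (2*a+b+2), (ρ i : ℕ) =
      if (i : ℕ) ≤ 2*a+1 then ((i : ℕ) + a + 1) % (2*a+2) else 4*a+b+3 - (i : ℕ))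
    (hψ : ∀ i : Fin (2*a+b+2), (ψ i : ℕ) =
      if (i : ℕ) ≤ a+1 then a+1 - (i : ℕ)
      else if (i : ℕ) ≤ 2*a+1 then 3*a+3 - (i : ℕ)
      else 4*a+b+3 - (i : ℕ))
    (hp1 : ∀ i : Fin (2*a+b+2), (p1 i : ℕ) =
      if (i : ℕ) ≤ a then (i : ℕ) + 1
      else if (i : ℕ) = a+1 then 0
      else (i : ℕ))
    (hp2 : ∀ i : Fin (2*a+b+2), (p2 i : ℕ) =
      if (i : ℕ) = 0 then (if b = 0 then a+1 else 2*a+2)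
      else if (i : ℕ) = a+1 then 0
      else if 2*a+2 ≤ (i : ℕ) ∧ (i : ℕ) ≤ 2*a+b then (i : ℕ) + 1
      else if (i : ℕ) = 2*a+b+1 ∧ b ≠ 0 then a+1
      else (i : ℕ))
    (hp3 : ∀ i : Fin (2*a+b+2), (p3 i : ℕ) =
      if (i : ℕ) = 0 then 2*a+1
      else if a+2 ≤ (i : ℕ) ∧ (i : ℕ) ≤ 2*a+1 then (i : ℕ) - 1
      else if (i : ℕ) = a+1 then 0
      else (i : ℕ))
    :
    Subgroup.closure ({p1 * ρ, p2 * ρ, p3 * ρ} : Set (Equiv.Perm (Fin (2*a+b+2))))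
      = MulAction.stabilizer (Equiv.Perm (Fin (2*a+b+2))) (0 : Fin (2*a+b+2))
        ⊓ alternatingGroup (Fin (2*a+b+2)) ∧
    Subgroup.closure ({p1 * ψ, p2 * ψ, p3 * ψ} : Set (Equiv.Perm (Fin (2*a+b+2))))
      = MulAction.stabilizer (Equiv.Perm (Fin (2*a+b+2))) (0 : Fin (2*a+b+2))
        ⊓ alternatingGroup (Fin (2*a+b+2)) := by
  have hcoe0 : ((0 : Fin (2*a+b+2)) : ℕ) = 0 := rfl
  have hA : ∀ i, ((p1 * p3⁻¹) i : ℕ) =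
      if 1 ≤ (i : ℕ) ∧ (i : ℕ) ≤ 2*a then (i : ℕ) + 1 else if (i : ℕ) = 2*a+1 then 1 else i := by
    intro i
    obtain ⟨j, rfl⟩ := p3.surjective i
    rw [mul_apply, inv_eq_iff_eq.mpr rfl]
    have h1 := hp1 j
    have h3 := hp3 j
    have := j.2
    split_ifs at h1 <;> split_ifs at h3 <;> split_ifs <;> omega
  have hC : ∀ i, ((p2 * p3⁻¹) i : ℕ) =
      if a+1 ≤ (i : ℕ) ∧ (i : ℕ) ≤ 2*a+b then (i : ℕ) + 1
      else if (i : ℕ) = 2*a+b+1 then a+1 else i := by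
    intro i
    obtain ⟨j, rfl⟩ := p3.surjective i
    rw [mul_apply, inv_eq_iff_eq.mpr rfl]
    have h2 := hp2 j
    have h3 := hp3 j
    have := j.2
    split_ifs at h2 <;> split_ifs at h3 <;> split_ifs <;> omega
  have hsp : sign p1 = -1 := by
    rw [sign_of_interval_cycle (i := 0) (j := a + 1) (by omega) (by omega) p1
      (by intro x; rw [hp1]; split_ifs <;> omega)]
    exact Odd.neg_one_pow (Nat.odd_iff.mpr (by omega))
  have hsign : sign ρ = -1 ∧ sign ψ = -1 := by
    have hodd : Odd (Fintype.card (Fin (2*a+b+2)) / 2) := by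
      rw [Fintype.card_fin, Nat.odd_iff]
      omega
    have hmod : ∀ i : ℕ, i ≤ 2*a+1 →
        (i + a + 1) % (2*a+2) = if i ≤ a then i + a + 1 else i - (a + 1) := by
      intro i hi
      split_ifs
      · exact Nat.mod_eq_of_lt (by omega)
      · rw [Nat.mod_eq_sub_mod (by omega), Nat.mod_eq_of_lt (by omega)]
        omega
    have hρ' : ∀ i, (ρ i : ℕ) = if (i : ℕ) ≤ a then (i : ℕ) + a + 1
        else if (i : ℕ) ≤ 2*a+1 then (i : ℕ) - (a + 1) else 4*a+b+3 - (i : ℕ) := by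
      intro i
      rw [hρ]
      by_cases hi : (i : ℕ) ≤ 2*a+1
      · rw [if_pos hi, if_pos hi, hmod i hi]
      · rw [if_neg hi, if_neg hi, if_neg (by omega)]
    constructor
    · rw [sign_of_involutive_of_fixedPointFree ρ, hodd.neg_one_pow]
      · intro x
        apply Fin.ext
        have h1 := hρ' x
        have h2 := hρ' (ρ x)
        have := x.2
        split_ifs at h1 <;> split_ifs at h2 <;> omega
      · intro x hx
        have h1 := hρ' x
        have := x.2
        rw [hx] at h1
        split_ifs at h1 <;> omega
    · rw [sign_of_involutive_of_fixedPointFree ψ, hodd.neg_one_pow]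
      · intro x
        apply Fin.ext
        have h1 := hψ x
        have h2 := hψ (ψ x)
        have := x.2
        split_ifs at h1 <;> split_ifs at h2 <;> omega
      · intro x hx
        have h1 := hψ x
        have := x.2
        rw [hx] at h1
        split_ifs at h1 <;> omega
  have hρ0 : (ρ 0 : ℕ) = a + 1 := by
    rw [hρ, hcoe0, if_pos (by omega), Nat.mod_eq_of_lt (by omega), zero_add]
  have hψ0 : (ψ 0 : ℕ) = a + 1 := by
    rw [hψ, hcoe0, if_pos (by omega), Nat.sub_zero]
  have fix1 : ∀ x : Fin (2*a+b+2), (x : ℕ) = a + 1 → p1 x = 0 := fun x hx ↦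
    Fin.ext (by rw [hp1, hx, if_neg (by omega), if_pos rfl, hcoe0])
  have fix2 : ∀ x : Fin (2*a+b+2), (x : ℕ) = a + 1 → p2 x = 0 := fun x hx ↦
    Fin.ext (by rw [hp2, hx, if_neg (by omega), if_pos rfl, hcoe0])
  have fix3 : ∀ x : Fin (2*a+b+2), (x : ℕ) = a + 1 → p3 x = 0 := fun x hx ↦
    Fin.ext (by rw [hp3, hx, if_neg (by omega), if_neg (by omega), if_pos rfl, hcoe0])
  exact ⟨closure_eq_of_cycle_quotients (by omega) haeven hb (fix1 _ hρ0) (fix2 _ hρ0)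
      (fix3 _ hρ0) hsp hsign.1 hA hC,
    closure_eq_of_cycle_quotients (by omega) haeven hb (fix1 _ hψ0) (fix2 _ hψ0)
      (fix3 _ hψ0) hsp hsign.2 hA hC⟩
end

section
/- Suppose a ≡ 0 (mod 2) and b ≡ 2 (mod 4). Then the subgroup of Perm(Fin (n+1)) generated by S1 = {σ_1, σ_2, σ_3} equals the full stabilizer {π ∈ Perm(Fin (n+1)) | π(0) = 0} of the point 0, and likewise for the subgroup generated by S2 = {τ_1, τ_2, τ_3}. (In particular each of S1 and S2 generates a copy of the symmetric group of degree n.) -/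
open Equiv MulAction
open scoped Pointwise

/-- A labelling `v` of the points by `1, …, 2a+b+1` for which `A` is the cycle
`(1, …, 2a+1)` and `B` is the cycle `(1, …, a+1, 2a+b+1, 2a+b, …, 2a+2)`. -/
structure IsThetaPair {β : Type*} (a b : ℕ) (v : β → ℕ) (A B : Perm β) : Prop where
  inj : Function.Injective v
  surj : ∀ i, 1 ≤ i → i ≤ 2*a+b+1 → ∃ x, v x = i
  pos : ∀ x, 1 ≤ v x
  le : ∀ x, v x ≤ 2*a+b+1
  left : ∀ x, v (A x) =
    if v x ≤ 2*a then v x + 1 else if v x = 2*a+1 then 1 else v x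
  right : ∀ x, v (B x) =
    if v x ≤ a then v x + 1 else if v x = a+1 then 2*a+b+1
    else if v x ≤ 2*a+1 then v x else if v x = 2*a+2 then 1 else v x - 1

namespace IsThetaPair

variable {β : Type*} {a b : ℕ} {v : β → ℕ} {A B : Perm β}

/-- A set stable under `A` that meets the cycle of `A` contains this cycle. -/
theorem mem_of_left_stable (h : IsThetaPair a b v A B) {S : Set β}
    (hS : ∀ x ∈ S, A x ∈ S) {x : β} (hx : x ∈ S) (hxv : v x ≤ 2*a+1)
    {y : β} (hy : v y ≤ 2*a+1) : y ∈ S := by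
  have up : ∀ k : ℕ, ∀ x ∈ S, ∀ y, v y = v x + k → v y ≤ 2*a+1 → y ∈ S := by
    intro k
    induction k with
    | zero =>
      intro x hx y hxy _
      rwa [h.inj (hxy : v y = v x)]
    | succ k ih =>
      intro x hx y hxy hy
      refine ih (A x) (hS x hx) y ?_ hy
      rw [h.left, if_pos (by omega)]
      omega
  obtain ⟨z, hz⟩ := h.surj (2*a+1) (by omega) (by omega)
  have hzS : z ∈ S := up (2*a+1 - v x) x hx z (by omega) (by omega)
  have hAz : v (A z) = 1 := by rw [h.left]; simp [hz]
  have := h.pos y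
  exact up (v y - 1) (A z) (hS z hzS) y (by omega) hy

/-- A set stable under `A` and `B` that meets the cycle of `A` is everything. -/
theorem mem_of_stable (h : IsThetaPair a b v A B) {S : Set β}
    (hA : ∀ x ∈ S, A x ∈ S) (hB : ∀ x ∈ S, B x ∈ S) {x : β} (hx : x ∈ S)
    (hxv : v x ≤ 2*a+1) (y : β) : y ∈ S := by
  have low : ∀ y, v y ≤ 2*a+1 → y ∈ S := fun y hy => h.mem_of_left_stable hA hx hxv hy
  have high : ∀ k : ℕ, ∀ y, 2*a+2 ≤ v y → v y + k = 2*a+b+1 → y ∈ S := by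
    intro k
    induction k with
    | zero =>
      intro y hy hyk
      obtain ⟨z, hz⟩ := h.surj (a+1) (by omega) (by omega)
      have : B z = y := h.inj (by rw [h.right, if_neg (by omega), if_pos hz]; omega)
      exact this ▸ hB z (low z (by omega))
    | succ k ih =>
      intro y hy hyk
      obtain ⟨z, hz⟩ := h.surj (v y + 1) (by omega) (by omega)
      have : B z = y := h.inj (by
        rw [h.right, if_neg (by omega), if_neg (by omega), if_neg (by omega),
          if_neg (by omega)]
        omega)
      exact this ▸ hB z (ih z (by omega) (by omega))
  rcases Nat.lt_or_ge (2*a+1) (v y) with hy | hy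
  · have := h.le y
    exact high (2*a+b+1 - v y) y hy (by omega)
  · exact low y hy

theorem isPretransitive (h : IsThetaPair a b v A B) {G : Subgroup (Perm β)}
    (hA : A ∈ G) (hB : B ∈ G) : IsPretransitive G β := by
  obtain ⟨x, hx⟩ := h.surj 1 le_rfl (by omega)
  refine (isPretransitive_iff_orbit_eq_univ x).mpr ?_
  refine Set.eq_univ_of_forall (h.mem_of_stable ?_ ?_ (mem_orbit_self x) (by omega))
  · rintro y hy
    exact mem_orbit_of_mem_orbit (⟨A, hA⟩ : G) hy
  · rintro y hy
    exact mem_orbit_of_mem_orbit (⟨B, hB⟩ : G) hy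

theorem isPreprimitive (h : IsThetaPair a b v A B) (ha : 1 ≤ a) (hb : 1 ≤ b)
    {G : Subgroup (Perm β)} (hA : A ∈ G) (hB : B ∈ G) : IsPreprimitive G β := by
  have := h.isPretransitive hA hB
  obtain ⟨q, hq⟩ := h.surj (2*a+2) (by omega) (by omega)
  have hBq : v (B q) = 1 := by
    rw [h.right, if_neg (by omega), if_neg (by omega), if_neg (by omega), if_pos hq]
  have fixA : ∀ x, 2*a+2 ≤ v x → A x = x := fun x hx =>
    h.inj (by rw [h.left, if_neg (by omega), if_neg (by omega)])
  have stable : ∀ {X : Set β} {f : Perm β}, IsBlock G X → f ∈ G →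
      ∀ z ∈ X, f z ∈ X → ∀ x ∈ X, f x ∈ X := by
    intro X f hX hf z hz hfz x hx
    have e := hX.smul_eq_of_mem (g := (⟨f, hf⟩ : G)) hz hfz
    rw [← e]
    exact Set.smul_mem_smul_set hx
  refine IsPreprimitive.of_isTrivialBlock_base q fun {X} hqX hX => ?_
  have stA : ∀ x ∈ X, A x ∈ X :=
    stable hX hA q hqX ((fixA q hq.ge).symm ▸ hqX)
  have full : (∃ x ∈ X, v x ≤ 2*a+1) → X = Set.univ := by
    rintro ⟨x, hx, hxv⟩
    have hBqX : B q ∈ X := h.mem_of_left_stable stA hx hxv (by omega)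
    exact Set.eq_univ_of_forall
      (h.mem_of_stable stA (stable hX hB q hqX hBqX) hx hxv)
  by_cases hX1 : X = {q}
  · exact Or.inl (hX1 ▸ Set.subsingleton_singleton)
  refine Or.inr (full ?_)
  obtain ⟨y, hy, hyq⟩ : ∃ y ∈ X, y ≠ q := by
    by_contra! hc
    exact hX1 (Set.eq_singleton_iff_unique_mem.mpr ⟨hqX, hc⟩)
  by_cases hyv : v y ≤ 2*a+1
  · exact ⟨y, hy, hyv⟩
  have hyq' : v y ≠ 2*a+2 := fun e => hyq (h.inj (e.trans hq.symm))
  have hBy : v (B y) = v y - 1 := by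
    rw [h.right, if_neg (by omega), if_neg (by omega), if_neg (by omega),
      if_neg (by omega)]
  -- the translate `B • X` contains the fixed point `B y` of `A` and the point `B q` of its cycle
  have hY : IsBlock G ((⟨B, hB⟩ : G) • X) := hX.translate _
  have mem : ∀ x, x ∈ X → B x ∈ (⟨B, hB⟩ : G) • X := fun x hx => Set.smul_mem_smul_set hx
  have stAY := stable hY hA (B y) (mem y hy) ((fixA (B y) (by omega)).symm ▸ mem y hy)
  have hBBq : B (B q) ∈ (⟨B, hB⟩ : G) • X :=
    h.mem_of_left_stable stAY (mem q hqX) (by omega) (by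
      rw [h.right, if_pos (by omega)]; omega)
  obtain ⟨z, hz, hzB⟩ := hBBq
  have : z = B q := B.injective hzB
  exact ⟨B q, this ▸ hz, by omega⟩

variable [DecidableEq β]

/-- The commutator of `A` and `B⁻¹` is a product of two disjoint transpositions. -/
theorem swap_mul_swap_mem (h : IsThetaPair a b v A B) (ha : 1 ≤ a) (hb : 1 ≤ b)
    {G : Subgroup (Perm β)} (hA : A ∈ G) (hB : B ∈ G) {s x t q : β}
    (hs : v s = a+1) (hx : v x = a+2) (ht : v t = 1) (hq : v q = 2*a+2) :
    swap s x * swap t q ∈ G := by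
  have key : B * (swap s x * swap t q) * A = A * B := by
    ext y
    apply h.inj
    have sw : ∀ c d z : β, v (swap c d z) =
        if v z = v c then v d else if v z = v d then v c else v z := by
      intro c d z
      simp only [swap_apply_def, h.inj.eq_iff]
      split_ifs <;> rfl
    simp only [Perm.mul_apply, h.left, h.right, sw, hs, hx, ht, hq]
    have := h.pos y
    have := h.le y
    grind
  have : swap s x * swap t q = B⁻¹ * (A * B) * A⁻¹ := by rw [← key]; group
  rw [this]
  exact G.mul_mem (G.mul_mem (G.inv_mem hB) (G.mul_mem hA hB)) (G.inv_mem hA)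

theorem exists_isThreeCycle_mem [Fintype β] (h : IsThetaPair a b v A B) (ha : a = 2 ∨ 4 ≤ a)
    (hb : 2 ≤ b) {G : Subgroup (Perm β)} (hA : A ∈ G) (hB : B ∈ G) :
    ∃ g ∈ G, g.IsThreeCycle := by
  obtain ⟨s, hs⟩ := h.surj (a+1) (by omega) (by omega)
  obtain ⟨x, hx⟩ := h.surj (a+2) (by omega) (by omega)
  obtain ⟨t, ht⟩ := h.surj 1 (by omega) (by omega)
  obtain ⟨q, hq⟩ := h.surj (2*a+2) (by omega) (by omega)
  have hT := h.swap_mul_swap_mem (by omega) (by omega) hA hB hs hx ht hq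
  have conj_mem : ∀ f ∈ G, swap (f s) (f x) * swap (f t) (f q) ∈ G := by
    intro f hf
    have : swap (f s) (f x) * swap (f t) (f q) = f * (swap s x * swap t q) * f⁻¹ := by
      simp only [swap_apply_apply]; group
    rw [this]
    exact G.mul_mem (G.mul_mem hf hT) (G.inv_mem hf)
  have ne : ∀ {y z : β}, v y ≠ v z → y ≠ z := fun hyz e => hyz (e ▸ rfl)
  rcases ha with rfl | ha
  · have hT' := conj_mem (A * (A * B)) (G.mul_mem hA (G.mul_mem hA hB))
    simp only [Perm.mul_apply] at hT'
    have e1 : v (A (A (B s))) = 2*2+b+1 := by simp [h.left, h.right, hs]; grind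
    have e2 : A (A (B x)) = t := h.inj (by simp [h.left, h.right, hx, ht])
    have e3 : A (A (B t)) = x := h.inj (by simp [h.left, h.right, hx, ht])
    have e4 : A (A (B q)) = s := h.inj (by simp [h.left, h.right, hq, hs])
    rw [e2, e3, e4] at hT'
    set r := A (A (B s))
    have e : swap r t * swap x s * (swap s x * swap t q) = swap t r * swap t q := by
      rw [swap_comm x s, swap_comm r t, mul_assoc, swap_mul_self_mul]
    have hmul := G.mul_mem hT' hT
    rw [e] at hmul
    exact ⟨_, hmul,
      Perm.isThreeCycle_swap_mul_swap_same (ne (by omega)) (ne (by omega)) (ne (by omega))⟩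
  · have hT' := conj_mem (A * A) (G.mul_mem hA hA)
    simp only [Perm.mul_apply] at hT'
    have e1 : v (A (A s)) = a+3 := by
      rw [h.left, h.left, hs]; grind
    have e2 : v (A (A x)) = a+4 := by
      rw [h.left, h.left, hx]; grind
    have e3 : v (A (A t)) = 3 := by
      rw [h.left, h.left, ht]; grind
    have e4 : A (A q) = q := h.inj (by rw [h.left, h.left, hq]; grind)
    rw [e4] at hT'
    set s' := A (A s)
    set x' := A (A x)
    set t' := A (A t)
    have hmul := G.mul_mem hT hT'
    refine ⟨_, G.mul_mem hmul hmul, ?_⟩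
    have hc : (swap q t * swap q t').IsThreeCycle :=
      Perm.isThreeCycle_swap_mul_swap_same (ne (by omega)) (ne (by omega)) (ne (by omega))
    have comm : ∀ {c d e f : β}, v c ≠ v d → v e ≠ v f → v c ≠ v e → v c ≠ v f → v d ≠ v e →
        v d ≠ v f → Commute (swap c d) (swap e f) := by
      intro c d e f h1 h2 h3 h4 h5 h6
      refine (Perm.disjoint_swap_swap ?_).commute
      simp [ne h1, ne h2, ne h3, ne h4, ne h5, ne h6]
    have c1 : Commute (swap s x) (swap s' x') := by apply comm <;> omega
    have c2 : Commute (swap s x) (swap q t) := by apply comm <;> omega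
    have c3 : Commute (swap s x) (swap q t') := by apply comm <;> omega
    have c4 : Commute (swap s' x') (swap q t) := by apply comm <;> omega
    have c5 : Commute (swap s' x') (swap q t') := by apply comm <;> omega
    have e : swap s x * swap t q * (swap s' x' * swap t' q) =
        swap s x * swap s' x' * (swap q t * swap q t') := by
      rw [swap_comm t q, swap_comm t' q, mul_assoc, ← mul_assoc (swap q t), ← c4.eq]
      group
    have hd : swap s x * swap s' x' * (swap s x * swap s' x') = 1 := by
      rw [c1.symm.mul_mul_mul_comm, swap_mul_self, swap_mul_self, one_mul]
    have hcomm : Commute (swap q t * swap q t') (swap s x * swap s' x') :=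
      ((c2.mul_right c3).mul_left (c4.mul_right c5)).symm
    rw [e, hcomm.mul_mul_mul_comm, hd, one_mul]
    exact hc.isThreeCycle_sq

end IsThetaPair

theorem sign_eq_one_of_involutive {α : Type*} [Fintype α] [DecidableEq α] {f : Perm α}
    (hf : ∀ x, f (f x) = x) (hfix : ∀ x, f x ≠ x) (hcard : 4 ∣ Fintype.card α) :
    Perm.sign f = 1 := by
  have h2 : f ^ 2 = 1 := by
    ext x
    simp [sq, hf]
  have h0 : Fintype.card (Function.fixedPoints f) = 0 :=
    Fintype.card_eq_zero_iff.mpr ⟨fun x => hfix x.1 x.2⟩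
  rw [Perm.sign_of_pow_two_eq_one h2, h0]
  obtain ⟨k, hk⟩ := hcard
  exact Even.neg_one_pow ⟨k, by omega⟩

/-- A subgroup of the stabilizer of a point is the whole stabilizer as soon as its restriction
to the other points is. -/
theorem eq_stabilizer_of_comap_ofSubtype_eq_top {α : Type*} [DecidableEq α] {z : α}
    {G : Subgroup (Perm α)} (hle : G ≤ stabilizer (Perm α) z)
    (h : G.comap (Perm.ofSubtype (p := fun i => i ≠ z)) = ⊤) : G = stabilizer (Perm α) z := by
  refine le_antisymm hle fun π hπ => ?_
  have hz : π z = z := hπ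
  have hp : ∀ x, π x ≠ z ↔ x ≠ z := fun x => by
    rw [not_iff_not]
    exact ⟨fun e => π.injective (e.trans hz.symm), fun e => e ▸ hz⟩
  have hmem : π.subtypePerm hp ∈ G.comap (Perm.ofSubtype (p := fun i => i ≠ z)) :=
    h ▸ Subgroup.mem_top _
  have := Subgroup.mem_comap.mp hmem
  rwa [Perm.ofSubtype_subtypePerm (p := fun i => i ≠ z) hp (fun x hx e => hx (e ▸ hz))] at this

theorem eq_top_of_alternatingGroup_le {α : Type*} [Fintype α] [DecidableEq α]
    {G : Subgroup (Perm α)} (hG : alternatingGroup α ≤ G) {g : Perm α} (hg : g ∈ G)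
    (hsign : Perm.sign g = -1) : G = ⊤ := by
  refine (Subgroup.eq_top_iff' G).mpr fun π => ?_
  rcases Int.units_eq_one_or (Perm.sign π) with hπ | hπ
  · exact hG (Perm.mem_alternatingGroup.mpr hπ)
  · have : π * g ∈ G := hG (Perm.mem_alternatingGroup.mpr (by simp [hπ, hsign]))
    exact (G.mul_mem_cancel_right hg).mp this

theorem sign_eq_neg_one_of_cycle {N a : ℕ} (haN : a + 1 < N) (haeven : a % 2 = 0)
    {p : Perm (Fin N)} (hp : ∀ i : Fin N, (p i : ℕ) =
      if (i : ℕ) ≤ a then (i : ℕ) + 1 else if (i : ℕ) = a+1 then 0 else (i : ℕ)) :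
    Perm.sign p = -1 := by
  have : p = Fin.cycleRange ⟨a+1, haN⟩ := by
    ext i
    rw [hp]
    rcases lt_trichotomy i ⟨a+1, haN⟩ with hi | hi | hi
    · rw [Fin.coe_cycleRange_of_lt hi, if_pos (by simpa [Fin.lt_def, Nat.lt_succ_iff] using hi)]
    · have : NeZero N := ⟨by omega⟩
      rw [Fin.cycleRange_of_eq hi]
      simp [hi]
    · rw [Fin.cycleRange_of_gt hi]
      have : a + 1 < (i : ℕ) := hi
      rw [if_neg (by omega), if_neg (by omega)]
  rw [this, Fin.sign_cycleRange]
  exact Odd.neg_one_pow (Nat.odd_iff.mpr (by simp; omega))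

/-- If `r` is even and sends `0` to `a+1`, the three path cycles of the theta graph composed
with `r` generate the stabilizer of `0`. -/
theorem closure_mul_eq_stabilizer (a b : ℕ) (ha : a = 2 ∨ 4 ≤ a)
    (haeven : a % 2 = 0) (hb : 2 ≤ b)
    (r p1 p2 p3 : Perm (Fin (2*a+b+2))) (hr : Perm.sign r = 1)
    (hr0 : (r 0 : ℕ) = a+1)
    (hp1 : ∀ i : Fin (2*a+b+2), (p1 i : ℕ) =
      if (i : ℕ) ≤ a then (i : ℕ) + 1
      else if (i : ℕ) = a+1 then 0
      else (i : ℕ))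
    (hp2 : ∀ i : Fin (2*a+b+2), (p2 i : ℕ) =
      if (i : ℕ) = 0 then (if b = 0 then a+1 else 2*a+2)
      else if (i : ℕ) = a+1 then 0
      else if 2*a+2 ≤ (i : ℕ) ∧ (i : ℕ) ≤ 2*a+b then (i : ℕ) + 1
      else if (i : ℕ) = 2*a+b+1 ∧ b ≠ 0 then a+1
      else (i : ℕ))
    (hp3 : ∀ i : Fin (2*a+b+2), (p3 i : ℕ) =
      if (i : ℕ) = 0 then 2*a+1
      else if a+2 ≤ (i : ℕ) ∧ (i : ℕ) ≤ 2*a+1 then (i : ℕ) - 1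
      else if (i : ℕ) = a+1 then 0
      else (i : ℕ)) :
    Subgroup.closure ({p1 * r, p2 * r, p3 * r} : Set (Perm (Fin (2*a+b+2))))
      = stabilizer (Perm (Fin (2*a+b+2))) (0 : Fin (2*a+b+2)) := by
  set G := Subgroup.closure ({p1 * r, p2 * r, p3 * r} : Set (Perm (Fin (2*a+b+2)))) with hG
  have m1 : p1 * r ∈ G := Subgroup.subset_closure (by simp)
  have m2 : p2 * r ∈ G := Subgroup.subset_closure (by simp)
  have m3 : p3 * r ∈ G := Subgroup.subset_closure (by simp)
  have hle : G ≤ stabilizer (Perm (Fin (2*a+b+2))) (0 : Fin (2*a+b+2)) := by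
    rw [hG, Subgroup.closure_le]
    rintro f (rfl | rfl | rfl) <;> change _ = (0 : Fin (2*a+b+2)) <;> apply Fin.ext
    · simp [hp1, hr0]
    · simp [hp2, hr0]
    · simp [hp3, hr0]
  have hfix : ∀ {f : Perm (Fin (2*a+b+2))}, f ∈ G → ∀ x, f x ≠ 0 ↔ x ≠ 0 := fun {f} hf x => by
    have h0 : f 0 = 0 := hle hf
    rw [not_iff_not]
    exact ⟨fun e => f.injective (e.trans h0.symm), fun e => e ▸ h0⟩
  refine eq_stabilizer_of_comap_ofSubtype_eq_top hle ?_
  have hcomap : ∀ {f : Perm (Fin (2*a+b+2))} (hf : f ∈ G),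
      f.subtypePerm (hfix hf) ∈ G.comap (Perm.ofSubtype (p := fun i => i ≠ 0)) := by
    intro f hf
    rw [Subgroup.mem_comap, Perm.ofSubtype_subtypePerm]
    · exact hf
    · rintro x hx rfl
      exact hx (hle hf)
  have hA : p1 * p3⁻¹ ∈ G := by
    convert G.mul_mem m1 (G.inv_mem m3) using 1
    group
  have hB : p1 * p2⁻¹ ∈ G := by
    convert G.mul_mem m1 (G.inv_mem m2) using 1
    group
  have hpair : IsThetaPair a b (fun x : {i : Fin (2*a+b+2) // i ≠ 0} => (x.1 : ℕ))
      ((p1 * p3⁻¹).subtypePerm (hfix hA)) ((p1 * p2⁻¹).subtypePerm (hfix hB)) := by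
    refine ⟨Fin.val_injective.comp Subtype.val_injective, ?_, ?_, ?_, ?_, ?_⟩
    · intro i hi hi'
      exact ⟨⟨⟨i, by omega⟩, fun e => by simp [Fin.ext_iff] at e; omega⟩, rfl⟩
    · exact fun x => Nat.one_le_iff_ne_zero.mpr fun e => x.2 (Fin.ext e)
    · exact fun x => Nat.lt_succ_iff.mp x.1.2
    · rintro ⟨x, hx⟩
      obtain ⟨y, rfl⟩ := p3.surjective x
      have hx' : (p3 y : ℕ) ≠ 0 := fun e => hx (Fin.ext e)
      have := y.2
      simp only [Perm.subtypePerm_apply, Perm.mul_apply, Perm.inv_def, symm_apply_apply]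
      have h1 := hp1 y
      have h2 := hp3 y
      clear hp1 hp2 hp3 hr0
      generalize (p3 y : ℕ) = j at *
      generalize (p1 y : ℕ) = l at *
      generalize (y : ℕ) = k at *
      split_ifs at h2 <;> split_ifs at h1 <;> first | omega | (split_ifs <;> omega)
    · rintro ⟨x, hx⟩
      obtain ⟨y, rfl⟩ := p2.surjective x
      have hx' : (p2 y : ℕ) ≠ 0 := fun e => hx (Fin.ext e)
      have := y.2
      simp only [Perm.subtypePerm_apply, Perm.mul_apply, Perm.inv_def, symm_apply_apply]
      have h1 := hp1 y
      have h2 := hp2 y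
      clear hp1 hp2 hp3 hr0
      generalize (p2 y : ℕ) = j at *
      generalize (p1 y : ℕ) = l at *
      generalize (y : ℕ) = k at *
      split_ifs at h2 <;> split_ifs at h1 <;> first | omega | (split_ifs <;> omega)
  obtain ⟨g, hg, hg3⟩ := hpair.exists_isThreeCycle_mem ha hb (hcomap hA) (hcomap hB)
  have hprim := hpair.isPreprimitive (by omega) (by omega) (hcomap hA) (hcomap hB)
  refine eq_top_of_alternatingGroup_le
    (Perm.alternatingGroup_le_of_isPreprimitive_of_isThreeCycle_mem hprim hg3 hg) (hcomap m1) ?_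
  rw [← Perm.sign_ofSubtype, Perm.ofSubtype_subtypePerm (p := fun i => i ≠ 0) (hfix m1)
    (fun x hx e => hx (e ▸ hle m1)), Perm.sign_mul, hr, mul_one]
  exact sign_eq_neg_one_of_cycle (by omega) haeven hp1


theorem closure_even_case_b2mod4 (a b : ℕ) (ha : 1 ≤ a)
    (haeven : a % 2 = 0) (hb : b % 4 = 2)
    (ρ ψ p1 p2 p3 : Equiv.Perm (Fin (2*a+b+2)))
    (hρ : ∀ i : Fin (2*a+b+2), (ρ i : ℕ) =
      if (i : ℕ) ≤ 2*a+1 then ((i : ℕ) + a + 1) % (2*a+2) else 4*a+b+3 - (i : ℕ))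
    (hψ : ∀ i : Fin (2*a+b+2), (ψ i : ℕ) =
      if (i : ℕ) ≤ a+1 then a+1 - (i : ℕ)
      else if (i : ℕ) ≤ 2*a+1 then 3*a+3 - (i : ℕ)
      else 4*a+b+3 - (i : ℕ))
    (hp1 : ∀ i : Fin (2*a+b+2), (p1 i : ℕ) =
      if (i : ℕ) ≤ a then (i : ℕ) + 1
      else if (i : ℕ) = a+1 then 0
      else (i : ℕ))
    (hp2 : ∀ i : Fin (2*a+b+2), (p2 i : ℕ) =
      if (i : ℕ) = 0 then (if b = 0 then a+1 else 2*a+2)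
      else if (i : ℕ) = a+1 then 0
      else if 2*a+2 ≤ (i : ℕ) ∧ (i : ℕ) ≤ 2*a+b then (i : ℕ) + 1
      else if (i : ℕ) = 2*a+b+1 ∧ b ≠ 0 then a+1
      else (i : ℕ))
    (hp3 : ∀ i : Fin (2*a+b+2), (p3 i : ℕ) =
      if (i : ℕ) = 0 then 2*a+1
      else if a+2 ≤ (i : ℕ) ∧ (i : ℕ) ≤ 2*a+1 then (i : ℕ) - 1
      else if (i : ℕ) = a+1 then 0
      else (i : ℕ))
    :
    Subgroup.closure ({p1 * ρ, p2 * ρ, p3 * ρ} : Set (Equiv.Perm (Fin (2*a+b+2))))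
      = MulAction.stabilizer (Equiv.Perm (Fin (2*a+b+2))) (0 : Fin (2*a+b+2)) ∧
    Subgroup.closure ({p1 * ψ, p2 * ψ, p3 * ψ} : Set (Equiv.Perm (Fin (2*a+b+2))))
      = MulAction.stabilizer (Equiv.Perm (Fin (2*a+b+2))) (0 : Fin (2*a+b+2)) := by
  have hcard : 4 ∣ Fintype.card (Fin (2*a+b+2)) := by
    rw [Fintype.card_fin]; omega
  constructor
  · refine closure_mul_eq_stabilizer a b (by omega) haeven (by omega) ρ p1 p2 p3 ?_ ?_ hp1 hp2 hp3
    · have hρ' : ∀ i : Fin (2*a+b+2), (ρ i : ℕ) = if (i : ℕ) ≤ a then (i : ℕ) + a + 1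
          else if (i : ℕ) ≤ 2*a+1 then (i : ℕ) - (a + 1) else 4*a+b+3 - (i : ℕ) := by
        intro i
        rw [hρ]
        split_ifs with h1 h2 h2
        · exact Nat.mod_eq_of_lt (by omega)
        · rw [Nat.mod_eq_sub_mod (by omega), Nat.mod_eq_of_lt (by omega)]
          omega
        · omega
        · rfl
      refine sign_eq_one_of_involutive (fun x => Fin.ext ?_) (fun x e => ?_) hcard
      · have h1 := hρ' x
        have h2 := hρ' (ρ x)
        have := x.2
        split_ifs at h1 <;> split_ifs at h2 <;> omega
      · have h1 := hρ' x
        rw [e] at h1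
        split_ifs at h1 <;> omega
    · rw [hρ]
      simp only [Fin.val_zero, Nat.zero_le, if_true, Nat.zero_add]
      exact Nat.mod_eq_of_lt (by omega)
  · refine closure_mul_eq_stabilizer a b (by omega) haeven (by omega) ψ p1 p2 p3 ?_ ?_ hp1 hp2 hp3
    · refine sign_eq_one_of_involutive (fun x => Fin.ext ?_) (fun x e => ?_) hcard
      · have h1 := hψ x
        have h2 := hψ (ψ x)
        have := x.2
        split_ifs at h1 <;> split_ifs at h2 <;> omega
      · have h1 := hψ x
        rw [e] at h1
        split_ifs at h1 <;> omega
    · simp [hψ]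
end

section
/- Suppose a ≡ 1 (mod 2). If b ≡ 1 (mod 4), then the subgroup of Perm(Fin (n+1)) generated by S1 = {σ_1, σ_2, σ_3} equals the group of even permutations fixing 0 (the stabilizer of 0 intersected with the alternating group), while the subgroup generated by S2 = {τ_1, τ_2, τ_3} equals the full stabilizer {π | π(0) = 0}. If instead b ≡ 3 (mod 4), then the subgroup generated by S1 equals the full stabilizer of 0, while the subgroup generated by S2 equals the stabilizer of 0 intersected with the alternating group. -/
open Equiv Equiv.Perm

/-- `x` is sent to `y` by a three-cycle of `G`. -/
def ThreeCycleStep {α : Type*} [Fintype α] [DecidableEq α] (G : Subgroup (Perm α))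
    (x y : α) : Prop :=
  ∃ g ∈ G, g.IsThreeCycle ∧ g x = y

theorem Equiv.Perm.IsThreeCycle.eq_apply_or_apply_eq {α : Type*} [Fintype α] [DecidableEq α]
    {g : Perm α} (hg : g.IsThreeCycle) {x y : α} (hxy : x ≠ y) (hx : g x ≠ x) (hy : g y ≠ y) :
    g x = y ∨ g y = x := by
  obtain ⟨i, hi, h⟩ := (hg.isCycle.sameCycle hx hy).exists_pow_eq_of_mem_support
    (mem_support.mpr hx)
  have h3 : g ^ 3 = 1 := by rw [← hg.orderOf, pow_orderOf_eq_one]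
  have hc : (g.cycleOf x).support.card = 3 := by
    rw [hg.isCycle.cycleOf_eq hx, hg.card_support]
  rw [hc] at hi
  interval_cases i
  · exact absurd h hxy
  · exact Or.inl h
  · right
    rw [← h, ← Perm.mul_apply, ← pow_succ', h3, Perm.one_apply]

theorem isBlock_apply_mem_of_isThreeCycle {α : Type*} [Fintype α] [DecidableEq α]
    {G : Subgroup (Perm α)} {B : Set α} (hB : MulAction.IsBlock G B) (hB' : B.Nontrivial)
    {g : Perm α} (hgG : g ∈ G) (hg : g.IsThreeCycle) {x : α} : g x ∈ B ↔ x ∈ B := by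
  have hmem : ∀ z ∈ B, g z ∈ B → ∀ y, g y ∈ B ↔ y ∈ B := by
    intro z hz hgz y
    have h := hB.smul_eq_of_mem (g := ⟨g, hgG⟩) hz hgz
    have := Set.smul_mem_smul_set_iff (a := (⟨g, hgG⟩ : G)) (s := B) (x := y)
    rwa [h] at this
  obtain ⟨y, hy, z, hz, hyz⟩ := hB'
  by_cases h1 : g y = y
  · exact hmem y hy (h1.symm ▸ hy) x
  by_cases h2 : g z = z
  · exact hmem z hz (h2.symm ▸ hz) x
  rcases hg.eq_apply_or_apply_eq hyz h1 h2 with h | h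
  · exact hmem y hy (h.symm ▸ hz) x
  · exact hmem z hz (h.symm ▸ hy) x

theorem alternatingGroup_le_of_eqvGen {α : Type*} [Fintype α] [DecidableEq α]
    {G : Subgroup (Perm α)} {g : Perm α} (hgG : g ∈ G) (hg : g.IsThreeCycle)
    (h : ∀ x y, Relation.EqvGen (ThreeCycleStep G) x y) : alternatingGroup α ≤ G := by
  have hpre : MulAction.IsPretransitive G α := by
    refine ⟨fun x y => ?_⟩
    induction h x y with
    | rel x y hxy =>
      obtain ⟨k, hk, -, hkx⟩ := hxy
      exact ⟨⟨k, hk⟩, hkx⟩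
    | refl x => exact ⟨1, one_smul _ x⟩
    | symm x y _ ih =>
      obtain ⟨k, rfl⟩ := ih
      exact ⟨k⁻¹, inv_smul_smul k x⟩
    | trans x y z _ _ ih₁ ih₂ =>
      obtain ⟨k, rfl⟩ := ih₁
      obtain ⟨l, rfl⟩ := ih₂
      exact ⟨l * k, mul_smul l k x⟩
  refine alternatingGroup_le_of_isPreprimitive_of_isThreeCycle_mem ⟨fun {B} hB => ?_⟩ hg hgG
  by_cases hB' : B.Subsingleton
  · exact Or.inl hB'
  rw [Set.not_subsingleton_iff] at hB'
  right
  have key : ∀ x y, x ∈ B ↔ y ∈ B := by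
    intro x y
    induction h x y with
    | rel x y hxy =>
      obtain ⟨k, hk, hk3, rfl⟩ := hxy
      exact (isBlock_apply_mem_of_isThreeCycle hB hB' hk hk3).symm
    | refl x => rfl
    | symm x y _ ih => exact ih.symm
    | trans x y z _ _ ih₁ ih₂ => exact ih₁.trans ih₂
  obtain ⟨z, hz⟩ := hB'.nonempty
  exact Set.eq_univ_of_forall fun x => (key z x).mp hz

/-- The version of `alternatingGroup_le_of_eqvGen` for a group fixing a point. -/
theorem stabilizer_inf_alternatingGroup_le_of_eqvGen {α : Type*} [Fintype α] [DecidableEq α]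
    {G : Subgroup (Perm α)} {o : α} (hG : G ≤ MulAction.stabilizer (Perm α) o)
    {g : Perm α} (hgG : g ∈ G) (hg : g.IsThreeCycle)
    (h : ∀ x y, x ≠ o → y ≠ o → Relation.EqvGen (ThreeCycleStep G) x y) :
    MulAction.stabilizer (Perm α) o ⊓ alternatingGroup α ≤ G := by
  let H : Subgroup (Perm {x // x ≠ o}) := G.comap ofSubtype
  have hfix : ∀ k ∈ MulAction.stabilizer (Perm α) o, ∀ x, k x ≠ o ↔ x ≠ o := by
    intro k hk x
    have hk' : k o = o := hk
    rw [not_iff_not]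
    constructor
    · intro hx
      exact k.injective (hx.trans hk'.symm)
    · rintro rfl
      exact hk'
  have hsub : ∀ k (hk : k ∈ MulAction.stabilizer (Perm α) o),
      ofSubtype (k.subtypePerm (p := (· ≠ o)) (hfix k hk)) = k := by
    intro k hk
    refine ofSubtype_subtypePerm _ fun x hx hxo => hx ?_
    rw [hxo]
    exact hk
  have hlift : ∀ k (hk : k ∈ G), k.subtypePerm (p := (· ≠ o)) (hfix k (hG hk)) ∈ H := by
    intro k hk
    change ofSubtype _ ∈ G
    rwa [hsub k (hG hk)]
  have h3 : ∀ k (hk : k ∈ G), k.IsThreeCycle →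
      (k.subtypePerm (p := (· ≠ o)) (hfix k (hG hk))).IsThreeCycle := by
    intro k hk hk3
    rw [IsThreeCycle, ← cycleType_ofSubtype, hsub k (hG hk)]
    exact hk3
  have hstep : ∀ x y, Relation.EqvGen (ThreeCycleStep G) x y → (x = o ↔ y = o) ∧
      ∀ (hx : x ≠ o) (hy : y ≠ o), Relation.EqvGen (ThreeCycleStep H) ⟨x, hx⟩ ⟨y, hy⟩ := by
    intro x y hxy
    induction hxy with
    | rel x y hxy =>
      obtain ⟨k, hk, hk3, rfl⟩ := hxy
      exact ⟨(not_iff_not.mp (hfix k (hG hk) x)).symm, fun hx hy =>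
        .rel _ _ ⟨_, hlift k hk, h3 k hk hk3, rfl⟩⟩
    | refl x => exact ⟨Iff.rfl, fun _ _ => .refl _⟩
    | symm x y _ ih => exact ⟨ih.1.symm, fun hx hy => (ih.2 hy hx).symm⟩
    | trans x y z _ _ ih₁ ih₂ =>
      exact ⟨ih₁.1.trans ih₂.1, fun hx hz =>
        (ih₁.2 hx (mt ih₁.1.mpr hx)).trans _ _ _ (ih₂.2 (mt ih₁.1.mpr hx) hz)⟩
  have hH : alternatingGroup {x // x ≠ o} ≤ H :=
    alternatingGroup_le_of_eqvGen (hlift g hgG) (h3 g hgG hg) fun x y =>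
      (hstep x y (h x y x.2 y.2)).2 x.2 y.2
  rintro k ⟨hk, hkA⟩
  have : k.subtypePerm (p := (· ≠ o)) (hfix k hk) ∈ H := by
    apply hH
    rw [mem_alternatingGroup, ← sign_ofSubtype, hsub k hk]
    exact hkA
  have h' : ofSubtype (k.subtypePerm (p := (· ≠ o)) (hfix k hk)) ∈ G := this
  rwa [hsub k hk] at h'

theorem eqvGen_threeCycleStep_apply {α : Type*} [Fintype α] [DecidableEq α]
    {G : Subgroup (Perm α)} {g : Perm α} (hg : g ∈ G) {x y : α}
    (h : Relation.EqvGen (ThreeCycleStep G) x y) :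
    Relation.EqvGen (ThreeCycleStep G) (g x) (g y) := by
  induction h with
  | rel x y hxy =>
    obtain ⟨k, hk, hk3, rfl⟩ := hxy
    refine .rel _ _ ⟨g * k * g⁻¹, G.mul_mem (G.mul_mem hg hk) (G.inv_mem hg), ?_, by simp⟩
    rwa [IsThreeCycle, cycleType_conj]
  | refl x => exact .refl _
  | symm x y _ ih => exact ih.symm
  | trans x y z _ _ ih₁ ih₂ => exact ih₁.trans _ _ _ ih₂

section Core

variable {a b : ℕ} {G : Subgroup (Perm (Fin (2 * a + b + 2)))}
  {d e r s : Perm (Fin (2 * a + b + 2))}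

theorem isThreeCycle_of_eq_one (ha : a = 1)
    (hd : ∀ i : Fin (2 * a + b + 2), (d i : ℕ) = if (i : ℕ) = 0 then 0
      else if (i : ℕ) ≤ 2 * a then (i : ℕ) + 1 else if (i : ℕ) = 2 * a + 1 then 1 else (i : ℕ)) :
    d.IsThreeCycle := by
  subst ha
  obtain ⟨u, hu⟩ : ∃ u : Fin (2 * 1 + b + 2), (u : ℕ) = 1 := ⟨⟨1, by omega⟩, rfl⟩
  obtain ⟨v, hv⟩ : ∃ v : Fin (2 * 1 + b + 2), (v : ℕ) = 2 := ⟨⟨2, by omega⟩, rfl⟩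
  obtain ⟨w, hw⟩ : ∃ w : Fin (2 * 1 + b + 2), (w : ℕ) = 3 := ⟨⟨3, by omega⟩, rfl⟩
  have : d = swap u w * swap u v := by
    ext i
    rw [hd, Perm.mul_apply, swap_apply_def, swap_apply_def]
    simp only [Fin.ext_iff]
    split_ifs <;> grind
  rw [this]
  apply isThreeCycle_swap_mul_swap_same <;> simp only [ne_eq, Fin.ext_iff] <;> omega

theorem exists_isThreeCycle_of_three_le (ha : 3 ≤ a) (hb : 1 ≤ b) (hdG : d ∈ G) (heG : e ∈ G)
    (hd : ∀ i : Fin (2 * a + b + 2), (d i : ℕ) = if (i : ℕ) = 0 then 0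
      else if (i : ℕ) ≤ 2 * a then (i : ℕ) + 1 else if (i : ℕ) = 2 * a + 1 then 1 else (i : ℕ))
    (he : ∀ i : Fin (2 * a + b + 2), (e i : ℕ) = if (i : ℕ) = 1 then 2 * a + 2
      else if (i : ℕ) = 2 * a + 2 then 1 else if (i : ℕ) = a + 1 then a + 2
      else if (i : ℕ) = a + 2 then a + 1 else (i : ℕ)) :
    ∃ g ∈ G, g.IsThreeCycle ∧
      ∀ i : Fin (2 * a + b + 2), (i : ℕ) = 2 * a + 2 → (g i : ℕ) = 1 := by
  have hlt : ∀ k ≤ 2 * a + 2, ∃ u : Fin (2 * a + b + 2), (u : ℕ) = k :=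
    fun k hk => ⟨⟨k, by omega⟩, rfl⟩
  obtain ⟨t, ht⟩ := hlt (2 * a + 2) le_rfl
  obtain ⟨u₁, h₁⟩ := hlt 1 (by omega)
  obtain ⟨u₃, h₃⟩ := hlt 3 (by omega)
  obtain ⟨v₁, k₁⟩ := hlt (a + 1) (by omega)
  obtain ⟨v₂, k₂⟩ := hlt (a + 2) (by omega)
  obtain ⟨v₃, k₃⟩ := hlt (a + 3) (by omega)
  obtain ⟨v₄, k₄⟩ := hlt (a + 4) (by omega)
  have dt : d t = t := by ext; rw [hd]; split_ifs <;> omega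
  have hdd : ∀ x y : Fin (2 * a + b + 2), (x : ℕ) ≠ 0 → (y : ℕ) = x + 2 →
      (x : ℕ) + 2 ≤ 2 * a + 1 → d (d x) = y := by
    intro x y hx hy hxy
    have h : (d x : ℕ) = x + 1 := by rw [hd]; split_ifs <;> omega
    ext
    rw [hd]
    split_ifs <;> omega
  have he' : e = swap t u₁ * swap v₁ v₂ := by
    ext i
    rw [he, Perm.mul_apply, swap_apply_def, swap_apply_def]
    simp only [Fin.ext_iff]
    split_ifs <;> grind
  have hconj : d * (d * e * d⁻¹) * d⁻¹ = swap t u₃ * swap v₃ v₄ := by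
    have h := swap_apply_apply (d * d) t u₁
    have h' := swap_apply_apply (d * d) v₁ v₂
    simp only [Perm.mul_apply, dt, hdd u₁ u₃ (by omega) (by omega) (by omega),
      hdd v₁ v₃ (by omega) (by omega) (by omega),
      hdd v₂ v₄ (by omega) (by omega) (by omega)] at h h'
    rw [h, h', he']
    group
  set f := d * (d * e * d⁻¹) * d⁻¹ with hf
  have hfG : f ∈ G := G.mul_mem (G.mul_mem hdG (G.mul_mem (G.mul_mem hdG heG) (G.inv_mem hdG)))
    (G.inv_mem hdG)
  have et : e t = u₁ := by ext; rw [he]; split_ifs <;> omega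
  have efix : ∀ x : Fin (2 * a + b + 2), (x : ℕ) ≠ 1 → (x : ℕ) ≠ 2 * a + 2 → (x : ℕ) ≠ a + 1 →
      (x : ℕ) ≠ a + 2 → e x = x := by
    intro x _ _ _ _
    ext
    rw [he]
    split_ifs <;> omega
  have key : e * f * e⁻¹ * f⁻¹ = swap u₃ u₁ * swap u₃ t := by
    have h := swap_apply_apply e t u₃
    have h' := swap_apply_apply e v₃ v₄
    rw [et, efix u₃ (by omega) (by omega) (by omega) (by omega)] at h
    rw [efix v₃ (by omega) (by omega) (by omega) (by omega),
      efix v₄ (by omega) (by omega) (by omega) (by omega)] at h'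
    calc e * f * e⁻¹ * f⁻¹
        = (e * swap t u₃ * e⁻¹) * (e * swap v₃ v₄ * e⁻¹) * (swap v₃ v₄)⁻¹ * (swap t u₃)⁻¹ := by
          rw [hconj]
          group
      _ = swap u₃ u₁ * swap u₃ t := by
          rw [← h, ← h', mul_inv_cancel_right, swap_inv, swap_comm u₁, swap_comm t]
  refine ⟨_, G.mul_mem (G.mul_mem (G.mul_mem heG hfG) (G.inv_mem heG)) (G.inv_mem hfG), ?_, ?_⟩
  · rw [key]
    apply isThreeCycle_swap_mul_swap_same <;> simp only [ne_eq, Fin.ext_iff] <;> omega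
  · intro i hi
    obtain rfl : i = t := Fin.ext (by omega)
    rw [key, Perm.mul_apply, swap_apply_right, swap_apply_left, h₁]

/-- A group that contains a cycle on `1, …, 2a+1`, a double transposition, and two elements
reversing the tail `2a+2, …, 2a+b+1` and its truncation contains all even permutations
fixing `0`. -/
theorem stabilizer_inf_alternatingGroup_le_of_tail (ha : a = 1 ∨ 3 ≤ a) (hb : 1 ≤ b)
    (hG : G ≤ MulAction.stabilizer (Perm (Fin (2 * a + b + 2))) (0 : Fin (2 * a + b + 2)))
    (hdG : d ∈ G) (heG : e ∈ G) (hrG : r ∈ G) (hsG : s ∈ G)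
    (hd : ∀ i : Fin (2 * a + b + 2), (d i : ℕ) = if (i : ℕ) = 0 then 0
      else if (i : ℕ) ≤ 2 * a then (i : ℕ) + 1 else if (i : ℕ) = 2 * a + 1 then 1 else (i : ℕ))
    (he : ∀ i : Fin (2 * a + b + 2), (e i : ℕ) = if (i : ℕ) = 1 then 2 * a + 2
      else if (i : ℕ) = 2 * a + 2 then 1 else if (i : ℕ) = a + 1 then a + 2
      else if (i : ℕ) = a + 2 then a + 1 else (i : ℕ))
    (hr₁ : ∀ i : Fin (2 * a + b + 2), (i : ℕ) = 1 → 1 ≤ (r i : ℕ) ∧ (r i : ℕ) ≤ 2 * a + 1)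
    (hr : ∀ i : Fin (2 * a + b + 2), 2 * a + 2 ≤ (i : ℕ) → (r i : ℕ) = 4 * a + b + 3 - i)
    (hs₁ : ∀ i : Fin (2 * a + b + 2), (i : ℕ) = 1 → 1 ≤ (s i : ℕ) ∧ (s i : ℕ) ≤ 2 * a + 1)
    (hs₂ : ∀ i : Fin (2 * a + b + 2), (i : ℕ) = a + 1 → (s i : ℕ) = 2 * a + 2)
    (hs : ∀ i : Fin (2 * a + b + 2), 2 * a + 3 ≤ (i : ℕ) → (s i : ℕ) = 4 * a + b + 4 - i) :
    MulAction.stabilizer (Perm (Fin (2 * a + b + 2))) (0 : Fin (2 * a + b + 2)) ⊓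
      alternatingGroup (Fin (2 * a + b + 2)) ≤ G := by
  obtain ⟨u, hu⟩ : ∃ u : Fin (2 * a + b + 2), (u : ℕ) = 1 := ⟨⟨1, by omega⟩, rfl⟩
  obtain ⟨v, hv⟩ : ∃ v : Fin (2 * a + b + 2), (v : ℕ) = a + 1 := ⟨⟨a + 1, by omega⟩, rfl⟩
  obtain ⟨t, ht⟩ : ∃ t : Fin (2 * a + b + 2), (t : ℕ) = 2 * a + 2 :=
    ⟨⟨2 * a + 2, by omega⟩, rfl⟩
  have hsv : s v = t := Fin.ext (by rw [hs₂ v hv, ht])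
  have hmain : (∃ g ∈ G, g.IsThreeCycle) ∧
      ∀ i : Fin (2 * a + b + 2), 1 ≤ (i : ℕ) → (i : ℕ) ≤ 2 * a + 1 →
        Relation.EqvGen (ThreeCycleStep G) u i ∧ Relation.EqvGen (ThreeCycleStep G) t i := by
    rcases ha with ha | ha
    · have h3 := isThreeCycle_of_eq_one ha hd
      have hstep : ∀ i : Fin (2 * a + b + 2), 1 ≤ (i : ℕ) → (i : ℕ) ≤ 2 * a + 1 →
          Relation.EqvGen (ThreeCycleStep G) u i := by
        have h0 : ∀ x, Relation.EqvGen (ThreeCycleStep G) x (d x) :=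
          fun x => .rel _ _ ⟨d, hdG, h3, rfl⟩
        intro i hi hi'
        obtain h | h | h : (i : ℕ) = 1 ∨ (i : ℕ) = 2 ∨ (i : ℕ) = 3 := by omega
        · obtain rfl : i = u := Fin.ext (by omega)
          exact .refl _
        · obtain rfl : i = d u := Fin.ext (by rw [hd]; split_ifs <;> omega)
          exact h0 u
        · have hdu : (d u : ℕ) = 2 := by rw [hd]; split_ifs <;> omega
          obtain rfl : i = d (d u) := Fin.ext (by rw [hd]; split_ifs <;> omega)
          exact (h0 u).trans _ _ _ (h0 _)
      refine ⟨⟨d, hdG, h3⟩, fun i hi hi' => ⟨hstep i hi hi', ?_⟩⟩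
      have h1 := eqvGen_threeCycleStep_apply hsG (hstep v (by omega) (by omega))
      rw [hsv] at h1
      have h2 := hstep (s u) (hs₁ u hu).1 (hs₁ u hu).2
      exact (h2.trans _ _ _ h1).symm.trans _ _ _ (hstep i hi hi')
    · obtain ⟨g, hgG, hg, hgt⟩ := exists_isThreeCycle_of_three_le ha hb hdG heG hd he
      have hdt : d t = t := by ext; rw [hd]; split_ifs <;> omega
      have hinv : ∀ k (x : Fin (2 * a + b + 2)), Relation.EqvGen (ThreeCycleStep G) t x →
          Relation.EqvGen (ThreeCycleStep G) t ((d ^ k) x) := by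
        intro k x hx
        have hk : (d ^ k) t = t := by
          induction k with
          | zero => rfl
          | succ k ih => rw [pow_succ, Perm.mul_apply, hdt, ih]
        have h := eqvGen_threeCycleStep_apply (G.pow_mem hdG k) hx
        rwa [hk] at h
      have hgt' : Relation.EqvGen (ThreeCycleStep G) t (g t) := .rel _ _ ⟨g, hgG, hg, rfl⟩
      have hpow : ∀ k (x : Fin (2 * a + b + 2)), 1 ≤ (x : ℕ) → (x : ℕ) + k ≤ 2 * a + 1 →
          ((d ^ k) x : ℕ) = x + k := by
        intro k
        induction k with
        | zero => intro x _ _; rfl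
        | succ k ih =>
          intro x hx hxk
          rw [pow_succ', Perm.mul_apply, hd, ih x hx (by omega)]
          split_ifs <;> omega
      have htu : Relation.EqvGen (ThreeCycleStep G) t u := by
        have : g t = u := Fin.ext (by rw [hgt t ht, hu])
        rwa [this] at hgt'
      have hstep : ∀ i : Fin (2 * a + b + 2), 1 ≤ (i : ℕ) → (i : ℕ) ≤ 2 * a + 1 →
          Relation.EqvGen (ThreeCycleStep G) t i := by
        intro i hi hi'
        have h := hinv ((i : ℕ) - 1) u htu
        have : (d ^ ((i : ℕ) - 1)) u = i := by
          ext
          rw [hpow _ _ (by omega) (by omega)]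
          omega
        rwa [this] at h
      exact ⟨⟨g, hgG, hg⟩, fun i hi hi' => ⟨htu.symm.trans _ _ _ (hstep i hi hi'), hstep i hi hi'⟩⟩
  obtain ⟨⟨g, hgG, hg⟩, hcycle⟩ := hmain
  have htu := (hcycle u (by omega) (by omega)).2.symm
  have hclosed : ∀ k ∈ G, (1 ≤ (k u : ℕ) ∧ (k u : ℕ) ≤ 2 * a + 1) → ∀ x,
      Relation.EqvGen (ThreeCycleStep G) u x → Relation.EqvGen (ThreeCycleStep G) u (k x) :=
    fun k hk hku x hx => (hcycle (k u) hku.1 hku.2).1.trans _ _ _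
      (eqvGen_threeCycleStep_apply hk hx)
  have htail : ∀ j (i : Fin (2 * a + b + 2)), (i : ℕ) = 2 * a + 2 + j →
      Relation.EqvGen (ThreeCycleStep G) u i := by
    intro j
    induction j with
    | zero =>
      intro i hi
      obtain rfl : i = t := Fin.ext (by omega)
      exact htu
    | succ j ih =>
      intro i hi
      have hib := i.isLt
      obtain ⟨x, hx⟩ : ∃ x : Fin (2 * a + b + 2), (x : ℕ) = 2 * a + 2 + j :=
        ⟨⟨2 * a + 2 + j, by omega⟩, rfl⟩
      have h := hclosed s hsG (hs₁ u hu) _ (hclosed r hrG (hr₁ u hu) x (ih x hx))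
      have hrx := hr x (by omega)
      have : s (r x) = i := Fin.ext (by rw [hs _ (by omega)]; omega)
      rwa [this] at h
  have hall : ∀ x : Fin (2 * a + b + 2), x ≠ 0 → Relation.EqvGen (ThreeCycleStep G) u x := by
    intro x hx
    have hx' : (x : ℕ) ≠ 0 := fun h => hx (Fin.ext h)
    by_cases h : (x : ℕ) ≤ 2 * a + 1
    · exact (hcycle x (by omega) h).1
    · exact htail ((x : ℕ) - (2 * a + 2)) x (by omega)
  exact stabilizer_inf_alternatingGroup_le_of_eqvGen hG hgG hg fun x y hx hy =>
    (hall x hx).symm.trans _ _ _ (hall y hy)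

end Core

theorem sign_of_involutive {α : Type*} [Fintype α] [DecidableEq α] {g : Perm α}
    (hg : ∀ x, g (g x) = x) (S : Finset α) (hS : ∀ x, g x = x ↔ x ∈ S) :
    sign g = (-1) ^ ((Fintype.card α - S.card) / 2) := by
  have hcard : Fintype.card (Function.fixedPoints g) = S.card :=
    Fintype.card_of_finset' (p := Function.fixedPoints g) S fun x => (hS x).symm
  rw [sign_of_pow_two_eq_one (by ext x; simp [pow_two, hg]), hcard]

theorem closure_eq_stabilizer_inf_alternatingGroup {α : Type*} [Fintype α] [DecidableEq α] {o : α}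
    {X : Set (Perm α)} (hX : ∀ g ∈ X, g o = o) (hsign : ∀ g ∈ X, sign g = 1)
    (h : MulAction.stabilizer (Perm α) o ⊓ alternatingGroup α ≤ Subgroup.closure X) :
    Subgroup.closure X = MulAction.stabilizer (Perm α) o ⊓ alternatingGroup α :=
  le_antisymm ((Subgroup.closure_le _).mpr fun g hg =>
    ⟨hX g hg, mem_alternatingGroup.mpr (hsign g hg)⟩) h

theorem closure_eq_stabilizer {α : Type*} [Fintype α] [DecidableEq α] {o : α}
    {X : Set (Perm α)} (hX : ∀ g ∈ X, g o = o) {g : Perm α} (hg : g ∈ X) (hsign : sign g = -1)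
    (h : MulAction.stabilizer (Perm α) o ⊓ alternatingGroup α ≤ Subgroup.closure X) :
    Subgroup.closure X = MulAction.stabilizer (Perm α) o := by
  refine le_antisymm ((Subgroup.closure_le _).mpr fun g hg => hX g hg) fun k hk => ?_
  have hgX := Subgroup.subset_closure (k := X) hg
  rcases Int.units_eq_one_or (sign k) with hk' | hk'
  · exact h ⟨hk, mem_alternatingGroup.mpr hk'⟩
  · have : g * k ∈ Subgroup.closure X := by
      refine h ⟨mul_mem (show g ∈ MulAction.stabilizer (Perm α) o from hX g hg) hk, ?_⟩
      exact mem_alternatingGroup.mpr (by rw [Perm.sign_mul, hsign, hk']; rfl)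
    exact ((Subgroup.closure X).mul_mem_cancel_left hgX).mp this

section Rotation

variable {a b : ℕ} {G : Subgroup (Perm (Fin (2 * a + b + 2)))}
  {g₁ g₂ : Perm (Fin (2 * a + b + 2))}

theorem stabilizer_inf_alternatingGroup_le_of_rotation (ha : a = 1 ∨ 3 ≤ a) (hb : 1 ≤ b)
    (hG : G ≤ MulAction.stabilizer (Perm (Fin (2 * a + b + 2))) (0 : Fin (2 * a + b + 2)))
    (h₁G : g₁ ∈ G) (h₂G : g₂ ∈ G)
    (h₁ : ∀ i : Fin (2 * a + b + 2), (g₁ i : ℕ) = if (i : ℕ) = 0 then 0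
      else if (i : ℕ) ≤ a then (i : ℕ) + a + 1 else if (i : ℕ) ≤ 2 * a + 1 then (i : ℕ) - a
      else 4 * a + b + 3 - i)
    (h₂ : ∀ i : Fin (2 * a + b + 2), (g₂ i : ℕ) = if (i : ℕ) = 0 then 0
      else if (i : ℕ) ≤ a then (i : ℕ) + a + 1 else if (i : ℕ) = a + 1 then 2 * a + 2
      else if (i : ℕ) ≤ 2 * a + 1 then (i : ℕ) - (a + 1) else if (i : ℕ) = 2 * a + 2 then a + 1
      else 4 * a + b + 4 - i) :
    MulAction.stabilizer (Perm (Fin (2 * a + b + 2))) (0 : Fin (2 * a + b + 2)) ⊓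
      alternatingGroup (Fin (2 * a + b + 2)) ≤ G := by
  have hd : ∀ i : Fin (2 * a + b + 2), ((g₁ * g₁) i : ℕ) = if (i : ℕ) = 0 then 0
      else if (i : ℕ) ≤ 2 * a then (i : ℕ) + 1 else if (i : ℕ) = 2 * a + 1 then 1
      else (i : ℕ) := by
    intro i
    have hi := i.isLt
    have k := h₁ i
    have k' := h₁ (g₁ i)
    rw [Perm.mul_apply]
    split_ifs at k k' ⊢ <;> omega
  have hdG : g₁ * g₁ ∈ G := G.mul_mem h₁G h₁G
  generalize g₁ * g₁ = d at hd hdG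
  refine stabilizer_inf_alternatingGroup_le_of_tail (d := d) (r := g₁) (s := g₂)
    (e := g₂ * d * g₂ * d⁻¹) ha hb hG hdG
    (G.mul_mem (G.mul_mem (G.mul_mem h₂G hdG) h₂G) (G.inv_mem hdG)) h₁G h₂G hd ?_ ?_ ?_ ?_ ?_ ?_
  · intro i
    obtain ⟨j, rfl⟩ := d.surjective i
    have hj := j.isLt
    have k₁ := hd j
    have k₂ := h₂ j
    have k₃ := hd (g₂ j)
    have k₄ := h₂ (d (g₂ j))
    simp only [Perm.mul_apply, Perm.inv_def, symm_apply_apply]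
    generalize (d j : ℕ) = x₁ at *
    generalize (g₂ (d (g₂ j)) : ℕ) = x₄ at *
    generalize (d (g₂ j) : ℕ) = x₃ at *
    generalize (g₂ j : ℕ) = x₂ at *
    generalize (j : ℕ) = x at *
    clear h₁ h₂ hd
    grind (splits := 30)
  all_goals
    intro i hi
    have k₁ := h₁ i
    have k₂ := h₂ i
    split_ifs at k₁ k₂ <;> omega

theorem sign_of_rotation (hb : b % 2 = 1)
    (h₂ : ∀ i : Fin (2 * a + b + 2), (g₂ i : ℕ) = if (i : ℕ) = 0 then 0
      else if (i : ℕ) ≤ a then (i : ℕ) + a + 1 else if (i : ℕ) = a + 1 then 2 * a + 2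
      else if (i : ℕ) ≤ 2 * a + 1 then (i : ℕ) - (a + 1) else if (i : ℕ) = 2 * a + 2 then a + 1
      else 4 * a + b + 4 - i) :
    sign g₂ = (-1) ^ ((2 * a + b + 1) / 2) := by
  rw [sign_of_involutive (S := {0})]
  · simp
  · intro i
    have hi := i.isLt
    have k := h₂ i
    have k' := h₂ (g₂ i)
    ext
    split_ifs at k k' <;> omega
  · intro i
    have hi := i.isLt
    have k := h₂ i
    rw [Finset.mem_singleton, Fin.ext_iff, Fin.ext_iff, Fin.val_zero]
    split_ifs at k <;> omega

end Rotation

section Reflection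

variable {a b : ℕ} {G : Subgroup (Perm (Fin (2 * a + b + 2)))}
  {g₁ g₂ g₃ : Perm (Fin (2 * a + b + 2))}

theorem stabilizer_inf_alternatingGroup_le_of_reflection (ha : a = 1 ∨ 3 ≤ a) (hb : 1 ≤ b)
    (hG : G ≤ MulAction.stabilizer (Perm (Fin (2 * a + b + 2))) (0 : Fin (2 * a + b + 2)))
    (h₁G : g₁ ∈ G) (h₂G : g₂ ∈ G) (h₃G : g₃ ∈ G)
    (h₁ : ∀ i : Fin (2 * a + b + 2), (g₁ i : ℕ) = if (i : ℕ) = 0 then 0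
      else if (i : ℕ) ≤ a + 1 then a + 2 - i else if (i : ℕ) ≤ 2 * a + 1 then 3 * a + 3 - i
      else 4 * a + b + 3 - i)
    (h₂ : ∀ i : Fin (2 * a + b + 2), (g₂ i : ℕ) = if (i : ℕ) = 0 then 0
      else if (i : ℕ) ≤ a then a + 1 - i else if (i : ℕ) = a + 1 then 2 * a + 2
      else if (i : ℕ) ≤ 2 * a + 1 then 3 * a + 3 - i else if (i : ℕ) = 2 * a + 2 then a + 1
      else 4 * a + b + 4 - i)
    (h₃ : ∀ i : Fin (2 * a + b + 2), (g₃ i : ℕ) = if (i : ℕ) = 0 then 0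
      else if (i : ℕ) ≤ a then a + 1 - i else if (i : ℕ) ≤ 2 * a + 1 then 3 * a + 2 - i
      else 4 * a + b + 3 - i) :
    MulAction.stabilizer (Perm (Fin (2 * a + b + 2))) (0 : Fin (2 * a + b + 2)) ⊓
      alternatingGroup (Fin (2 * a + b + 2)) ≤ G := by
  have hd : ∀ i : Fin (2 * a + b + 2), ((g₁ * g₃) i : ℕ) = if (i : ℕ) = 0 then 0
      else if (i : ℕ) ≤ 2 * a then (i : ℕ) + 1 else if (i : ℕ) = 2 * a + 1 then 1
      else (i : ℕ) := by
    intro i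
    have hi := i.isLt
    have k := h₃ i
    have k' := h₁ (g₃ i)
    rw [Perm.mul_apply]
    split_ifs at k k' ⊢ <;> omega
  have hdG : g₁ * g₃ ∈ G := G.mul_mem h₁G h₃G
  generalize g₁ * g₃ = d at hd hdG
  refine stabilizer_inf_alternatingGroup_le_of_tail (d := d) (r := g₁) (s := g₂)
    (e := d * g₂ * d * g₂) ha hb hG hdG
    (G.mul_mem (G.mul_mem (G.mul_mem hdG h₂G) hdG) h₂G) h₁G h₂G hd ?_ ?_ ?_ ?_ ?_ ?_
  · intro j
    have hj := j.isLt
    have k₁ := h₂ j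
    have k₂ := hd (g₂ j)
    have k₃ := h₂ (d (g₂ j))
    have k₄ := hd (g₂ (d (g₂ j)))
    simp only [Perm.mul_apply]
    generalize (d (g₂ (d (g₂ j))) : ℕ) = x₄ at *
    generalize (g₂ (d (g₂ j)) : ℕ) = x₃ at *
    generalize (d (g₂ j) : ℕ) = x₂ at *
    generalize (g₂ j : ℕ) = x₁ at *
    generalize (j : ℕ) = x at *
    clear h₁ h₂ h₃ hd
    grind (splits := 30)
  all_goals
    intro i hi
    have k₁ := h₁ i
    have k₂ := h₂ i
    split_ifs at k₁ k₂ <;> omega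

theorem sign_of_involutive_of_fixed_three {n : ℕ} {g : Perm (Fin n)} (hg : ∀ x, g (g x) = x)
    (x y z : ℕ) (hxy : x < y) (hyz : y < z) (hz : z < n)
    (h : ∀ i, (g i : ℕ) = i ↔ (i : ℕ) = x ∨ (i : ℕ) = y ∨ (i : ℕ) = z) :
    sign g = (-1) ^ ((n - 3) / 2) := by
  rw [sign_of_involutive hg {⟨x, by omega⟩, ⟨y, by omega⟩, ⟨z, hz⟩}]
  · rw [Finset.card_eq_three.mpr ⟨_, _, _, ?_, ?_, ?_, rfl⟩, Fintype.card_fin] <;>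
    · simp only [ne_eq, Fin.ext_iff]
      omega
  · intro i
    simp only [Finset.mem_insert, Finset.mem_singleton, Fin.ext_iff]
    exact h i

end Reflection

section Composition

variable {a b : ℕ} {ρ ψ p1 p2 p3 : Perm (Fin (2*a+b+2))}

theorem p1_mul_rho_apply (ha : 1 ≤ a)
    (hρ : ∀ i : Fin (2*a+b+2), (ρ i : ℕ) = if (i : ℕ) ≤ a then (i : ℕ) + a + 1
      else if (i : ℕ) ≤ 2*a+1 then (i : ℕ) - (a + 1) else 4*a+b+3 - (i : ℕ))
    (hp1 : ∀ i : Fin (2*a+b+2), (p1 i : ℕ) =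
      if (i : ℕ) ≤ a then (i : ℕ) + 1
      else if (i : ℕ) = a+1 then 0
      else (i : ℕ)) :
    ∀ i : Fin (2*a+b+2), ((p1 * ρ) i : ℕ) = if (i : ℕ) = 0 then 0
      else if (i : ℕ) ≤ a then (i : ℕ) + a + 1 else if (i : ℕ) ≤ 2 * a + 1 then (i : ℕ) - a
      else 4 * a + b + 3 - i := by
  intro i
  have hi := i.isLt
  have k := hρ i
  have k' := hp1 (ρ i)
  rw [Perm.mul_apply]
  split_ifs at k k' ⊢ <;> omega

theorem p2_mul_rho_apply (ha : 1 ≤ a) (hb : 1 ≤ b)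
    (hρ : ∀ i : Fin (2*a+b+2), (ρ i : ℕ) = if (i : ℕ) ≤ a then (i : ℕ) + a + 1
      else if (i : ℕ) ≤ 2*a+1 then (i : ℕ) - (a + 1) else 4*a+b+3 - (i : ℕ))
    (hp2 : ∀ i : Fin (2*a+b+2), (p2 i : ℕ) =
      if (i : ℕ) = 0 then (if b = 0 then a+1 else 2*a+2)
      else if (i : ℕ) = a+1 then 0
      else if 2*a+2 ≤ (i : ℕ) ∧ (i : ℕ) ≤ 2*a+b then (i : ℕ) + 1
      else if (i : ℕ) = 2*a+b+1 ∧ b ≠ 0 then a+1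
      else (i : ℕ)) :
    ∀ i : Fin (2*a+b+2), ((p2 * ρ) i : ℕ) = if (i : ℕ) = 0 then 0
      else if (i : ℕ) ≤ a then (i : ℕ) + a + 1 else if (i : ℕ) = a + 1 then 2 * a + 2
      else if (i : ℕ) ≤ 2 * a + 1 then (i : ℕ) - (a + 1) else if (i : ℕ) = 2 * a + 2 then a + 1
      else 4 * a + b + 4 - i := by
  intro i
  have hi := i.isLt
  have k := hρ i
  have k' := hp2 (ρ i)
  rw [Perm.mul_apply]
  split_ifs at k k' ⊢ <;> omega

theorem p1_mul_psi_apply (ha : 1 ≤ a)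
    (hψ : ∀ i : Fin (2*a+b+2), (ψ i : ℕ) =
      if (i : ℕ) ≤ a+1 then a+1 - (i : ℕ)
      else if (i : ℕ) ≤ 2*a+1 then 3*a+3 - (i : ℕ)
      else 4*a+b+3 - (i : ℕ))
    (hp1 : ∀ i : Fin (2*a+b+2), (p1 i : ℕ) =
      if (i : ℕ) ≤ a then (i : ℕ) + 1
      else if (i : ℕ) = a+1 then 0
      else (i : ℕ)) :
    ∀ i : Fin (2*a+b+2), ((p1 * ψ) i : ℕ) = if (i : ℕ) = 0 then 0
      else if (i : ℕ) ≤ a + 1 then a + 2 - i else if (i : ℕ) ≤ 2 * a + 1 then 3 * a + 3 - i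
      else 4 * a + b + 3 - i := by
  intro i
  have hi := i.isLt
  have k := hψ i
  have k' := hp1 (ψ i)
  rw [Perm.mul_apply]
  split_ifs at k k' ⊢ <;> omega

theorem p2_mul_psi_apply (ha : 1 ≤ a) (hb : 1 ≤ b)
    (hψ : ∀ i : Fin (2*a+b+2), (ψ i : ℕ) =
      if (i : ℕ) ≤ a+1 then a+1 - (i : ℕ)
      else if (i : ℕ) ≤ 2*a+1 then 3*a+3 - (i : ℕ)
      else 4*a+b+3 - (i : ℕ))
    (hp2 : ∀ i : Fin (2*a+b+2), (p2 i : ℕ) =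
      if (i : ℕ) = 0 then (if b = 0 then a+1 else 2*a+2)
      else if (i : ℕ) = a+1 then 0
      else if 2*a+2 ≤ (i : ℕ) ∧ (i : ℕ) ≤ 2*a+b then (i : ℕ) + 1
      else if (i : ℕ) = 2*a+b+1 ∧ b ≠ 0 then a+1
      else (i : ℕ)) :
    ∀ i : Fin (2*a+b+2), ((p2 * ψ) i : ℕ) = if (i : ℕ) = 0 then 0
      else if (i : ℕ) ≤ a then a + 1 - i else if (i : ℕ) = a + 1 then 2 * a + 2
      else if (i : ℕ) ≤ 2 * a + 1 then 3 * a + 3 - i else if (i : ℕ) = 2 * a + 2 then a + 1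
      else 4 * a + b + 4 - i := by
  intro i
  have hi := i.isLt
  have k := hψ i
  have k' := hp2 (ψ i)
  rw [Perm.mul_apply]
  split_ifs at k k' ⊢ <;> omega

theorem p3_mul_psi_apply (ha : 1 ≤ a)
    (hψ : ∀ i : Fin (2*a+b+2), (ψ i : ℕ) =
      if (i : ℕ) ≤ a+1 then a+1 - (i : ℕ)
      else if (i : ℕ) ≤ 2*a+1 then 3*a+3 - (i : ℕ)
      else 4*a+b+3 - (i : ℕ))
    (hp3 : ∀ i : Fin (2*a+b+2), (p3 i : ℕ) =
      if (i : ℕ) = 0 then 2*a+1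
      else if a+2 ≤ (i : ℕ) ∧ (i : ℕ) ≤ 2*a+1 then (i : ℕ) - 1
      else if (i : ℕ) = a+1 then 0
      else (i : ℕ)) :
    ∀ i : Fin (2*a+b+2), ((p3 * ψ) i : ℕ) = if (i : ℕ) = 0 then 0
      else if (i : ℕ) ≤ a then a + 1 - i else if (i : ℕ) ≤ 2 * a + 1 then 3 * a + 2 - i
      else 4 * a + b + 3 - i := by
  intro i
  have hi := i.isLt
  have k := hψ i
  have k' := hp3 (ψ i)
  rw [Perm.mul_apply]
  split_ifs at k k' ⊢ <;> omega

theorem sign_psi (ha : a % 2 = 1) (hb : b % 2 = 1)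
    (hψ : ∀ i : Fin (2*a+b+2), (ψ i : ℕ) =
      if (i : ℕ) ≤ a+1 then a+1 - (i : ℕ)
      else if (i : ℕ) ≤ 2*a+1 then 3*a+3 - (i : ℕ)
      else 4*a+b+3 - (i : ℕ)) :
    sign ψ = (-1) ^ ((2*a+b+2 - 3) / 2) := by
  refine sign_of_involutive_of_fixed_three (fun i => ?_) ((a+1)/2) (3*(a+1)/2) ((4*a+b+3)/2)
    (by omega) (by omega) (by omega) fun i => ?_
  · have hi := i.isLt
    have k := hψ i
    have k' := hψ (ψ i)
    ext
    split_ifs at k k' <;> omega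
  · have hi := i.isLt
    have k := hψ i
    split_ifs at k <;> omega

theorem sign_p1_mul_psi {g : Perm (Fin (2*a+b+2))} (ha : a % 2 = 1) (hb : b % 2 = 1)
    (h : ∀ i : Fin (2*a+b+2), (g i : ℕ) = if (i : ℕ) = 0 then 0
      else if (i : ℕ) ≤ a + 1 then a + 2 - i else if (i : ℕ) ≤ 2 * a + 1 then 3 * a + 3 - i
      else 4 * a + b + 3 - i) :
    sign g = (-1) ^ ((2*a+b+2 - 3) / 2) := by
  refine sign_of_involutive_of_fixed_three (fun i => ?_) 0 (3*(a+1)/2) ((4*a+b+3)/2)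
    (by omega) (by omega) (by omega) fun i => ?_
  · have hi := i.isLt
    have k := h i
    have k' := h (g i)
    ext
    split_ifs at k k' <;> omega
  · have hi := i.isLt
    have k := h i
    split_ifs at k <;> omega

theorem sign_p2_mul_psi {g : Perm (Fin (2*a+b+2))} (ha : a % 2 = 1) (hb : b % 2 = 1)
    (h : ∀ i : Fin (2*a+b+2), (g i : ℕ) = if (i : ℕ) = 0 then 0
      else if (i : ℕ) ≤ a then a + 1 - i else if (i : ℕ) = a + 1 then 2 * a + 2
      else if (i : ℕ) ≤ 2 * a + 1 then 3 * a + 3 - i else if (i : ℕ) = 2 * a + 2 then a + 1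
      else 4 * a + b + 4 - i) :
    sign g = (-1) ^ ((2*a+b+2 - 3) / 2) := by
  refine sign_of_involutive_of_fixed_three (fun i => ?_) 0 ((a+1)/2) (3*(a+1)/2)
    (by omega) (by omega) (by omega) fun i => ?_
  · have hi := i.isLt
    have k := h i
    have k' := h (g i)
    ext
    split_ifs at k k' <;> omega
  · have hi := i.isLt
    have k := h i
    split_ifs at k <;> omega

theorem sign_p3_mul_psi {g : Perm (Fin (2*a+b+2))} (ha : a % 2 = 1) (hb : b % 2 = 1)
    (h : ∀ i : Fin (2*a+b+2), (g i : ℕ) = if (i : ℕ) = 0 then 0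
      else if (i : ℕ) ≤ a then a + 1 - i else if (i : ℕ) ≤ 2 * a + 1 then 3 * a + 2 - i
      else 4 * a + b + 3 - i) :
    sign g = (-1) ^ ((2*a+b+2 - 3) / 2) := by
  refine sign_of_involutive_of_fixed_three (fun i => ?_) 0 ((a+1)/2) ((4*a+b+3)/2)
    (by omega) (by omega) (by omega) fun i => ?_
  · have hi := i.isLt
    have k := h i
    have k' := h (g i)
    ext
    split_ifs at k k' <;> omega
  · have hi := i.isLt
    have k := h i
    split_ifs at k <;> omega

theorem rho_apply
    (hρ : ∀ i : Fin (2*a+b+2), (ρ i : ℕ) =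
      if (i : ℕ) ≤ 2*a+1 then ((i : ℕ) + a + 1) % (2*a+2) else 4*a+b+3 - (i : ℕ)) :
    ∀ i : Fin (2*a+b+2), (ρ i : ℕ) = if (i : ℕ) ≤ a then (i : ℕ) + a + 1
      else if (i : ℕ) ≤ 2*a+1 then (i : ℕ) - (a + 1) else 4*a+b+3 - (i : ℕ) := by
  intro i
  rw [hρ]
  split_ifs with h1 h2 h2
  · exact Nat.mod_eq_of_lt (by omega)
  · rw [show (i : ℕ) + a + 1 = (i - (a + 1)) + (2*a+2) by omega, Nat.add_mod_right]
    exact Nat.mod_eq_of_lt (by omega)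
  · omega
  · rfl

end Composition

theorem closure_a_odd (a b : ℕ) (ha : 1 ≤ a) (haodd : a % 2 = 1)
    (ρ ψ p1 p2 p3 : Equiv.Perm (Fin (2*a+b+2)))
    (hρ : ∀ i : Fin (2*a+b+2), (ρ i : ℕ) =
      if (i : ℕ) ≤ 2*a+1 then ((i : ℕ) + a + 1) % (2*a+2) else 4*a+b+3 - (i : ℕ))
    (hψ : ∀ i : Fin (2*a+b+2), (ψ i : ℕ) =
      if (i : ℕ) ≤ a+1 then a+1 - (i : ℕ)
      else if (i : ℕ) ≤ 2*a+1 then 3*a+3 - (i : ℕ)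
      else 4*a+b+3 - (i : ℕ))
    (hp1 : ∀ i : Fin (2*a+b+2), (p1 i : ℕ) =
      if (i : ℕ) ≤ a then (i : ℕ) + 1
      else if (i : ℕ) = a+1 then 0
      else (i : ℕ))
    (hp2 : ∀ i : Fin (2*a+b+2), (p2 i : ℕ) =
      if (i : ℕ) = 0 then (if b = 0 then a+1 else 2*a+2)
      else if (i : ℕ) = a+1 then 0
      else if 2*a+2 ≤ (i : ℕ) ∧ (i : ℕ) ≤ 2*a+b then (i : ℕ) + 1
      else if (i : ℕ) = 2*a+b+1 ∧ b ≠ 0 then a+1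
      else (i : ℕ))
    (hp3 : ∀ i : Fin (2*a+b+2), (p3 i : ℕ) =
      if (i : ℕ) = 0 then 2*a+1
      else if a+2 ≤ (i : ℕ) ∧ (i : ℕ) ≤ 2*a+1 then (i : ℕ) - 1
      else if (i : ℕ) = a+1 then 0
      else (i : ℕ))
    :
    (b % 4 = 1 →
      Subgroup.closure ({p1 * ρ, p2 * ρ, p3 * ρ} : Set (Equiv.Perm (Fin (2*a+b+2))))
        = MulAction.stabilizer (Equiv.Perm (Fin (2*a+b+2))) (0 : Fin (2*a+b+2))
          ⊓ alternatingGroup (Fin (2*a+b+2)) ∧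
      Subgroup.closure ({p1 * ψ, p2 * ψ, p3 * ψ} : Set (Equiv.Perm (Fin (2*a+b+2))))
        = MulAction.stabilizer (Equiv.Perm (Fin (2*a+b+2))) (0 : Fin (2*a+b+2))) ∧
    (b % 4 = 3 →
      Subgroup.closure ({p1 * ρ, p2 * ρ, p3 * ρ} : Set (Equiv.Perm (Fin (2*a+b+2))))
        = MulAction.stabilizer (Equiv.Perm (Fin (2*a+b+2))) (0 : Fin (2*a+b+2)) ∧
      Subgroup.closure ({p1 * ψ, p2 * ψ, p3 * ψ} : Set (Equiv.Perm (Fin (2*a+b+2))))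
        = MulAction.stabilizer (Equiv.Perm (Fin (2*a+b+2))) (0 : Fin (2*a+b+2))
          ⊓ alternatingGroup (Fin (2*a+b+2))) := by
  have hρ' := rho_apply hρ
  by_cases hb : b % 2 = 1
  swap
  · exact ⟨fun h => by omega, fun h => by omega⟩
  have ha' : a = 1 ∨ 3 ≤ a := by omega
  have s₁ := p1_mul_rho_apply ha hρ' hp1
  have s₂ := p2_mul_rho_apply ha (by omega) hρ' hp2
  have t₁ := p1_mul_psi_apply ha hψ hp1
  have t₂ := p2_mul_psi_apply ha (by omega) hψ hp2
  have t₃ := p3_mul_psi_apply ha hψ hp3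
  have sρ : sign (p2 * ρ) = (-1) ^ ((2*a+b+1) / 2) := sign_of_rotation hb s₂
  have sψ := sign_psi haodd hb hψ
  have st₁ := sign_p1_mul_psi haodd hb t₁
  have st₂ := sign_p2_mul_psi haodd hb t₂
  have st₃ := sign_p3_mul_psi haodd hb t₃
  have even_of_mul : ∀ p : Perm (Fin (2*a+b+2)), sign (p * ψ) = sign ψ → sign p = 1 := by
    intro p hp
    rwa [Perm.sign_mul, mul_eq_right] at hp
  have sp1 := even_of_mul p1 (st₁.trans sψ.symm)
  have sp2 := even_of_mul p2 (st₂.trans sψ.symm)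
  have sp3 := even_of_mul p3 (st₃.trans sψ.symm)
  rw [Perm.sign_mul, sp2, one_mul] at sρ
  have fix : ∀ g ∈ ({p1 * ρ, p2 * ρ, p3 * ρ} : Set (Perm (Fin (2*a+b+2)))), g 0 = 0 := by
    have h0 : (ρ 0 : ℕ) = a + 1 := by rw [hρ']; simp
    rintro g (rfl | rfl | rfl) <;> ext <;> rw [Perm.mul_apply, Fin.val_zero]
    · rw [hp1]; split_ifs <;> omega
    · rw [hp2]; split_ifs <;> omega
    · rw [hp3]; split_ifs <;> omega
  have fix' : ∀ g ∈ ({p1 * ψ, p2 * ψ, p3 * ψ} : Set (Perm (Fin (2*a+b+2)))), g 0 = 0 := by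
    rintro g (rfl | rfl | rfl) <;> ext
    · rw [t₁]; rfl
    · rw [t₂]; rfl
    · rw [t₃]; rfl
  have sign_rot : ∀ g ∈ ({p1 * ρ, p2 * ρ, p3 * ρ} : Set (Perm (Fin (2*a+b+2)))),
      sign g = (-1) ^ ((2*a+b+1) / 2) := by
    rintro g (rfl | rfl | rfl) <;> simp only [Perm.sign_mul, sp1, sp2, sp3, sρ, one_mul]
  have sign_refl : ∀ g ∈ ({p1 * ψ, p2 * ψ, p3 * ψ} : Set (Perm (Fin (2*a+b+2)))),
      sign g = (-1) ^ ((2*a+b+2 - 3) / 2) := by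
    rintro g (rfl | rfl | rfl) <;> assumption
  have hrot := stabilizer_inf_alternatingGroup_le_of_rotation ha' (by omega)
    ((Subgroup.closure_le _).mpr fix)
    (Subgroup.subset_closure (Set.mem_insert (p1 * ρ) _))
    (Subgroup.subset_closure (Set.mem_insert_of_mem _ (Set.mem_insert (p2 * ρ) _))) s₁ s₂
  have hrefl := stabilizer_inf_alternatingGroup_le_of_reflection ha' (by omega)
    ((Subgroup.closure_le _).mpr fix')
    (Subgroup.subset_closure (Set.mem_insert (p1 * ψ) _))
    (Subgroup.subset_closure (Set.mem_insert_of_mem _ (Set.mem_insert (p2 * ψ) _)))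
    (Subgroup.subset_closure (Set.mem_insert_of_mem _ (Set.mem_insert_of_mem _
      (Set.mem_singleton (p3 * ψ))))) t₁ t₂ t₃
  refine ⟨fun h => ⟨?_, ?_⟩, fun h => ⟨?_, ?_⟩⟩
  · refine closure_eq_stabilizer_inf_alternatingGroup fix (fun g hg => ?_) hrot
    rw [sign_rot g hg, Even.neg_one_pow (Nat.even_iff.mpr (by omega))]
  · refine closure_eq_stabilizer fix' (Set.mem_insert (p1 * ψ) _) ?_ hrefl
    rw [st₁, Odd.neg_one_pow (Nat.odd_iff.mpr (by omega))]
  · refine closure_eq_stabilizer fix (Set.mem_insert (p1 * ρ) _) ?_ hrot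
    rw [sign_rot _ (Set.mem_insert _ _), Odd.neg_one_pow (Nat.odd_iff.mpr (by omega))]
  · refine closure_eq_stabilizer_inf_alternatingGroup fix' (fun g hg => ?_) hrefl
    rw [sign_refl g hg, Even.neg_one_pow (Nat.even_iff.mpr (by omega))]
end

section
/- Suppose (a,b) ≠ (2,1), and let H denote the stabilizer subgroup {π ∈ Perm(Fin (n+1)) | π(0) = 0}, which contains all σ_k and τ_k. Then there exists a bijection Φ : H × (ZMod 2) ≃ H × (ZMod 2) such that for all x, y ∈ H × (ZMod 2): (there exists k ∈ {1,2,3} with y.1 = x.1·σ_k and y.2 = x.2 + 1) if and only if (there exists k ∈ {1,2,3} with (Φ y).1 = (Φ x).1·τ_k and (Φ y).2 = (Φ x).2 + 1). That is, the Cayley graphs Cay(H × C₂, S1 × {1}) and Cay(H × C₂, S2 × {1}) are isomorphic directed graphs. -/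
/-- If a self-inverse `c ∈ H` satisfies `r * c = s` and left multiplication by `c` maps `S * s` to
`S * r`, then twisting one colour class by `c` is an isomorphism between the bipartite double
covers of the Cayley graphs of `H` on `S * r` and `S * s`. -/
theorem exists_doubleCover_equiv {G : Type*} [Group G] (H : Subgroup G) (S : List G) (r s c : G)
    (hc : c ∈ H) (hcc : c * c = 1) (hrc : r * c = s)
    (hS : ∀ p ∈ S, ∃ q ∈ S, c * (p * s) = q * r) :
    ∃ Φ : (H × ZMod 2) ≃ (H × ZMod 2), ∀ x y,
      ((∃ p ∈ S, (y.1 : G) = (x.1 : G) * (p * r)) ∧ y.2 = x.2 + 1) ↔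
      ((∃ p ∈ S, ((Φ y).1 : G) = ((Φ x).1 : G) * (p * s)) ∧ (Φ y).2 = (Φ x).2 + 1) := by
  have hcr : s * c = r := by rw [← hrc, mul_assoc, hcc, mul_one]
  have hS' : ∀ p ∈ S, ∃ q ∈ S, p * r = c * (q * s) := by
    intro p hp
    obtain ⟨q, hq, h⟩ := hS p hp
    refine ⟨q, hq, ?_⟩
    calc p * r = c * (c * (p * s)) * c := by
          rw [← mul_assoc c c, hcc, one_mul, mul_assoc, hcr]
      _ = c * (q * s) := by rw [h, mul_assoc, mul_assoc, hrc]
  have hinv : Function.Involutive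
      (fun x : H × ZMod 2 => (if x.2 = 0 then x.1 else x.1 * ⟨c, hc⟩, x.2)) := by
    rintro ⟨x, e⟩
    by_cases he : e = 0
    · simp [he]
    · simp [he, mul_assoc, hcc]
  refine ⟨hinv.toPerm, ?_⟩
  rintro ⟨x, e⟩ ⟨y, f⟩
  simp only [Function.Involutive.coe_toPerm]
  refine and_congr_left ?_
  rintro rfl
  obtain rfl | rfl : e = 0 ∨ e = 1 := by revert e; decide
  · have h1 : (0 + 1 : ZMod 2) ≠ 0 := by decide
    simp only [h1, if_true, if_false, Subgroup.coe_mul, ← hrc, ← mul_assoc, mul_left_inj]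
  · have h0 : (1 + 1 : ZMod 2) = 0 := by decide
    have h1 : (1 : ZMod 2) ≠ 0 := by decide
    simp only [h0, h1, if_true, if_false, Subgroup.coe_mul]
    constructor
    · rintro ⟨p, hp, h⟩
      obtain ⟨q, hq, hpq⟩ := hS' p hp
      exact ⟨q, hq, by rw [h, hpq, mul_assoc]⟩
    · rintro ⟨p, hp, h⟩
      obtain ⟨q, hq, hpq⟩ := hS p hp
      exact ⟨q, hq, by rw [h, mul_assoc, hpq]⟩


theorem bipartite_double_covers_isomorphic (a b : ℕ) (ha : 1 ≤ a) (hab : ¬(a = 2 ∧ b = 1))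
    (ρ ψ p1 p2 p3 : Equiv.Perm (Fin (2*a+b+2)))
    (hρ : ∀ i : Fin (2*a+b+2), (ρ i : ℕ) =
      if (i : ℕ) ≤ 2*a+1 then ((i : ℕ) + a + 1) % (2*a+2) else 4*a+b+3 - (i : ℕ))
    (hψ : ∀ i : Fin (2*a+b+2), (ψ i : ℕ) =
      if (i : ℕ) ≤ a+1 then a+1 - (i : ℕ)
      else if (i : ℕ) ≤ 2*a+1 then 3*a+3 - (i : ℕ)
      else 4*a+b+3 - (i : ℕ))
    (hp1 : ∀ i : Fin (2*a+b+2), (p1 i : ℕ) =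
      if (i : ℕ) ≤ a then (i : ℕ) + 1
      else if (i : ℕ) = a+1 then 0
      else (i : ℕ))
    (hp2 : ∀ i : Fin (2*a+b+2), (p2 i : ℕ) =
      if (i : ℕ) = 0 then (if b = 0 then a+1 else 2*a+2)
      else if (i : ℕ) = a+1 then 0
      else if 2*a+2 ≤ (i : ℕ) ∧ (i : ℕ) ≤ 2*a+b then (i : ℕ) + 1
      else if (i : ℕ) = 2*a+b+1 ∧ b ≠ 0 then a+1
      else (i : ℕ))
    (hp3 : ∀ i : Fin (2*a+b+2), (p3 i : ℕ) =
      if (i : ℕ) = 0 then 2*a+1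
      else if a+2 ≤ (i : ℕ) ∧ (i : ℕ) ≤ 2*a+1 then (i : ℕ) - 1
      else if (i : ℕ) = a+1 then 0
      else (i : ℕ))
    :
    ∃ Φ : (↥(MulAction.stabilizer (Equiv.Perm (Fin (2*a+b+2))) (0 : Fin (2*a+b+2))) × ZMod 2)
        ≃ (↥(MulAction.stabilizer (Equiv.Perm (Fin (2*a+b+2))) (0 : Fin (2*a+b+2))) × ZMod 2),
      ∀ x y,
        ((∃ p ∈ [p1, p2, p3], (y.1 : Equiv.Perm (Fin (2*a+b+2))) = (x.1 : Equiv.Perm (Fin (2*a+b+2))) * (p * ρ))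
            ∧ y.2 = x.2 + 1)
        ↔
        ((∃ p ∈ [p1, p2, p3], ((Φ y).1 : Equiv.Perm (Fin (2*a+b+2))) = ((Φ x).1 : Equiv.Perm (Fin (2*a+b+2))) * (p * ψ))
            ∧ (Φ y).2 = (Φ x).2 + 1) := by
  have hρ' : ∀ i : Fin (2*a+b+2), (ρ i : ℕ) =
      if (i : ℕ) ≤ a then (i : ℕ) + a + 1
      else if (i : ℕ) ≤ 2*a+1 then (i : ℕ) - (a + 1) else 4*a+b+3 - (i : ℕ) := by
    intro i
    rw [hρ]
    split_ifs with h1 h2 h2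
    · exact Nat.mod_eq_of_lt (by omega)
    · rw [Nat.mod_eq_sub_mod (by omega), Nat.mod_eq_of_lt (by omega)]
      omega
    · omega
    · rfl
  have hα : ∀ i : Fin (2*a+b+2), ((ρ * ψ) i : ℕ) =
      if (i : ℕ) = 0 then 0 else if (i : ℕ) ≤ 2*a+1 then 2*a+2 - (i : ℕ) else (i : ℕ) := by
    intro i
    have := i.isLt
    rw [Equiv.Perm.mul_apply, hρ', hψ]
    split_ifs <;> omega
  have hρρ : ρ * ρ = 1 := by
    ext i
    have := i.isLt
    rw [Equiv.Perm.mul_apply, hρ', hρ', Equiv.Perm.one_apply]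
    split_ifs <;> omega
  have hαα : ρ * ψ * (ρ * ψ) = 1 := by
    ext i
    have := i.isLt
    rw [Equiv.Perm.mul_apply, hα, hα, Equiv.Perm.one_apply]
    split_ifs <;> omega
  have hαψ : ρ * ψ * ψ = ρ := by
    ext i
    have := i.isLt
    rw [Equiv.Perm.mul_apply, hα, hψ, hρ']
    split_ifs <;> omega
  have h13 : ρ * ψ * p1 = p3 * (ρ * ψ) := by
    ext i
    have := i.isLt
    have h1 := hp1 i
    have h2 := hα i
    have h3 := hα (p1 i)
    have h4 := hp3 ((ρ * ψ) i)
    rw [Equiv.Perm.mul_apply, Equiv.Perm.mul_apply p3]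
    split_ifs at h1 <;> split_ifs at h2 <;> first | omega | (split_ifs at h3 h4 <;> omega)
  have h22 : ρ * ψ * p2 = p2 * (ρ * ψ) := by
    ext i
    have := i.isLt
    have h1 := hp2 i
    have h2 := hα i
    have h3 := hα (p2 i)
    have h4 := hp2 ((ρ * ψ) i)
    rw [Equiv.Perm.mul_apply, Equiv.Perm.mul_apply p2]
    split_ifs at h1 <;> split_ifs at h2 <;> first | omega | (split_ifs at h3 h4 <;> omega)
  have h31 : ρ * ψ * p3 = p1 * (ρ * ψ) := by
    rw [← mul_left_inj (ρ * ψ), mul_assoc, ← h13, mul_assoc p1, hαα, ← mul_assoc, hαα, one_mul,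
      mul_one]
  have hswap : ∀ p q, ρ * ψ * p = q * (ρ * ψ) → ρ * ψ * (p * ψ) = q * ρ := by
    intro p q h
    rw [← mul_assoc, h, mul_assoc, hαψ]
  refine exists_doubleCover_equiv _ [p1, p2, p3] ρ ψ (ρ * ψ) ?_ hαα ?_ ?_
  · rw [MulAction.mem_stabilizer_iff, Equiv.Perm.smul_def]
    ext
    rw [hα]
    simp
  · rw [← mul_assoc, hρρ, one_mul]
  · simp only [List.forall_mem_cons]
    exact ⟨⟨p3, by simp, hswap _ _ h13⟩, ⟨p2, by simp, hswap _ _ h22⟩,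
      ⟨p1, by simp, hswap _ _ h31⟩, by simp⟩
end

section
/- Let G be a finite group and S1, S2 finite subsets of G. Suppose φ : G × (ZMod 2) ≃ G × (ZMod 2) is a bijection preserving the second coordinate (i.e. (φ x).2 = x.2 for all x) such that for all x, y: (there exists s ∈ S1 with y = (x.1·s, x.2+1)) if and only if (there exists s ∈ S2 with φ y = ((φ x).1·s, (φ x).2+1)); define φ₀, φ₁ : G → G by φ(g,0) = (φ₀(g),0) and φ(g,1) = (φ₁(g),1). Then for every t ∈ ℕ and g, h ∈ G, the number of functions w : Fin t → S1 with g·(w 0)·(w 1)⋯(w (t−1)) = h equals the number of functions w : Fin t → S2 with φ₀(g)·(w 0)·(w 1)⋯(w (t−1)) = φ_{[t]}(h), where [t] ∈ {0,1} is t mod 2 (so φ_{[t]} = φ₀ if t is even and φ₁ if t is odd). -/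
/-- The number of length-`t` paths from `g` to `h` in the Cayley graph of `G` with respect to `S`. -/
def cayleyPathCount {G : Type*} [Group G] [DecidableEq G] (S : Finset G) (t : ℕ) (g h : G) : ℕ :=
  Fintype.card {w : Fin t → ↥S // g * (List.ofFn fun i => ((w i : G))).prod = h}

theorem cayleyPathCount_zero {G : Type*} [Group G] [DecidableEq G] (S : Finset G) (g h : G) :
    cayleyPathCount S 0 g h = if g = h then 1 else 0 := by
  simp [cayleyPathCount, Fintype.card_subtype, Finset.filter_const, apply_ite Finset.card]

theorem cayleyPathCount_succ {G : Type*} [Group G] [DecidableEq G] (S : Finset G) (t : ℕ)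
    (g h : G) :
    cayleyPathCount S (t + 1) g h = ∑ s : ↥S, cayleyPathCount S t (g * s) h := by
  unfold cayleyPathCount
  rw [← Fintype.card_sigma]
  refine Fintype.card_congr
    { toFun := fun w => ⟨w.1 0, fun i => w.1 i.succ, ?_⟩
      invFun := fun p => ⟨Fin.cons p.1 p.2.1, ?_⟩
      left_inv := ?_
      right_inv := ?_ }
  · simpa [List.ofFn_succ, mul_assoc] using w.2
  · simpa [List.ofFn_succ, mul_assoc] using p.2.2
  · rintro ⟨w, hw⟩
    exact Subtype.ext (Fin.cons_self_tail w)
  · rintro ⟨s, w, hw⟩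
    rfl

/-- A sequence of permutations carrying right multiplication by elements of `S1` to right
multiplication by elements of `S2` preserves the number of paths. -/
theorem cayleyPathCount_eq {G : Type*} [Group G] [DecidableEq G] (S1 S2 : Finset G)
    (f : ℕ → Equiv.Perm G)
    (hf : ∀ n g k, g⁻¹ * k ∈ S1 ↔ (f n g)⁻¹ * f (n + 1) k ∈ S2) (t n : ℕ) (g h : G) :
    cayleyPathCount S1 t g h = cayleyPathCount S2 t (f n g) (f (n + t) h) := by
  induction t generalizing n g with
  | zero => simp [cayleyPathCount_zero]
  | succ t ih =>
    rw [cayleyPathCount_succ, cayleyPathCount_succ]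
    let e : ↥S1 ≃ ↥S2 :=
      (((Equiv.mulLeft g).trans (f (n + 1))).trans (Equiv.mulLeft (f n g)⁻¹)).subtypeEquiv
        fun s => by simpa using hf n g (g * s)
    refine Fintype.sum_equiv e _ _ fun s => ?_
    have he : f n g * (e s : G) = f (n + 1) (g * s) := by simp [e]
    rw [he, ih (n + 1), add_right_comm, add_assoc n t 1]


theorem path_count_bijection (G : Type*) [Group G] [Fintype G] [DecidableEq G]
    (S1 S2 : Finset G)
    (φ : G × ZMod 2 ≃ G × ZMod 2)
    (hpres : ∀ x : G × ZMod 2, (φ x).2 = x.2)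
    (hedge : ∀ x y : G × ZMod 2,
      (∃ s ∈ S1, y = (x.1 * s, x.2 + 1)) ↔ (∃ s ∈ S2, φ y = ((φ x).1 * s, (φ x).2 + 1)))
    (φ0 φ1 : G → G)
    (hφ0 : ∀ g : G, φ (g, 0) = (φ0 g, 0))
    (hφ1 : ∀ g : G, φ (g, 1) = (φ1 g, 1)) :
    ∀ (t : ℕ) (g h : G),
      Fintype.card {w : Fin t → ↥S1 // g * (List.ofFn fun i => ((w i : G))).prod = h}
        = Fintype.card {w : Fin t → ↥S2 //
            φ0 g * (List.ofFn fun i => ((w i : G))).prod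
              = (if t % 2 = 0 then φ0 h else φ1 h)} := by
  have hinj (i : ZMod 2) : Function.Injective fun g : G => (φ (g, i)).1 := fun a b hab => by
    have h : φ (a, i) = φ (b, i) := Prod.ext hab (by rw [hpres, hpres])
    exact congrArg Prod.fst (φ.injective h)
  let f (n : ℕ) : Equiv.Perm G :=
    Equiv.ofBijective _ (Finite.injective_iff_bijective.mp (hinj (n : ZMod 2)))
  have hf_apply (n : ℕ) (g : G) : f n g = (φ (g, (n : ZMod 2))).1 := rfl
  have hf (n : ℕ) (g k : G) : g⁻¹ * k ∈ S1 ↔ (f n g)⁻¹ * f (n + 1) k ∈ S2 := by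
    have h := hedge (g, (n : ZMod 2)) (k, (n : ZMod 2) + 1)
    simp only [Prod.ext_iff, hpres, and_true, ← inv_mul_eq_iff_eq_mul, exists_eq_right'] at h
    rw [hf_apply, hf_apply, Nat.cast_succ]
    exact h
  intro t g h
  have hg : f 0 g = φ0 g := by simp [hf_apply, hφ0]
  have hh : f (0 + t) h = if t % 2 = 0 then φ0 h else φ1 h := by
    rw [hf_apply, zero_add, ← ZMod.natCast_mod t 2]
    rcases Nat.mod_two_eq_zero_or_one t with ht | ht <;> simp [ht, hφ0, hφ1]
  rw [← hg, ← hh]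
  exact cayleyPathCount_eq S1 S2 f hf t 0 g h
end

section
/- Let G be a finite group and S1, S2 nonempty finite subsets of G with |S1| = |S2| = d. Suppose φ : G × (ZMod 2) ≃ G × (ZMod 2) is a bijection preserving the second coordinate, with φ(1,0) = (1,0), such that for all x, y: (∃ s ∈ S1, y = (x.1·s, x.2+1)) iff (∃ s ∈ S2, φ y = ((φ x).1·s, (φ x).2+1)); define φ₀, φ₁ : G → G by φ(g,0) = (φ₀(g),0) and φ(g,1) = (φ₁(g),1). Let μ₁, μ₂ : ℕ → G → ℚ be the simple random walks started at the identity, with step sets S1 and S2 respectively (μ_i 0 g = 1 if g = 1 else 0; μ_i (t+1) g = (1/d)·∑_{k∈S_i} μ_i t (g·k⁻¹)). Then for all t ∈ ℕ and g ∈ G: μ₁ t g = μ₂ t (φ_{[t]}(g)), where [t] = t mod 2; and consequently ∑_{g∈G} |μ₁ t g − 1/|G|| = ∑_{g∈G} |μ₂ t g − 1/|G||, i.e. the two walks have equal total variation distance from the uniform distribution at every step. -/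
/-- If `a` is a bijection and the pair `(a, b)` carries the edges of the Cayley graph of `S1` to those
of the Cayley graph of `S2`, then it carries sums over in-neighbours to sums over in-neighbours. -/
theorem sum_mul_inv_eq_of_cayley_edges {G M : Type*} [Group G] [AddCommMonoid M]
    {S1 S2 : Finset G} {a b : G → G} (ha : Function.Bijective a)
    (hab : ∀ g h : G, g⁻¹ * h ∈ S1 ↔ (a g)⁻¹ * b h ∈ S2) (F : G → M) (g : G) :
    ∑ k ∈ S1, F (a (g * k⁻¹)) = ∑ s ∈ S2, F (b g * s⁻¹) := by
  refine Finset.sum_bij (fun k _ => (a (g * k⁻¹))⁻¹ * b g) ?_ ?_ ?_ ?_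
  · intro k hk
    exact (hab _ _).1 (by simpa using hk)
  · intro k _ l _ h
    simpa using ha.1 (inv_injective (mul_right_cancel h))
  · intro s hs
    obtain ⟨x, hx⟩ := ha.2 (b g * s⁻¹)
    refine ⟨x⁻¹ * g, (hab _ _).2 ?_, ?_⟩
    · simpa [hx] using hs
    · simp [hx]
  · intro k _
    simp


theorem random_walks_equal_tv_distance (G : Type*) [Group G] [Fintype G] [DecidableEq G]
    (S1 S2 : Finset G) (d : ℕ) (hd : 0 < d)
    (hS1 : S1.card = d) (hS2 : S2.card = d)
    (φ : G × ZMod 2 ≃ G × ZMod 2)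
    (hpres : ∀ x : G × ZMod 2, (φ x).2 = x.2)
    (hone : φ (1, 0) = (1, 0))
    (hedge : ∀ x y : G × ZMod 2,
      (∃ s ∈ S1, y = (x.1 * s, x.2 + 1)) ↔ (∃ s ∈ S2, φ y = ((φ x).1 * s, (φ x).2 + 1)))
    (φ0 φ1 : G → G)
    (hφ0 : ∀ g : G, φ (g, 0) = (φ0 g, 0))
    (hφ1 : ∀ g : G, φ (g, 1) = (φ1 g, 1))
    (μ1 μ2 : ℕ → G → ℚ)
    (hμ10 : ∀ g : G, μ1 0 g = if g = 1 then 1 else 0)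
    (hμ20 : ∀ g : G, μ2 0 g = if g = 1 then 1 else 0)
    (hμ1 : ∀ (t : ℕ) (g : G), μ1 (t+1) g = (1 / (d : ℚ)) * ∑ k ∈ S1, μ1 t (g * k⁻¹))
    (hμ2 : ∀ (t : ℕ) (g : G), μ2 (t+1) g = (1 / (d : ℚ)) * ∑ k ∈ S2, μ2 t (g * k⁻¹)) :
    (∀ (t : ℕ) (g : G), μ1 t g = μ2 t (if t % 2 = 0 then φ0 g else φ1 g)) ∧
    (∀ t : ℕ,
      ∑ g : G, |μ1 t g - 1 / (Fintype.card G : ℚ)|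
        = ∑ g : G, |μ2 t g - 1 / (Fintype.card G : ℚ)|) := by
  have edge : ∀ (i : ZMod 2) (a b : G → G), (∀ g, φ (g, i) = (a g, i)) →
      (∀ g, φ (g, i + 1) = (b g, i + 1)) → ∀ g h, g⁻¹ * h ∈ S1 ↔ (a g)⁻¹ * b h ∈ S2 := by
    intro i a b ha hb g h
    simpa [ha, hb, ← inv_mul_eq_iff_eq_mul] using hedge (g, i) (h, i + 1)
  have bij : ∀ (i : ZMod 2) (a : G → G), (∀ g, φ (g, i) = (a g, i)) → Function.Bijective a := by
    intro i a ha
    refine Finite.injective_iff_bijective.1 fun x y hxy => ?_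
    have h : φ (x, i) = φ (y, i) := by rw [ha, ha, hxy]
    exact congrArg Prod.fst (φ.injective h)
  have b0 := bij 0 φ0 hφ0
  have b1 := bij 1 φ1 hφ1
  have e01 := edge 0 φ0 φ1 hφ0 (by simpa using hφ1)
  have e10 := edge 1 φ1 φ0 hφ1 hφ0
  have h1 : φ0 1 = 1 := congrArg Prod.fst ((hφ0 1).symm.trans hone)
  have transport : ∀ (t : ℕ) (g : G), μ1 t g = μ2 t (if t % 2 = 0 then φ0 g else φ1 g) := by
    intro t
    induction t with
    | zero =>
      intro g
      have hg : φ0 g = 1 ↔ g = 1 := by rw [← b0.1.eq_iff (a := g) (b := 1), h1]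
      simp [hμ10, hμ20, hg]
    | succ t ih =>
      intro g
      rw [hμ1, hμ2]
      rcases Nat.mod_two_eq_zero_or_one t with ht | ht
      · have ht' : (t + 1) % 2 = 1 := by omega
        simp only [ih, ht, ht', if_true, one_ne_zero, if_false]
        rw [sum_mul_inv_eq_of_cayley_edges b0 e01]
      · have ht' : (t + 1) % 2 = 0 := by omega
        simp only [ih, ht, ht', if_true, one_ne_zero, if_false]
        rw [sum_mul_inv_eq_of_cayley_edges b1 e10]
  refine ⟨transport, fun t => ?_⟩
  have bt : Function.Bijective fun g => if t % 2 = 0 then φ0 g else φ1 g := by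
    split_ifs
    exacts [b0, b1]
  exact Fintype.sum_bijective _ bt _ _ fun g => by rw [transport t g]
end

section
/- Let G = Perm(Fin 3) be the symmetric group on three letters {1,2,3} (identified with Fin 3), σ the 3-cycle mapping 1↦3, 3↦2, 2↦1, and τ the transposition swapping 1 and 3. Set S1 = {σ, σ⁻¹, τ} and S2 = {τ, τ·σ, 1} (each a set of three distinct elements). Let μ₁, μ₂ : ℕ → G → ℚ be the simple random walks started at the identity with step sets S1, S2 respectively: μ_i 0 g = 1 if g = 1 else 0, and μ_i (t+1) g = (1/3)·∑_{k∈S_i} μ_i t (g·k⁻¹). Then for every t ∈ ℕ: ∑_{g∈G} |μ₁ t g − 1/6| = ∑_{g∈G} |μ₂ t g − 1/6|; that is, the simple random walks on the non-isomorphic Cayley graphs Cay(𝔖₃, S1) and Cay(𝔖₃, S2) have the same total variation distance from the uniform distribution at every step. -/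
/-- The 3-cycle σ = (1,3,2) on {1,2,3} ≅ Fin 3, mapping 1↦3, 3↦2, 2↦1. -/
def sigma3 : Equiv.Perm (Fin 3) := Equiv.swap 0 1 * Equiv.swap 0 2

/-- The transposition τ = (1,3) on {1,2,3} ≅ Fin 3. -/
def tau3 : Equiv.Perm (Fin 3) := Equiv.swap 0 2

/-- A sum over the symmetric group on three letters, written out in terms of `sigma3`, `tau3`. -/
lemma sum_perm_fin_three (f : Equiv.Perm (Fin 3) → ℚ) :
    ∑ g, f g = f 1 + f sigma3 + f sigma3⁻¹ + f tau3 + f (tau3 * sigma3) + f (sigma3 * tau3) := by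
  have huniv : (Finset.univ : Finset (Equiv.Perm (Fin 3))) =
      {1, sigma3, sigma3⁻¹, tau3, tau3 * sigma3, sigma3 * tau3} := by decide
  rw [huniv, Finset.sum_insert (by decide), Finset.sum_insert (by decide),
    Finset.sum_insert (by decide), Finset.sum_insert (by decide), Finset.sum_insert (by decide),
    Finset.sum_singleton]
  ring

/-- One step of the random walk with step set `{σ, σ⁻¹, τ}`. -/
lemma step_sigma_sigma_inv_tau {μ ν : Equiv.Perm (Fin 3) → ℚ}
    (h : ∀ g, ν g = (1/3 : ℚ) * ∑ k ∈ ({sigma3, sigma3⁻¹, tau3} : Finset (Equiv.Perm (Fin 3))),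
      μ (g * k⁻¹)) :
    ν 1 = (1/3 : ℚ) * (μ sigma3⁻¹ + μ sigma3 + μ tau3) ∧
    ν sigma3 = (1/3 : ℚ) * (μ 1 + μ sigma3⁻¹ + μ (sigma3 * tau3)) ∧
    ν sigma3⁻¹ = (1/3 : ℚ) * (μ sigma3 + μ 1 + μ (tau3 * sigma3)) ∧
    ν tau3 = (1/3 : ℚ) * (μ (sigma3 * tau3) + μ (tau3 * sigma3) + μ 1) ∧
    ν (tau3 * sigma3) = (1/3 : ℚ) * (μ tau3 + μ (sigma3 * tau3) + μ sigma3⁻¹) ∧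
    ν (sigma3 * tau3) = (1/3 : ℚ) * (μ (tau3 * sigma3) + μ tau3 + μ sigma3) := by
  have hsum : ∀ g, ν g = (1/3 : ℚ) *
      (μ (g * sigma3⁻¹) + μ (g * sigma3⁻¹⁻¹) + μ (g * tau3⁻¹)) := fun g => by
    rw [h, Finset.sum_insert (by decide), Finset.sum_insert (by decide),
      Finset.sum_singleton, add_assoc]
  refine ⟨?_, ?_, ?_, ?_, ?_, ?_⟩ <;> refine (hsum _).trans (congrArg _
    (congrArg₂ _ (congrArg₂ _ (congrArg μ ?_) (congrArg μ ?_)) (congrArg μ ?_))) <;> decide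

/-- One step of the random walk with step set `{τ, τσ, 1}`. -/
lemma step_tau_tau_sigma_one {μ ν : Equiv.Perm (Fin 3) → ℚ}
    (h : ∀ g, ν g = (1/3 : ℚ) * ∑ k ∈ ({tau3, tau3 * sigma3, 1} : Finset (Equiv.Perm (Fin 3))),
      μ (g * k⁻¹)) :
    ν 1 = (1/3 : ℚ) * (μ tau3 + μ (tau3 * sigma3) + μ 1) ∧
    ν sigma3 = (1/3 : ℚ) * (μ (sigma3 * tau3) + μ tau3 + μ sigma3) ∧
    ν sigma3⁻¹ = (1/3 : ℚ) * (μ (tau3 * sigma3) + μ (sigma3 * tau3) + μ sigma3⁻¹) ∧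
    ν tau3 = (1/3 : ℚ) * (μ 1 + μ sigma3 + μ tau3) ∧
    ν (tau3 * sigma3) = (1/3 : ℚ) * (μ sigma3⁻¹ + μ 1 + μ (tau3 * sigma3)) ∧
    ν (sigma3 * tau3) = (1/3 : ℚ) * (μ sigma3 + μ sigma3⁻¹ + μ (sigma3 * tau3)) := by
  have hsum : ∀ g, ν g = (1/3 : ℚ) *
      (μ (g * tau3⁻¹) + μ (g * (tau3 * sigma3)⁻¹) + μ (g * 1⁻¹)) := fun g => by
    rw [h, Finset.sum_insert (by decide), Finset.sum_insert (by decide),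
      Finset.sum_singleton, add_assoc]
  refine ⟨?_, ?_, ?_, ?_, ?_, ?_⟩ <;> refine (hsum _).trans (congrArg _
    (congrArg₂ _ (congrArg₂ _ (congrArg μ ?_) (congrArg μ ?_)) (congrArg μ ?_))) <;> decide

/-- The pattern shared by the two walks after at least one step: up to a permutation of the group
and a global sign `ε`, their deviations from uniform are `a, a, b, b, b, b` in absolute value. -/
def MatchedDeviations (μ ν : Equiv.Perm (Fin 3) → ℚ) (ε a b : ℚ) : Prop :=
  (μ 1 = 1/6 + ε * a ∧ μ sigma3 = 1/6 - ε * b ∧ μ sigma3⁻¹ = 1/6 - ε * b ∧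
    μ tau3 = 1/6 - ε * a ∧ μ (tau3 * sigma3) = 1/6 + ε * b ∧
    μ (sigma3 * tau3) = 1/6 + ε * b) ∧
  (ν 1 = 1/6 + a ∧ ν sigma3 = 1/6 - b ∧ ν sigma3⁻¹ = 1/6 - b ∧
    ν tau3 = 1/6 + b ∧ ν (tau3 * sigma3) = 1/6 + b ∧ ν (sigma3 * tau3) = 1/6 - a)

lemma MatchedDeviations.sum_abs_eq {μ ν : Equiv.Perm (Fin 3) → ℚ} {ε a b : ℚ}
    (h : MatchedDeviations μ ν ε a b) (hε : |ε| = 1) :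
    ∑ g, |μ g - 1/6| = ∑ g, |ν g - 1/6| := by
  obtain ⟨⟨h1, h2, h3, h4, h5, h6⟩, k1, k2, k3, k4, k5, k6⟩ := h
  have hadd : ∀ x y : ℚ, |x + y - x| = |y| := fun x y => by rw [add_sub_cancel_left]
  have hsub : ∀ x y : ℚ, |x - y - x| = |y| := fun x y => by rw [sub_sub_cancel_left, abs_neg]
  simp only [sum_perm_fin_three, h1, h2, h3, h4, h5, h6, k1, k2, k3, k4, k5, k6, hadd, hsub,
    abs_mul, hε, one_mul]
  ring

theorem S3_walks_equal_tv_distance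
    (μ1 μ2 : ℕ → Equiv.Perm (Fin 3) → ℚ)
    (hμ10 : ∀ g, μ1 0 g = if g = 1 then 1 else 0)
    (hμ20 : ∀ g, μ2 0 g = if g = 1 then 1 else 0)
    (hμ1 : ∀ (t : ℕ) (g : Equiv.Perm (Fin 3)),
      μ1 (t+1) g = (1/3 : ℚ) * ∑ k ∈ ({sigma3, sigma3⁻¹, tau3} : Finset (Equiv.Perm (Fin 3))),
        μ1 t (g * k⁻¹))
    (hμ2 : ∀ (t : ℕ) (g : Equiv.Perm (Fin 3)),
      μ2 (t+1) g = (1/3 : ℚ) * ∑ k ∈ ({tau3, tau3 * sigma3, 1} : Finset (Equiv.Perm (Fin 3))),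
        μ2 t (g * k⁻¹)) :
    ∀ t : ℕ,
      ∑ g : Equiv.Perm (Fin 3), |μ1 t g - 1/6|
        = ∑ g : Equiv.Perm (Fin 3), |μ2 t g - 1/6| := by
  have hmatch : ∀ t, ∃ ε a b : ℚ, |ε| = 1 ∧ MatchedDeviations (μ1 (t + 1)) (μ2 (t + 1)) ε a b := by
    intro t
    induction t with
    | zero =>
      obtain ⟨h1, h2, h3, h4, h5, h6⟩ := step_sigma_sigma_inv_tau (hμ1 0)
      obtain ⟨k1, k2, k3, k4, k5, k6⟩ := step_tau_tau_sigma_one (hμ2 0)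
      have e2 : sigma3 ≠ 1 := by decide
      have e3 : sigma3⁻¹ ≠ 1 := by decide
      have e4 : tau3 ≠ 1 := by decide
      have e5 : tau3 * sigma3 ≠ 1 := by decide
      have e6 : sigma3 * tau3 ≠ 1 := by decide
      simp only [hμ10, hμ20, if_pos, if_neg e2, if_neg e3, if_neg e4, if_neg e5, if_neg e6]
        at h1 h2 h3 h4 h5 h6 k1 k2 k3 k4 k5 k6
      refine ⟨-1, 1/6, 1/6, by norm_num, ⟨?_, ?_, ?_, ?_, ?_, ?_⟩, ?_, ?_, ?_, ?_, ?_, ?_⟩ <;>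
        linarith
    | succ t ih =>
      obtain ⟨ε, a, b, hε, ⟨p1, p2, p3, p4, p5, p6⟩, q1, q2, q3, q4, q5, q6⟩ := ih
      obtain ⟨h1, h2, h3, h4, h5, h6⟩ := step_sigma_sigma_inv_tau (hμ1 (t + 1))
      obtain ⟨k1, k2, k3, k4, k5, k6⟩ := step_tau_tau_sigma_one (hμ2 (t + 1))
      refine ⟨-ε, (a + 2 * b) / 3, a / 3, by rwa [abs_neg],
        ⟨?_, ?_, ?_, ?_, ?_, ?_⟩, ?_, ?_, ?_, ?_, ?_, ?_⟩ <;> linarith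
  intro t
  cases t with
  | zero => simp only [hμ10, hμ20]
  | succ t =>
    obtain ⟨ε, a, b, hε, h⟩ := hmatch t
    exact h.sum_abs_eq hε
end

section
/- Let G = Perm(Fin 3), σ the 3-cycle mapping 1↦3, 3↦2, 2↦1, and τ the transposition swapping 1 and 3 (letters {1,2,3} identified with Fin 3). Set S1 = {σ, σ⁻¹, τ} and S2 = {τ, τ·σ, 1}. Let A₁, A₂ be the adjacency matrices over ℤ of the Cayley graphs Cay(G,S1) and Cay(G,S2), i.e. A_i g h = 1 if h = g·s for some s ∈ S_i and 0 otherwise. Then the characteristic polynomial of A₁ is (X−3)(X−1)X²(X+2)² and the characteristic polynomial of A₂ is (X−3)(X−2)²X²(X+1). In particular, writing P_Z(X) = (X−3)X², the spectral sets decompose so that P₁(X)/P_Z(X) = −P₂(−X)/P_Z(−X), i.e. P₁(X)·P_Z(−X) = −P₂(−X)·P_Z(X). -/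
open Polynomial

/-- The common spectral factor P_Z(X) = (X − 3)·X². -/
noncomputable def PZ3 : Polynomial ℤ := (X - C 3) * X ^ 2

/-- An enumeration of `Perm (Fin 3)` by its rotations and reflections. -/
def permEnum : Fin 6 → Equiv.Perm (Fin 3) :=
  ![1, sigma3, sigma3⁻¹, tau3, sigma3 * tau3, sigma3⁻¹ * tau3]

theorem permEnum_bijective : Function.Bijective permEnum := by
  decide

/-- Triangularizing a matrix, after reindexing by a bijection, computes its characteristic
polynomial. -/
theorem Matrix.charpoly_eq_prod_of_triangularization {R m n : Type*} [CommRing R]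
    [Fintype m] [LinearOrder m] [Fintype n] [DecidableEq n]
    {A : Matrix n n R} {f : m → n} (hf : f.Bijective) {U T V : Matrix m m R}
    (hA : A.submatrix f f = U * (T * V)) (hVU : V * U = 1) (hT : T.IsUpperTriangular) :
    A.charpoly = ∏ i, (X - C (T i i)) := by
  have h : (A.submatrix f f).charpoly = A.charpoly :=
    Matrix.charpoly_reindex (Equiv.ofBijective f hf).symm A
  rw [← h, hA, Matrix.charpoly_mul_comm, Matrix.mul_assoc, hVU, Matrix.mul_one,
    Matrix.charpoly_of_isUpperTriangular _ hT]

theorem S3_cayley_charpolys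
    (A1 A2 : Matrix (Equiv.Perm (Fin 3)) (Equiv.Perm (Fin 3)) ℤ)
    (hA1 : ∀ g h : Equiv.Perm (Fin 3),
      A1 g h = if h = g * sigma3 ∨ h = g * sigma3⁻¹ ∨ h = g * tau3 then 1 else 0)
    (hA2 : ∀ g h : Equiv.Perm (Fin 3),
      A2 g h = if h = g * tau3 ∨ h = g * (tau3 * sigma3) ∨ h = g * 1 then 1 else 0) :
    A1.charpoly = (X - C 3) * (X - C 1) * X ^ 2 * (X + C 2) ^ 2 ∧
    A2.charpoly = (X - C 3) * (X - C 2) ^ 2 * X ^ 2 * (X + C 1) ∧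
    A1.charpoly * (PZ3.comp (-X)) = -(A2.charpoly.comp (-X)) * PZ3 := by
  have h1 : A1.charpoly = (X - C 3) * (X - C 1) * X ^ 2 * (X + C 2) ^ 2 := by
    rw [Matrix.charpoly_eq_prod_of_triangularization permEnum_bijective
      (U := !![1, 0, 0, 0, 0, 0;
         1, 0, 1, -1, 0, 0;
         1, 0, 0, 1, 0, 0;
         1, 1, -1, 1, 0, 0;
         1, 1, 0, 0, 1, 0;
         1, 1, -1, 2, 0, 1])
      (T := !![3, 1, 0, 1, 0, 0;
         0, 1, -1, 1, 2, 1;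
         0, 0, 0, 0, 1, 1;
         0, 0, 0, 0, 0, 1;
         0, 0, 0, 0, -2, 0;
         0, 0, 0, 0, 0, -2])
      (V := !![1, 0, 0, 0, 0, 0;
         -2, 1, 0, 1, 0, 0;
         -2, 1, 1, 0, 0, 0;
         -1, 0, 1, 0, 0, 0;
         1, -1, 0, -1, 1, 0;
         1, 0, -1, -1, 0, 1])
      (by rw [show A1 = Matrix.of _ from Matrix.ext hA1]; decide) (by decide)
      (by intro i j; fin_cases i <;> fin_cases j <;> simp)]
    simp only [Fin.prod_univ_six, Matrix.cons_val, Matrix.of_apply, map_zero, map_neg]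
    ring
  have h2 : A2.charpoly = (X - C 3) * (X - C 2) ^ 2 * X ^ 2 * (X + C 1) := by
    rw [Matrix.charpoly_eq_prod_of_triangularization permEnum_bijective
      (U := !![1, 0, 0, 0, 0, 0;
         1, 2, 3, 0, 2, 2;
         1, 1, 3, 0, 2, 2;
         1, 1, 1, -1, 0, 0;
         1, 2, 4, 1, 3, 2;
         1, 0, 1, 0, 1, 1])
      (T := !![3, 1, 2, -1, 1, 1;
         0, 2, 0, -1, -1, -1;
         0, 0, 2, 1, 2, 1;
         0, 0, 0, 0, 0, -1;
         0, 0, 0, 0, 0, 2;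
         0, 0, 0, 0, 0, -1])
      (V := !![1, 0, 0, 0, 0, 0;
         0, 1, -1, 0, 0, 0;
         1, -1, 2, 0, 0, -2;
         2, 0, 1, -1, 0, -2;
         -3, 0, -3, 1, 1, 4;
         1, 1, 1, -1, -1, -1])
      (by rw [show A2 = Matrix.of _ from Matrix.ext hA2]; decide) (by decide)
      (by intro i j; fin_cases i <;> fin_cases j <;> simp)]
    simp only [Fin.prod_univ_six, Matrix.cons_val, Matrix.of_apply, map_zero, map_neg]
    ring
  refine ⟨h1, h2, ?_⟩
  rw [h1, h2, PZ3]
  simp only [mul_comp, pow_comp, sub_comp, add_comp, X_comp, C_comp, map_one, one_comp]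
  ring
end
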